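/- arXiv:1306.1998 — 2 statements merged into one kernel-verified Lean document; each statement's English description precedes it below -/
import Mathlib

section
/- Let H ∈ (0, 1/2) and T > 0. Then limsup_{u→∞} P(M_H(T) > u) / (u^{2/H − 2} Ψ(u)) ≤ (T/H) · (1/2)^{1/H} · 𝓗_{2H}². -/
open MeasureTheory ProbabilityTheory Real Filter Set

/-- Tail `Ψ(u) = P(N > u)` of a standard normal random variable. -/
noncomputable def stdNormalTail (u : ℝ) : ℝ :=
  ((ProbabilityTheory.gaussianReal 0 1) (Set.Ioi u)).toReal

/-- A crude second-order Taylor bound from a bound on the third derivative. -/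
lemma abs_taylor_two_sub_le {f f₁ f₂ f₃ : ℝ → ℝ} {M s : ℝ} (hs : 0 ≤ s)
    (h₁ : ∀ x, HasDerivAt f (f₁ x) x) (h₂ : ∀ x, HasDerivAt f₁ (f₂ x) x)
    (h₃ : ∀ x, HasDerivAt f₂ (f₃ x) x) (hM : ∀ x ∈ Icc 0 s, |f₃ x| ≤ M) :
    |f s - f 0 - s * f₁ 0 - s ^ 2 / 2 * f₂ 0| ≤ M * s ^ 3 := by
  have mvt : ∀ (g g' : ℝ → ℝ) (C : ℝ), (∀ x, HasDerivAt g (g' x) x) →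
      (∀ x ∈ Icc 0 s, |g' x| ≤ C) → ∀ x ∈ Icc 0 s, |g x - g 0| ≤ C * s := by
    intro g g' C hg hC x hx
    have h := (convex_Icc (0:ℝ) s).norm_image_sub_le_of_norm_hasDerivWithin_le
      (f := g) (f' := g') (C := C) (fun y _ => (hg y).hasDerivWithinAt) hC
      (left_mem_Icc.2 hs) hx
    have hC0 : 0 ≤ C := (abs_nonneg _).trans (hC x hx)
    refine h.trans ?_
    rw [Real.norm_eq_abs, sub_zero, abs_of_nonneg hx.1]
    exact mul_le_mul_of_nonneg_left hx.2 hC0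
  have e₂ := mvt f₂ f₃ M h₃ hM
  have e₁ := mvt (fun x => f₁ x - x * f₂ 0) (fun x => f₂ x - f₂ 0) (M * s)
    (fun x => ((h₂ x).sub ((hasDerivAt_id x).mul_const (f₂ 0))).congr_deriv (by simp)) e₂
  have e₀ := mvt (fun x => f x - x * f₁ 0 - x ^ 2 / 2 * f₂ 0)
    (fun x => f₁ x - f₁ 0 - x * f₂ 0) (M * s * s)
    (fun x => by
      have := ((h₁ x).sub ((hasDerivAt_id x).mul_const (f₁ 0))).sub
        ((((hasDerivAt_pow 2 x).div_const 2)).mul_const (f₂ 0))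
      refine this.congr_deriv ?_
      simp)
    (fun x hx => by
      have := e₁ x hx
      simp only [zero_mul, sub_zero] at this
      rwa [show f₁ x - f₁ 0 - x * f₂ 0 = f₁ x - x * f₂ 0 - f₁ 0 by ring]) s (right_mem_Icc.2 hs)
  have : f s - f 0 - s * f₁ 0 - s ^ 2 / 2 * f₂ 0 =
      f s - s * f₁ 0 - s ^ 2 / 2 * f₂ 0 - (f 0 - 0 * f₁ 0 - 0 ^ 2 / 2 * f₂ 0) := by ring
  rw [this]
  exact e₀.trans_eq (by ring)

/-- The `ℓᵖ` norm of the vector `(exp (w i))`. -/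
noncomputable def expNorm {ι : Type*} [Fintype ι] (p : ℝ) (w : ι → ℝ) : ℝ :=
  (∑ i, exp (p * w i)) ^ (1 / p)

section expNorm
variable {ι : Type*} [Fintype ι] {p : ℝ}

lemma expNorm_nonneg (w : ι → ℝ) : 0 ≤ expNorm p w := by
  unfold expNorm; positivity

lemma continuous_expNorm (hp : 1 ≤ p) : Continuous (expNorm p : (ι → ℝ) → ℝ) := by
  unfold expNorm
  exact Continuous.rpow_const (by fun_prop) fun _ => Or.inr (by positivity)

lemma expNorm_le_sum (hp : 1 ≤ p) (w : ι → ℝ) : expNorm p w ≤ ∑ i, exp (w i) := by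
  have hp0 : 0 < p := by linarith
  set Y := ∑ i, exp (w i) with hY
  have hY0 : 0 ≤ Y := by positivity
  have : ∑ i, exp (p * w i) ≤ Y ^ p := by
    calc ∑ i, exp (p * w i) = ∑ i, exp (w i) * exp (w i) ^ (p - 1) := by
          refine Finset.sum_congr rfl fun i _ => ?_
          rw [← Real.exp_mul, ← Real.exp_add]; congr 1; ring
      _ ≤ ∑ i, exp (w i) * Y ^ (p - 1) := by
          refine Finset.sum_le_sum fun i hi => ?_
          refine mul_le_mul_of_nonneg_left ?_ (exp_pos _).le
          refine Real.rpow_le_rpow (exp_pos _).le ?_ (by linarith)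
          exact Finset.single_le_sum (f := fun i => exp (w i)) (fun j _ => (exp_pos _).le) hi
      _ = Y * Y ^ (p - 1) := by rw [← Finset.sum_mul]
      _ = Y ^ p := by
          rcases hY0.eq_or_lt with h | h
          · rw [← h, zero_mul, Real.zero_rpow hp0.ne']
          · rw [← Real.rpow_one_add' hY0 (by linarith)]; congr 1; ring
  calc expNorm p w ≤ (Y ^ p) ^ (1 / p) := by unfold expNorm; gcongr
    _ = Y := by rw [← Real.rpow_mul hY0, mul_one_div_cancel hp0.ne', Real.rpow_one]

lemma exp_le_expNorm (hp : 1 ≤ p) (w : ι → ℝ) (i : ι) : exp (w i) ≤ expNorm p w := by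
  have hp0 : 0 < p := by linarith
  calc exp (w i) = exp (p * w i) ^ (1 / p) := by
        rw [← Real.exp_mul]; congr 1; field_simp
    _ ≤ expNorm p w := by
        unfold expNorm
        gcongr
        exact Finset.single_le_sum (f := fun i => exp (p * w i)) (fun j _ => (exp_pos _).le)
          (Finset.mem_univ i)

lemma expNorm_le_of_forall_exp_le (hp : 1 ≤ p) (w : ι → ℝ) {m : ℝ} (hm : ∀ i, exp (w i) ≤ m)
    (hm0 : 0 ≤ m) : expNorm p w ≤ (Fintype.card ι : ℝ) ^ (1 / p) * m := by
  have hp0 : 0 < p := by linarith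
  calc expNorm p w ≤ (∑ _i : ι, m ^ p) ^ (1 / p) := by
        unfold expNorm
        gcongr with i
        rw [mul_comm, Real.exp_mul]
        exact Real.rpow_le_rpow (exp_pos _).le (hm i) hp0.le
    _ = (Fintype.card ι : ℝ) ^ (1 / p) * m := by
        rw [Finset.sum_const, Finset.card_univ, nsmul_eq_mul, Real.mul_rpow (by positivity)
          (by positivity), ← Real.rpow_mul hm0, mul_one_div_cancel hp0.ne', Real.rpow_one]

/-- The weights of the gradient of `expNorm`. -/
noncomputable def softWeight (p : ℝ) (w : ι → ℝ) (i : ι) : ℝ :=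
  exp (p * w i) / ∑ j, exp (p * w j)

lemma softWeight_nonneg (w : ι → ℝ) (i : ι) : 0 ≤ softWeight p w i := by
  unfold softWeight; positivity

lemma sum_softWeight [Nonempty ι] (w : ι → ℝ) : ∑ i, softWeight p w i = 1 := by
  unfold softWeight
  rw [← Finset.sum_div, div_self]
  exact (Finset.sum_pos (fun i _ => exp_pos _) Finset.univ_nonempty).ne'

lemma expNorm_taylor [Nonempty ι] (hp : 1 ≤ p) (w x c : ι → ℝ) {m s : ℝ} (hm : 1 ≤ m)
    (hc : ∀ i, 0 ≤ c i) (hxm : ∀ i, |x i| + c i ≤ m) (hs : s ∈ Icc (0:ℝ) 1) :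
    |expNorm p (fun i => w i + s * x i - s ^ 2 * c i / 2) - expNorm p w
      - s * (expNorm p w * ∑ i, softWeight p w i * x i)
      - s ^ 2 / 2 * (expNorm p w * (p * ∑ i, softWeight p w i * x i ^ 2
          - ∑ i, softWeight p w i * c i + (1 - p) * (∑ i, softWeight p w i * x i) ^ 2))|
      ≤ 15 * p ^ 3 * m ^ 3 * (∑ i, exp (w i + m)) * s ^ 3 := by
  have hp0 : 0 < p := by linarith
  obtain ⟨a, ha⟩ : ∃ a, a = 1 / p := ⟨_, rfl⟩
  have hap : a * p = 1 := by rw [ha]; field_simp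
  have ha0 : 0 ≤ a := by rw [ha]; positivity
  have ha1 : a ≤ 1 := by rw [ha, div_le_one hp0]; exact hp
  let q : ι → ℝ → ℝ := fun i s => w i + s * x i - s ^ 2 * c i / 2
  let q' : ι → ℝ → ℝ := fun i s => x i - s * c i
  have hq : ∀ i s, HasDerivAt (q i) (q' i s) s := by
    intro i s
    have := (((hasDerivAt_id s).mul_const (x i)).const_add (w i)).sub
      (((hasDerivAt_pow 2 s).mul_const (c i)).div_const 2)
    refine this.congr_deriv ?_
    simp [q']; ring
  have hq' : ∀ i s, HasDerivAt (q' i) (-c i) s := by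
    intro i s
    have := ((hasDerivAt_id s).mul_const (c i)).const_sub (x i)
    refine this.congr_deriv ?_
    simp
  let e : ι → ℝ → ℝ := fun i s => exp (p * q i s)
  have he : ∀ i s, HasDerivAt (e i) (p * q' i s * e i s) s := by
    intro i s
    refine ((hq i s).const_mul p).exp.congr_deriv ?_
    simp [e]; ring
  let S : ℝ → ℝ := fun s => ∑ i, e i s
  let S1 : ℝ → ℝ := fun s => ∑ i, p * q' i s * e i s
  let S2 : ℝ → ℝ := fun s => ∑ i, (p ^ 2 * q' i s ^ 2 - p * c i) * e i s
  let S3 : ℝ → ℝ := fun s => ∑ i, (p ^ 3 * q' i s ^ 3 - 3 * p ^ 2 * q' i s * c i) * e i s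
  have hSpos : ∀ s, 0 < S s := fun s =>
    Finset.sum_pos (fun i _ => exp_pos _) Finset.univ_nonempty
  have hS : ∀ s, HasDerivAt S (S1 s) s := fun s =>
    HasDerivAt.fun_sum fun i _ => he i s
  have hS1 : ∀ s, HasDerivAt S1 (S2 s) s := fun s =>
    HasDerivAt.fun_sum fun i _ => by
      refine (((hq' i s).const_mul p).mul (he i s)).congr_deriv ?_
      ring
  have hS2 : ∀ s, HasDerivAt S2 (S3 s) s := fun s =>
    HasDerivAt.fun_sum fun i _ => by
      refine (((((hq' i s).pow 2).const_mul (p ^ 2)).sub_const (p * c i)).mul (he i s)).congr_deriv ?_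
      simp; ring
  let A : ℝ → ℝ := fun s => S1 s / S s
  let B : ℝ → ℝ := fun s => S2 s / S s
  let D : ℝ → ℝ := fun s => S3 s / S s
  have hA : ∀ s, HasDerivAt A (B s - A s ^ 2) s := fun s => by
    refine ((hS1 s).div (hS s) (hSpos s).ne').congr_deriv ?_
    have := (hSpos s).ne'
    simp only [A, B]; field_simp
  have hB : ∀ s, HasDerivAt B (D s - A s * B s) s := fun s => by
    refine ((hS2 s).div (hS s) (hSpos s).ne').congr_deriv ?_
    have := (hSpos s).ne'
    simp only [A, B, D]; field_simp
  let F : ℝ → ℝ := fun s => S s ^ a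
  have hF : ∀ s, HasDerivAt F (a * (F s * A s)) s := fun s => by
    refine ((hS s).rpow_const (p := a) (Or.inl (hSpos s).ne')).congr_deriv ?_
    simp only [F, A]
    rw [Real.rpow_sub_one (hSpos s).ne']; ring
  have hF1 : ∀ s, HasDerivAt (fun s => a * (F s * A s))
      (a * (F s * (B s + (a - 1) * A s ^ 2))) s := fun s => by
    refine (((hF s).mul (hA s)).const_mul a).congr_deriv ?_
    ring
  have hF2 : ∀ s, HasDerivAt (fun s => a * (F s * (B s + (a - 1) * A s ^ 2)))
      (a * (F s * (a * A s * (B s + (a - 1) * A s ^ 2) + (D s - A s * B s)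
        + 2 * (a - 1) * A s * (B s - A s ^ 2)))) s := fun s => by
    refine (((hF s).mul ((hB s).add (((hA s).pow 2).const_mul (a - 1)))).const_mul a).congr_deriv ?_
    simp only [Pi.add_apply, Pi.pow_apply, Nat.cast_ofNat, Nat.add_one_sub_one, pow_one]
    ring
  have hmean : ∀ (y : ι → ℝ) (K s : ℝ), (∀ i, |y i| ≤ K) → |(∑ i, y i * e i s) / S s| ≤ K := by
    intro y K s hy
    rw [abs_div, abs_of_pos (hSpos s), div_le_iff₀ (hSpos s)]
    calc |∑ i, y i * e i s| ≤ ∑ i, |y i * e i s| := Finset.abs_sum_le_sum_abs _ _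
      _ ≤ ∑ i, K * e i s := by
          refine Finset.sum_le_sum fun i _ => ?_
          rw [abs_mul, abs_of_pos (exp_pos _)]
          exact mul_le_mul_of_nonneg_right (hy i) (exp_pos _).le
      _ = K * S s := by rw [Finset.mul_sum]
  have hm0 : 0 ≤ m := by linarith
  have hbound : ∀ t ∈ Icc 0 s, |a * (F t * (a * A t * (B t + (a - 1) * A t ^ 2) + (D t - A t * B t)
        + 2 * (a - 1) * A t * (B t - A t ^ 2)))| ≤ 15 * p ^ 3 * m ^ 3 * (∑ i, exp (w i + m)) := by
    intro t ht
    have ht0 : 0 ≤ t := ht.1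
    have ht1 : t ≤ 1 := ht.2.trans hs.2
    have hcm : ∀ i, c i ≤ m := fun i => by linarith [hxm i, abs_nonneg (x i)]
    have hqm : ∀ i, |q' i t| ≤ m := fun i => by
      have h1 : |x i - t * c i| ≤ |x i| + |t * c i| := abs_sub _ _
      rw [abs_of_nonneg (mul_nonneg ht0 (hc i))] at h1
      have : t * c i ≤ c i := mul_le_of_le_one_left (hc i) ht1
      simp only [q']
      linarith [hxm i]
    have hpm : 1 ≤ p * m := by nlinarith
    obtain ⟨k, hk⟩ : ∃ k, k = p * m := ⟨_, rfl⟩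
    have hkm : m ≤ k := by rw [hk]; nlinarith
    have hk1 : 1 ≤ k := hk ▸ hpm
    have hpq : ∀ i, |p * q' i t| ≤ k := fun i => by
      rw [abs_mul, abs_of_pos hp0, hk]; exact mul_le_mul_of_nonneg_left (hqm i) hp0.le
    have hpc : ∀ i, |p * c i| ≤ k := fun i => by
      rw [abs_mul, abs_of_pos hp0, hk, abs_of_nonneg (hc i)]
      exact mul_le_mul_of_nonneg_left (hcm i) hp0.le
    have hAb : |A t| ≤ k := hmean _ _ t hpq
    have hBb : |B t| ≤ 2 * k ^ 2 := by
      refine hmean _ _ t fun i => (abs_sub _ _).trans ?_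
      rw [← mul_pow, abs_pow]
      have : |p * q' i t| ^ 2 ≤ k ^ 2 := pow_le_pow_left₀ (abs_nonneg _) (hpq i) 2
      nlinarith [hpc i]
    have hDb : |D t| ≤ 4 * k ^ 3 := by
      refine hmean _ _ t fun i => (abs_sub _ _).trans ?_
      rw [← mul_pow, abs_pow (p * q' i t), show 3 * p ^ 2 * q' i t * c i = 3 * ((p * q' i t) * (p * c i)) by ring,
        abs_mul 3, abs_mul (p * q' i t)]
      have h3 : |p * q' i t| ^ 3 ≤ k ^ 3 := pow_le_pow_left₀ (abs_nonneg _) (hpq i) 3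
      have h2 : |p * q' i t| * |p * c i| ≤ k * k :=
        mul_le_mul (hpq i) (hpc i) (abs_nonneg _) (by linarith)
      have h4 : k * k ≤ k ^ 3 := by nlinarith [mul_nonneg (by linarith : (0:ℝ) ≤ k) (by linarith : (0:ℝ) ≤ k)]
      rw [abs_of_pos (by norm_num : (0:ℝ) < 3)]
      linarith
    have hk0 : 0 ≤ k := by linarith
    have hF0 : 0 ≤ F t := by simp only [F]; exact Real.rpow_nonneg (hSpos t).le _
    have hFb : F t ≤ ∑ i, exp (w i + m) := by
      have h1 : F t = expNorm p (fun i => q i t) := by simp only [F, S, e, expNorm, ha]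
      rw [h1]
      refine (expNorm_le_sum hp _).trans ?_
      gcongr with i
      simp only [q]
      have h2 : t * x i ≤ |x i| := by
        calc t * x i ≤ |t * x i| := le_abs_self _
          _ = t * |x i| := by rw [abs_mul, abs_of_nonneg ht0]
          _ ≤ |x i| := mul_le_of_le_one_left (abs_nonneg _) ht1
      have h3 : 0 ≤ t ^ 2 * c i / 2 := by have := hc i; positivity
      linarith [hxm i, hc i]
    have hA2 : |A t ^ 2| ≤ k ^ 2 := by rw [abs_pow]; exact pow_le_pow_left₀ (abs_nonneg _) hAb 2
    have ha1' : |a - 1| ≤ 1 := by rw [abs_le]; constructor <;> linarith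
    have haa : |a| ≤ 1 := by rw [abs_of_nonneg ha0]; exact ha1
    have hX1 : |B t + (a - 1) * A t ^ 2| ≤ 3 * k ^ 2 := by
      refine (abs_add_le _ _).trans ?_
      rw [abs_mul]
      have := mul_le_mul ha1' hA2 (abs_nonneg _) zero_le_one
      linarith
    have hX2 : |a * A t * (B t + (a - 1) * A t ^ 2)| ≤ 3 * k ^ 3 := by
      rw [abs_mul, abs_mul]
      calc |a| * |A t| * _ ≤ 1 * k * (3 * k ^ 2) := by gcongr
        _ = _ := by ring
    have hX3 : |A t * B t| ≤ 2 * k ^ 3 := by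
      rw [abs_mul]
      calc |A t| * _ ≤ k * (2 * k ^ 2) := by gcongr
        _ = _ := by ring
    have hX4 : |B t - A t ^ 2| ≤ 3 * k ^ 2 := by
      refine (abs_sub _ _).trans ?_
      linarith
    have hX5 : |2 * (a - 1) * A t * (B t - A t ^ 2)| ≤ 6 * k ^ 3 := by
      rw [abs_mul, abs_mul, abs_mul, abs_of_pos (by norm_num : (0:ℝ) < 2)]
      calc 2 * |a - 1| * |A t| * _ ≤ 2 * 1 * k * (3 * k ^ 2) := by gcongr
        _ = _ := by ring
    have hX6 : |a * A t * (B t + (a - 1) * A t ^ 2) + (D t - A t * B t)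
        + 2 * (a - 1) * A t * (B t - A t ^ 2)| ≤ 15 * k ^ 3 := by
      refine (abs_add_le _ _).trans ?_
      have h1 := abs_add_le (a * A t * (B t + (a - 1) * A t ^ 2)) (D t - A t * B t)
      have h2 := abs_sub (D t) (A t * B t)
      linarith
    rw [abs_mul, abs_mul, abs_of_nonneg hF0]
    calc |a| * (F t * _) ≤ 1 * ((∑ i, exp (w i + m)) * (15 * k ^ 3)) := by gcongr
      _ = _ := by rw [hk]; ring
  have key := abs_taylor_two_sub_le hs.1 hF hF1 hF2 hbound
  have hS0 : S 0 = ∑ j, exp (p * w j) := by simp [S, e, q]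
  have hF0' : F 0 = expNorm p w := by simp only [F, hS0, expNorm, ha]
  have hsum0 : ∀ y : ι → ℝ, (∑ i, y i * e i 0) / S 0 = ∑ i, softWeight p w i * y i := by
    intro y
    rw [Finset.sum_div, hS0]
    refine Finset.sum_congr rfl fun i _ => ?_
    simp [softWeight, e, q]; ring
  have hA0 : A 0 = p * ∑ i, softWeight p w i * x i := by
    simp only [A, S1]; rw [hsum0, Finset.mul_sum]
    refine Finset.sum_congr rfl fun i _ => ?_
    simp [q']; ring
  have hB0 : B 0 = p ^ 2 * ∑ i, softWeight p w i * x i ^ 2 - p * ∑ i, softWeight p w i * c i := by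
    simp only [B, S2]; rw [hsum0, Finset.mul_sum, Finset.mul_sum, ← Finset.sum_sub_distrib]
    refine Finset.sum_congr rfl fun i _ => ?_
    simp [q']; ring
  rw [hA0, hB0, hF0'] at key
  have hFs : F s = expNorm p (fun i => w i + s * x i - s ^ 2 * c i / 2) := by
    simp only [F, S, e, q, expNorm, ha]
  rw [hFs] at key
  convert key using 2
  generalize (∑ i, softWeight p w i * x i) = u
  generalize (∑ i, softWeight p w i * x i ^ 2) = v
  generalize (∑ i, softWeight p w i * c i) = z
  have h2 : a * (expNorm p w * (p * u)) = expNorm p w * u := by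
    rw [show a * (expNorm p w * (p * u)) = (a * p) * (expNorm p w * u) by ring, hap, one_mul]
  rw [h2, show a * (expNorm p w * (p ^ 2 * v - p * z + (a - 1) * (p * u) ^ 2)) =
    (a * p) * (expNorm p w * (p * v - z + (a * p - p) * u ^ 2)) by ring, hap, one_mul]

end expNorm

section GaussianVector
variable {ι : Type*} [Fintype ι] {γ : Measure (ι → ℝ)} [IsGaussian γ]

lemma integrable_exp_mul_norm (K : ℝ) : Integrable (fun x => exp (K * ‖x‖)) γ := by
  obtain ⟨C, hC, hint⟩ := IsGaussian.exists_integrable_exp_sq γ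
  refine (hint.const_mul (exp (K ^ 2 / (4 * C)))).mono' (by fun_prop) (ae_of_all _ fun x => ?_)
  rw [Real.norm_eq_abs, abs_of_pos (exp_pos _), ← Real.exp_add]
  gcongr
  have : K ^ 2 / (4 * C) + C * ‖x‖ ^ 2 - K * ‖x‖ = (K - 2 * C * ‖x‖) ^ 2 / (4 * C) := by
    field_simp; ring
  have h2 : 0 ≤ (K - 2 * C * ‖x‖) ^ 2 / (4 * C) := by positivity
  linarith

lemma memLp_eval (i : ι) : MemLp (fun x : ι → ℝ => x i) 2 γ :=
  (IsGaussian.memLp_two_id (μ := γ)).eval i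

lemma memLp_eval_sub (i j : ι) : MemLp (fun x : ι → ℝ => x i - x j) 2 γ :=
  (memLp_eval i).sub (memLp_eval j)

lemma integral_eval_eq_zero (h0 : γ[id] = 0) (i : ι) : ∫ x, x i ∂γ = 0 := by
  have := IsGaussian.integral_dual (μ := γ) (ContinuousLinearMap.proj (R := ℝ) i)
  simp only [id_eq] at h0
  rw [h0] at this
  simpa using this

/-- Two independent copies of a centered Gaussian vector combine into a scaled copy. -/
lemma map_combination_eq_map_smul (h0 : γ[id] = 0) {a b r : ℝ} (hr : a ^ 2 + b ^ 2 = r ^ 2)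
    (hr0 : 0 ≤ r) :
    (γ.prod γ).map (fun z => a • z.1 + b • z.2) = γ.map (fun x => r • x) := by
  rcases hr0.eq_or_lt with h | h
  · subst h
    have ha : a = 0 := by nlinarith [sq_nonneg a, sq_nonneg b]
    have hb : b = 0 := by nlinarith [sq_nonneg a, sq_nonneg b]
    simp [ha, hb, Measure.map_const]
  · obtain ⟨θ, hc, hs⟩ : ∃ θ, r * cos θ = a ∧ r * sin θ = b := by
      refine ⟨Complex.arg ⟨a, b⟩, ?_, ?_⟩
      · have : ‖(⟨a, b⟩ : ℂ)‖ = r := by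
          rw [Complex.norm_def, Complex.normSq_mk, ← sq, ← sq, hr, Real.sqrt_sq hr0]
        rw [← this, Complex.norm_mul_cos_arg]
      · have : ‖(⟨a, b⟩ : ℂ)‖ = r := by
          rw [Complex.norm_def, Complex.normSq_mk, ← sq, ← sq, hr, Real.sqrt_sq hr0]
        rw [← this, Complex.norm_mul_sin_arg]
    have h1 := IsGaussian.map_rotation_eq_self h0 θ
    have h2 : (γ.prod γ).map Prod.fst = γ := by
      rw [Measure.map_fst_prod]; simp
    have : γ.map (fun x => r • x) =
        ((γ.prod γ).map (ContinuousLinearMap.rotation θ)).map (fun z => r • z.1) := by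
      rw [h1]
      conv_lhs => rw [← h2]
      rw [Measure.map_map (by fun_prop) (by fun_prop)]
      rfl
    rw [this, Measure.map_map (by fun_prop) (by fun_prop)]
    congr 1
    ext z : 1
    simp [ContinuousLinearMap.rotation_apply, smul_smul, ← hc, ← hs]

end GaussianVector

section Expansion
variable {ι : Type*} [Fintype ι] {p : ℝ}

lemma sum_softWeight_variance [Nonempty ι] (w x : ι → ℝ) :
    ∑ i, softWeight p w i * x i ^ 2 - (∑ i, softWeight p w i * x i) ^ 2 =
      1 / 2 * ∑ i, ∑ j, softWeight p w i * softWeight p w j * (x i - x j) ^ 2 := by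
  have h1 := sum_softWeight (p := p) w
  have e1 : ∑ i, ∑ j, softWeight p w i * softWeight p w j * x i ^ 2 =
      ∑ i, softWeight p w i * x i ^ 2 := by
    refine Finset.sum_congr rfl fun i _ => ?_
    rw [← Finset.sum_mul, ← Finset.mul_sum, h1, mul_one]
  have e2 : ∑ i, ∑ j, softWeight p w i * softWeight p w j * x j ^ 2 =
      ∑ i, softWeight p w i * x i ^ 2 := by
    rw [Finset.sum_comm, ← e1]
    refine Finset.sum_congr rfl fun i _ => Finset.sum_congr rfl fun j _ => by ring
  have e3 : ∑ i, ∑ j, softWeight p w i * softWeight p w j * (x i * x j) =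
      (∑ i, softWeight p w i * x i) ^ 2 := by
    rw [sq, Finset.sum_mul_sum]
    refine Finset.sum_congr rfl fun i _ => Finset.sum_congr rfl fun j _ => by ring
  have : ∑ i, ∑ j, softWeight p w i * softWeight p w j * (x i - x j) ^ 2 =
      ∑ i, ∑ j, softWeight p w i * softWeight p w j * x i ^ 2 +
      ∑ i, ∑ j, softWeight p w i * softWeight p w j * x j ^ 2 -
      2 * ∑ i, ∑ j, softWeight p w i * softWeight p w j * (x i * x j) := by
    simp only [Finset.mul_sum, ← Finset.sum_add_distrib, ← Finset.sum_sub_distrib]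
    refine Finset.sum_congr rfl fun i _ => Finset.sum_congr rfl fun j _ => by ring
  rw [this, e1, e2, e3]; ring

lemma exp_eval_le (w x c : ι → ℝ) (hc : ∀ i, 0 ≤ c i) {s : ℝ} (hs : s ∈ Icc (0:ℝ) 1) :
    ∑ i, exp (w i + s * x i - s ^ 2 * c i / 2) ≤ exp ‖x‖ * ∑ i, exp (w i) := by
  rw [Finset.mul_sum]
  refine Finset.sum_le_sum fun i _ => ?_
  rw [← Real.exp_add]
  gcongr
  have h1 : s * x i ≤ ‖x‖ := by
    calc s * x i ≤ |s * x i| := le_abs_self _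
      _ = s * |x i| := by rw [abs_mul, abs_of_nonneg hs.1]
      _ ≤ 1 * ‖x‖ := mul_le_mul hs.2 (norm_le_pi_norm x i) (abs_nonneg _) zero_le_one
      _ = ‖x‖ := one_mul _
  have h2 : 0 ≤ s ^ 2 * c i / 2 := by have := hc i; positivity
  linarith

lemma integrable_expNorm_add (γ : Measure (ι → ℝ)) [IsGaussian γ] (hp : 1 ≤ p) (w c : ι → ℝ)
    (hc : ∀ i, 0 ≤ c i) {s : ℝ} (hs : s ∈ Icc (0:ℝ) 1) :
    Integrable (fun x : ι → ℝ => expNorm p (fun i => w i + s * x i - s ^ 2 * c i / 2)) γ := by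
  refine ((integrable_exp_mul_norm (γ := γ) 1).mul_const (∑ i, exp (w i))).mono'
    ((continuous_expNorm hp).comp (by fun_prop)).aestronglyMeasurable (ae_of_all _ fun x => ?_)
  rw [Real.norm_eq_abs, abs_of_nonneg (expNorm_nonneg _), one_mul]
  exact (expNorm_le_sum hp _).trans (exp_eval_le w x c hc hs)

/-- Short-time expansion of the Gaussian smoothing of `expNorm`. -/
lemma exists_abs_integral_expNorm_sub_le [Nonempty ι] (γ : Measure (ι → ℝ)) [IsGaussian γ]
    (h0 : γ[id] = 0) (hp : 1 ≤ p) :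
    ∃ K, 0 ≤ K ∧ ∀ s ∈ Icc (0:ℝ) 1, ∀ w : ι → ℝ,
      |∫ x, expNorm p (fun i => w i + s * x i - s ^ 2 * (∫ y, y i ^ 2 ∂γ) / 2) ∂γ - expNorm p w
        - s ^ 2 / 2 * (expNorm p w * ((p - 1) / 2 * ∑ i, ∑ j,
            softWeight p w i * softWeight p w j * ∫ y, (y i - y j) ^ 2 ∂γ))|
      ≤ K * s ^ 3 * ∑ i, exp (w i) := by
  obtain ⟨c, hc⟩ : ∃ c : ι → ℝ, c = fun i => ∫ y, y i ^ 2 ∂γ := ⟨_, rfl⟩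
  have hc0 : ∀ i, 0 ≤ c i := fun i => by rw [hc]; exact integral_nonneg fun y => sq_nonneg _
  obtain ⟨C, hC⟩ : ∃ C, C = 1 + ∑ i, c i := ⟨_, rfl⟩
  have hC1 : 1 ≤ C := by
    rw [hC]; linarith [Finset.sum_nonneg fun i (_ : i ∈ Finset.univ) => hc0 i]
  have hcC : ∀ i, c i ≤ C := fun i => by
    rw [hC]; linarith [Finset.single_le_sum (fun j _ => hc0 j) (Finset.mem_univ i)]
  have hp0 : 0 < p := by linarith
  refine ⟨90 * p ^ 3 * exp (2 * C) * ∫ x, exp (2 * ‖x‖) ∂γ, by positivity, fun s hs w => ?_⟩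
  have hcs : ∀ i, ∫ y, y i ^ 2 ∂γ = c i := fun i => by rw [hc]
  simp only [hcs]
  set N := expNorm p w
  have i1 : ∀ i, Integrable (fun x : ι → ℝ => x i) γ := fun i =>
    (memLp_eval i).integrable (by norm_num)
  have i2 : ∀ i, Integrable (fun x : ι → ℝ => x i ^ 2) γ := fun i => (memLp_eval i).integrable_sq
  have i3 : ∀ i j, Integrable (fun x : ι → ℝ => (x i - x j) ^ 2) γ := fun i j =>
    (memLp_eval_sub i j).integrable_sq
  -- the Taylor polynomial
  let L : (ι → ℝ) → ℝ := fun x => s * (N * ∑ i, softWeight p w i * x i)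
  let Q : (ι → ℝ) → ℝ := fun x => s ^ 2 / 2 * (N * (∑ i, softWeight p w i * x i ^ 2
    - ∑ i, softWeight p w i * c i
    + (p - 1) / 2 * ∑ i, ∑ j, softWeight p w i * softWeight p w j * (x i - x j) ^ 2))
  have hLint : Integrable L γ :=
    ((integrable_finsetSum _ fun i _ => (i1 i).const_mul _).const_mul N).const_mul s
  have hd : Integrable (fun x : ι → ℝ =>
      ∑ i, ∑ j, softWeight p w i * softWeight p w j * (x i - x j) ^ 2) γ :=
    integrable_finsetSum _ fun i _ => integrable_finsetSum _ fun j _ => (i3 i j).const_mul _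
  have hsq : Integrable (fun x : ι → ℝ => ∑ i, softWeight p w i * x i ^ 2) γ :=
    integrable_finsetSum _ fun i _ => (i2 i).const_mul _
  have hQint : Integrable Q γ :=
    (((hsq.sub (integrable_const _)).add (hd.const_mul _)).const_mul N).const_mul (s ^ 2 / 2)
  have hLz : ∫ x, L x ∂γ = 0 := by
    simp only [L]
    rw [integral_const_mul, integral_const_mul, integral_finsetSum _ fun i _ => (i1 i).const_mul _]
    simp [integral_const_mul, integral_eval_eq_zero h0]
  have hQz : ∫ x, Q x ∂γ = s ^ 2 / 2 * (N * ((p - 1) / 2 * ∑ i, ∑ j,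
            softWeight p w i * softWeight p w j * ∫ y, (y i - y j) ^ 2 ∂γ)) := by
    simp only [Q]
    have hsub : Integrable (fun x : ι → ℝ => ∑ i, softWeight p w i * x i ^ 2
        - ∑ i, softWeight p w i * c i) γ := hsq.sub (integrable_const _)
    rw [integral_const_mul, integral_const_mul, integral_add hsub
      (hd.const_mul _), integral_sub hsq (integrable_const _), integral_const_mul,
      integral_finsetSum _ fun i _ => (i2 i).const_mul _,
      integral_finsetSum _ fun i _ => integrable_finsetSum _ fun j _ => (i3 i j).const_mul _]
    have : ∀ i, ∫ x : ι → ℝ, ∑ j, softWeight p w i * softWeight p w j * (x i - x j) ^ 2 ∂γ =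
        ∑ j, softWeight p w i * softWeight p w j * ∫ y, (y i - y j) ^ 2 ∂γ := fun i => by
      rw [integral_finsetSum _ fun j _ => (i3 i j).const_mul _]
      simp only [integral_const_mul]
    simp only [this, integral_const_mul, hcs]
    simp
  have hF := integrable_expNorm_add γ hp w c hc0 hs
  have hint : ∫ x, (expNorm p (fun i => w i + s * x i - s ^ 2 * c i / 2) - N - L x - Q x) ∂γ =
      ∫ x, expNorm p (fun i => w i + s * x i - s ^ 2 * c i / 2) ∂γ - N
        - s ^ 2 / 2 * (N * ((p - 1) / 2 * ∑ i, ∑ j,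
            softWeight p w i * softWeight p w j * ∫ y, (y i - y j) ^ 2 ∂γ)) := by
    have hF1 : Integrable (fun x : ι → ℝ =>
        expNorm p (fun i => w i + s * x i - s ^ 2 * c i / 2) - N) γ := hF.sub (integrable_const _)
    have hF2 : Integrable (fun x : ι → ℝ =>
        expNorm p (fun i => w i + s * x i - s ^ 2 * c i / 2) - N - L x) γ := hF1.sub hLint
    rw [integral_sub hF2 hQint, integral_sub hF1 hLint, integral_sub hF (integrable_const _),
      hLz, hQz]
    simp
  rw [← hint, ← Real.norm_eq_abs]
  have hdom : Integrable (fun x => 90 * p ^ 3 * exp (2 * C) * s ^ 3 * (∑ i, exp (w i))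
      * exp (2 * ‖x‖)) γ := (integrable_exp_mul_norm 2).const_mul _
  refine (norm_integral_le_of_norm_le hdom (ae_of_all _ fun x => ?_)).trans_eq ?_
  · have hm : 1 ≤ ‖x‖ + C := by linarith [norm_nonneg x]
    have hb := expNorm_taylor hp w x c hm hc0
      (fun i => add_le_add (norm_le_pi_norm x i) (hcC i)) hs
    have hv := sum_softWeight_variance (p := p) w x
    rw [Real.norm_eq_abs]
    have heq : p * ∑ i, softWeight p w i * x i ^ 2
          - ∑ i, softWeight p w i * c i + (1 - p) * (∑ i, softWeight p w i * x i) ^ 2 =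
        ∑ i, softWeight p w i * x i ^ 2 - ∑ i, softWeight p w i * c i
    + (p - 1) / 2 * ∑ i, ∑ j, softWeight p w i * softWeight p w j * (x i - x j) ^ 2 := by
      linear_combination (p - 1) * hv
    rw [heq] at hb
    refine hb.trans ?_
    have h6 : (‖x‖ + C) ^ 3 ≤ 6 * exp (‖x‖ + C) := by
      have := Real.pow_div_factorial_le_exp (‖x‖ + C) (by linarith) 3
      have h3 : ((Nat.factorial 3 : ℕ) : ℝ) = 6 := by norm_num [Nat.factorial]
      rw [h3] at this
      linarith
    have hs0 : 0 ≤ s := hs.1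
    have hsum : ∑ i, exp (w i + (‖x‖ + C)) = (∑ i, exp (w i)) * exp (‖x‖ + C) := by
      rw [Finset.sum_mul]; exact Finset.sum_congr rfl fun i _ => Real.exp_add _ _
    rw [hsum]
    calc 15 * p ^ 3 * (‖x‖ + C) ^ 3 * ((∑ i, exp (w i)) * exp (‖x‖ + C)) * s ^ 3
        ≤ 15 * p ^ 3 * (6 * exp (‖x‖ + C)) * ((∑ i, exp (w i)) * exp (‖x‖ + C)) * s ^ 3 := by
          have hE : 0 ≤ ∑ i, exp (w i) := Finset.sum_nonneg fun i _ => (exp_pos _).le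
          have hE' := exp_pos (‖x‖ + C)
          refine mul_le_mul_of_nonneg_right (mul_le_mul_of_nonneg_right
            (mul_le_mul_of_nonneg_left h6 ?_) ?_) ?_
          · exact mul_nonneg (by norm_num) (pow_nonneg hp0.le _)
          · exact mul_nonneg hE hE'.le
          · exact pow_nonneg hs0 _
      _ = 90 * p ^ 3 * exp (2 * C) * s ^ 3 * (∑ i, exp (w i)) * exp (2 * ‖x‖) := by
          rw [two_mul C, two_mul ‖x‖, Real.exp_add ‖x‖ C, Real.exp_add C C, Real.exp_add ‖x‖ ‖x‖]
          generalize exp ‖x‖ = e1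
          generalize exp C = e2
          generalize ∑ i, exp (w i) = e3
          ring
  · rw [integral_const_mul]; ring

end Expansion

section Interpolation
variable {ι : Type*} [Fintype ι] {p : ℝ}

/-- The interpolated field `s X + t Y` with its variance correction. -/
noncomputable def interpField (c d : ι → ℝ) (s t : ℝ) (z : (ι → ℝ) × (ι → ℝ)) (i : ι) : ℝ :=
  s * z.1 i + t * z.2 i - (s ^ 2 * c i + t ^ 2 * d i) / 2

lemma continuous_interpField (c d : ι → ℝ) (s t : ℝ) : Continuous (interpField c d s t) := by
  unfold interpField; fun_prop

lemma mul_eval_le_norm (x : ι → ℝ) (i : ι) {s : ℝ} (hs : s ∈ Icc (0:ℝ) 1) : s * x i ≤ ‖x‖ := by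
  calc s * x i ≤ |s * x i| := le_abs_self _
    _ = s * |x i| := by rw [abs_mul, abs_of_nonneg hs.1]
    _ ≤ 1 * ‖x‖ := mul_le_mul hs.2 (norm_le_pi_norm x i) (abs_nonneg _) zero_le_one
    _ = ‖x‖ := one_mul _

lemma sum_exp_interpField_le {c d : ι → ℝ} (hc : ∀ i, 0 ≤ c i) (hd : ∀ i, 0 ≤ d i) {s t : ℝ}
    (hs : s ∈ Icc (0:ℝ) 1) (ht : t ∈ Icc (0:ℝ) 1) (z : (ι → ℝ) × (ι → ℝ)) :
    ∑ i, exp (interpField c d s t z i) ≤ Fintype.card ι * (exp ‖z.1‖ * exp ‖z.2‖) := by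
  rw [← Real.exp_add, ← nsmul_eq_mul, ← Finset.card_univ]
  refine Finset.sum_le_card_nsmul _ _ _ fun i _ => ?_
  unfold interpField
  have h1 := mul_eval_le_norm z.1 i hs
  have h2 := mul_eval_le_norm z.2 i ht
  have h3 := mul_nonneg (sq_nonneg s) (hc i)
  have h4 := mul_nonneg (sq_nonneg t) (hd i)
  gcongr
  linarith

lemma integrable_exp_norm_prod (γ ν : Measure (ι → ℝ)) [IsGaussian γ] [IsGaussian ν] :
    Integrable (fun z : (ι → ℝ) × (ι → ℝ) => exp ‖z.1‖ * exp ‖z.2‖) (γ.prod ν) := by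
  have h1 := integrable_exp_mul_norm (γ := γ) 1
  have h2 := integrable_exp_mul_norm (γ := ν) 1
  simp only [one_mul] at h1 h2
  exact h1.mul_prod h2

lemma integrable_sum_exp_interpField (γ ν : Measure (ι → ℝ)) [IsGaussian γ] [IsGaussian ν]
    {c d : ι → ℝ} (hc : ∀ i, 0 ≤ c i) (hd : ∀ i, 0 ≤ d i) {s t : ℝ}
    (hs : s ∈ Icc (0:ℝ) 1) (ht : t ∈ Icc (0:ℝ) 1) :
    Integrable (fun z => ∑ i, exp (interpField c d s t z i)) (γ.prod ν) := by
  refine ((integrable_exp_norm_prod γ ν).const_mul (Fintype.card ι)).mono' ?_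
    (ae_of_all _ fun z => ?_)
  · have := continuous_interpField c d s t
    exact Continuous.aestronglyMeasurable (by fun_prop)
  · rw [Real.norm_eq_abs, abs_of_nonneg (Finset.sum_nonneg fun i _ => (exp_pos _).le)]
    exact sum_exp_interpField_le hc hd hs ht z

lemma integrable_expNorm_interpField (γ ν : Measure (ι → ℝ)) [IsGaussian γ] [IsGaussian ν]
    (hp : 1 ≤ p) {c d : ι → ℝ} (hc : ∀ i, 0 ≤ c i) (hd : ∀ i, 0 ≤ d i) {s t : ℝ}
    (hs : s ∈ Icc (0:ℝ) 1) (ht : t ∈ Icc (0:ℝ) 1) :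
    Integrable (fun z => expNorm p (interpField c d s t z)) (γ.prod ν) := by
  refine (integrable_sum_exp_interpField γ ν hc hd hs ht).mono'
    ((continuous_expNorm hp).comp (continuous_interpField c d s t)).aestronglyMeasurable
    (ae_of_all _ fun z => ?_)
  rw [Real.norm_eq_abs, abs_of_nonneg (expNorm_nonneg _)]
  exact expNorm_le_sum hp _

lemma map_smul_fst_prod (γ ν : Measure (ι → ℝ)) [IsGaussian γ] [IsGaussian ν] (h0 : γ[id] = 0)
    {s h r : ℝ} (hr : s ^ 2 + h ^ 2 = r ^ 2) (hr0 : 0 ≤ r) :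
    (γ.prod ν).map (fun z => (r • z.1, z.2)) =
      ((γ.prod ν).prod γ).map (fun z => (s • z.1.1 + h • z.2, z.1.2)) := by
  have e1 : (γ.prod ν).map (fun z => (r • z.1, z.2)) = (γ.map (fun x => r • x)).prod ν := by
    have := Measure.map_prod_map γ ν (f := fun x => r • x) (g := id) (by fun_prop) measurable_id
    rw [Measure.map_id] at this
    exact this.symm
  have e2 : ((γ.prod γ).prod ν).map (fun z => (s • z.1.1 + h • z.1.2, z.2)) =
      ((γ.prod γ).map (fun z => s • z.1 + h • z.2)).prod ν := by
    have := Measure.map_prod_map (γ.prod γ) ν (f := fun z => s • z.1 + h • z.2) (g := id)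
      (by fun_prop) measurable_id
    rw [Measure.map_id] at this
    exact this.symm
  have e3 : ((γ.prod ν).prod γ).map (fun z => ((z.1.1, z.2), z.1.2)) = (γ.prod γ).prod ν := by
    have a1 : MeasurePreserving (MeasurableEquiv.prodAssoc (α := ι → ℝ) (β := ι → ℝ)
        (γ := ι → ℝ)) ((γ.prod ν).prod γ) (γ.prod (ν.prod γ)) := measurePreserving_prodAssoc ..
    have a2 : MeasurePreserving (Prod.map id Prod.swap) (γ.prod (ν.prod γ))
        (γ.prod (γ.prod ν)) := (MeasurePreserving.id γ).prod Measure.measurePreserving_swap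
    have a3 : MeasurePreserving (MeasurableEquiv.prodAssoc (α := ι → ℝ) (β := ι → ℝ)
        (γ := ι → ℝ)).symm (γ.prod (γ.prod ν)) ((γ.prod γ).prod ν) :=
      (measurePreserving_prodAssoc ..).symm
    exact (a3.comp (a2.comp a1)).map_eq
  rw [e1, ← map_combination_eq_map_smul h0 hr hr0, ← e2, ← e3,
    Measure.map_map (by fun_prop) (by fun_prop)]
  rfl

lemma integral_interpField_split (γ ν : Measure (ι → ℝ)) [IsGaussian γ] [IsGaussian ν]
    (h0 : γ[id] = 0) (hp : 1 ≤ p) {c d : ι → ℝ} (hc : ∀ i, 0 ≤ c i) (hd : ∀ i, 0 ≤ d i)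
    {s t h r : ℝ} (hr : s ^ 2 + h ^ 2 = r ^ 2) (hr0 : r ∈ Icc (0:ℝ) 1) (ht : t ∈ Icc (0:ℝ) 1) :
    Integrable (fun z => ∫ x, expNorm p
      (fun i => interpField c d s t z i + h * x i - h ^ 2 * c i / 2) ∂γ) (γ.prod ν) ∧
    ∫ z, expNorm p (interpField c d r t z) ∂(γ.prod ν) =
      ∫ z, ∫ x, expNorm p (fun i => interpField c d s t z i + h * x i - h ^ 2 * c i / 2) ∂γ
        ∂(γ.prod ν) := by
  have hm := map_smul_fst_prod γ ν h0 hr hr0.1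
  obtain ⟨F, hF⟩ : ∃ F : (ι → ℝ) × (ι → ℝ) → ℝ, F = fun z =>
    expNorm p (fun i => z.1 i + t * z.2 i - (r ^ 2 * c i + t ^ 2 * d i) / 2) := ⟨_, rfl⟩
  have hFc : Continuous F := by
    rw [hF]; exact (continuous_expNorm hp).comp (by fun_prop)
  have hL : (fun z => expNorm p (interpField c d r t z)) =
      F ∘ fun z : (ι → ℝ) × (ι → ℝ) => (r • z.1, z.2) := by
    rw [hF]; rfl
  have hR : (fun z : ((ι → ℝ) × (ι → ℝ)) × (ι → ℝ) => expNorm p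
      (fun i => interpField c d s t z.1 i + h * z.2 i - h ^ 2 * c i / 2)) =
      F ∘ fun z : ((ι → ℝ) × (ι → ℝ)) × (ι → ℝ) => (s • z.1.1 + h • z.2, z.1.2) := by
    rw [hF]
    ext z
    simp only [Function.comp, interpField, Pi.add_apply, Pi.smul_apply, smul_eq_mul, ← hr]
    congr 1
    ext i
    ring
  have hI := integrable_expNorm_interpField γ ν hp hc hd hr0 ht
  rw [hL] at hI
  have hI2 : Integrable F ((γ.prod ν).map fun z => (r • z.1, z.2)) :=
    (integrable_map_measure hFc.aestronglyMeasurable (by fun_prop)).2 hI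
  have hI3 := hI2
  rw [hm] at hI3
  have hI4 := (integrable_map_measure hFc.aestronglyMeasurable (by fun_prop)).1 hI3
  rw [← hR] at hI4
  refine ⟨hI4.integral_prod_left, ?_⟩
  rw [← integral_prod _ hI4, hL, hR]
  simp only [Function.comp_def]
  rw [← integral_map (by fun_prop) hFc.aestronglyMeasurable, hm,
    integral_map (by fun_prop) hFc.aestronglyMeasurable]

lemma interpField_swap (c d : ι → ℝ) (s t : ℝ) (z : (ι → ℝ) × (ι → ℝ)) :
    interpField d c t s z.swap = interpField c d s t z := by
  ext i; simp only [interpField, Prod.fst_swap, Prod.snd_swap]; ring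

lemma integral_interpField_split_right (γ ν : Measure (ι → ℝ)) [IsGaussian γ] [IsGaussian ν]
    (h0 : ν[id] = 0) (hp : 1 ≤ p) {c d : ι → ℝ} (hc : ∀ i, 0 ≤ c i) (hd : ∀ i, 0 ≤ d i)
    {s t h r : ℝ} (hr : t ^ 2 + h ^ 2 = r ^ 2) (hr0 : r ∈ Icc (0:ℝ) 1) (hs : s ∈ Icc (0:ℝ) 1) :
    Integrable (fun z => ∫ x, expNorm p
      (fun i => interpField c d s t z i + h * x i - h ^ 2 * d i / 2) ∂ν) (γ.prod ν) ∧
    ∫ z, expNorm p (interpField c d s r z) ∂(γ.prod ν) =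
      ∫ z, ∫ x, expNorm p (fun i => interpField c d s t z i + h * x i - h ^ 2 * d i / 2) ∂ν
        ∂(γ.prod ν) := by
  obtain ⟨h1, h2⟩ := integral_interpField_split ν γ h0 hp hd hc hr hr0 hs
  constructor
  · have := h1.swap
    simpa only [Function.comp_def, interpField_swap] using this
  · have a1 := integral_prod_swap (μ := ν) (ν := γ) fun z => expNorm p (interpField d c r s z)
    have a2 := integral_prod_swap (μ := ν) (ν := γ) fun z => ∫ x, expNorm p
      (fun i => interpField d c t s z i + h * x i - h ^ 2 * d i / 2) ∂ν
    rw [← a1, ← a2] at h2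
    simpa only [interpField_swap] using h2

/-- One step of the discrete Gaussian interpolation. -/
lemma exists_interpolation_step [Nonempty ι] (γ ν : Measure (ι → ℝ)) [IsGaussian γ] [IsGaussian ν]
    (h0 : γ[id] = 0) (h0' : ν[id] = 0) (hp : 1 ≤ p)
    (hΓ : ∀ i j, ∫ x, (x i - x j) ^ 2 ∂γ ≤ ∫ x, (x i - x j) ^ 2 ∂ν) :
    ∃ K, ∀ s ∈ Icc (0:ℝ) 1, ∀ t ∈ Icc (0:ℝ) 1, ∀ h ∈ Icc (0:ℝ) 1,
      ∀ r ∈ Icc (0:ℝ) 1, ∀ q ∈ Icc (0:ℝ) 1, s ^ 2 + h ^ 2 = r ^ 2 → t ^ 2 + h ^ 2 = q ^ 2 →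
      ∫ z, expNorm p (interpField (fun i => ∫ x, x i ^ 2 ∂γ) (fun i => ∫ x, x i ^ 2 ∂ν) r t z)
        ∂(γ.prod ν) ≤
      ∫ z, expNorm p (interpField (fun i => ∫ x, x i ^ 2 ∂γ) (fun i => ∫ x, x i ^ 2 ∂ν) s q z)
        ∂(γ.prod ν) + K * h ^ 3 := by
  obtain ⟨K₁, hK₁0, hK₁⟩ := exists_abs_integral_expNorm_sub_le γ h0 hp
  obtain ⟨K₂, hK₂0, hK₂⟩ := exists_abs_integral_expNorm_sub_le ν h0' hp
  have hc : ∀ i, 0 ≤ ∫ x : ι → ℝ, x i ^ 2 ∂γ := fun i => integral_nonneg fun y => sq_nonneg _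
  have hd : ∀ i, 0 ≤ ∫ x : ι → ℝ, x i ^ 2 ∂ν := fun i => integral_nonneg fun y => sq_nonneg _
  set M := ∫ z : (ι → ℝ) × (ι → ℝ), Fintype.card ι * (exp ‖z.1‖ * exp ‖z.2‖) ∂(γ.prod ν)
  refine ⟨(K₁ + K₂) * M, fun s hs t ht h hh r hr q hq hsr htq => ?_⟩
  obtain ⟨i1, e1⟩ := integral_interpField_split γ ν h0 hp hc hd hsr hr ht
  obtain ⟨i2, e2⟩ := integral_interpField_split_right γ ν h0' hp hc hd htq hq hs
  have i3 := integrable_sum_exp_interpField γ ν hc hd hs ht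
  rw [e1, e2]
  have key := integral_mono i1 (i2.add (i3.const_mul ((K₁ + K₂) * h ^ 3))) fun z => by
    set W := interpField (fun i => ∫ x, x i ^ 2 ∂γ) (fun i => ∫ x, x i ^ 2 ∂ν) s t z
    have a1 := (abs_le.1 (hK₁ h hh W)).2
    have a2 := (abs_le.1 (hK₂ h hh W)).1
    have a3 : h ^ 2 / 2 * (expNorm p W * ((p - 1) / 2 * ∑ i, ∑ j,
        softWeight p W i * softWeight p W j * ∫ y, (y i - y j) ^ 2 ∂γ)) ≤
        h ^ 2 / 2 * (expNorm p W * ((p - 1) / 2 * ∑ i, ∑ j,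
        softWeight p W i * softWeight p W j * ∫ y, (y i - y j) ^ 2 ∂ν)) := by
      have : 0 ≤ p - 1 := by linarith
      refine mul_le_mul_of_nonneg_left (mul_le_mul_of_nonneg_left (mul_le_mul_of_nonneg_left
        (Finset.sum_le_sum fun i _ => Finset.sum_le_sum fun j _ => mul_le_mul_of_nonneg_left
          (hΓ i j) (mul_nonneg (softWeight_nonneg _ _) (softWeight_nonneg _ _))) (by positivity))
          (expNorm_nonneg _)) (by positivity)
    simp only [Pi.add_apply]
    nlinarith
  rw [integral_add' i2 (i3.const_mul _), integral_const_mul] at key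
  have hM : ∫ z, ∑ i, exp (interpField (fun i => ∫ x, x i ^ 2 ∂γ) (fun i => ∫ x, x i ^ 2 ∂ν)
      s t z i) ∂(γ.prod ν) ≤ M :=
    integral_mono i3 ((integrable_exp_norm_prod γ ν).const_mul _)
      fun z => sum_exp_interpField_le hc hd hs ht z
  have : (K₁ + K₂) * h ^ 3 * (∫ z, ∑ i, exp (interpField (fun i => ∫ x, x i ^ 2 ∂γ)
      (fun i => ∫ x, x i ^ 2 ∂ν) s t z i) ∂(γ.prod ν)) ≤ (K₁ + K₂) * h ^ 3 * M :=
    mul_le_mul_of_nonneg_left hM (mul_nonneg (by positivity) (pow_nonneg hh.1 _))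
  linarith

/-- The mean of `expNorm p` of a variance-corrected centered Gaussian vector is monotone in the
variogram. -/
theorem integral_expNorm_mono [Nonempty ι] (γ ν : Measure (ι → ℝ)) [IsGaussian γ] [IsGaussian ν]
    (h0 : γ[id] = 0) (h0' : ν[id] = 0) (hp : 1 ≤ p)
    (hΓ : ∀ i j, ∫ x, (x i - x j) ^ 2 ∂γ ≤ ∫ x, (x i - x j) ^ 2 ∂ν) :
    ∫ x, expNorm p (fun i => x i - (∫ y, y i ^ 2 ∂γ) / 2) ∂γ ≤
      ∫ x, expNorm p (fun i => x i - (∫ y, y i ^ 2 ∂ν) / 2) ∂ν := by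
  obtain ⟨K, hK⟩ := exists_interpolation_step γ ν h0 h0' hp hΓ
  set c : ι → ℝ := fun i => ∫ x, x i ^ 2 ∂γ
  set d : ι → ℝ := fun i => ∫ x, x i ^ 2 ∂ν
  set G : ℝ → ℝ → ℝ := fun s t => ∫ z, expNorm p (interpField c d s t z) ∂(γ.prod ν)
  have hbound : ∀ N : ℕ, 0 < N → G 1 0 ≤ G 0 1 + K * (√N)⁻¹ := by
    intro N hN
    have hN0 : (0:ℝ) < N := by exact_mod_cast hN
    have hN1 : (1:ℝ) ≤ N := by exact_mod_cast hN
    have hstep : ∀ k : ℕ, k ≤ N → G 1 0 ≤ G (√(1 - k / N)) (√(k / N)) + k * (K * (√N)⁻¹ ^ 3) := by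
      intro k
      induction k with
      | zero => intro _; simp
      | succ k ih =>
        intro hk
        have hk' : ((k:ℝ) + 1) / N ≤ 1 := by
          rw [div_le_one hN0]; exact_mod_cast hk
        have hk0 : (k:ℝ) / N + 1 / N = (k + 1) / N := by ring
        have hk1 : 0 ≤ (k:ℝ) / N := by positivity
        have hN' : 0 < 1 / (N:ℝ) := by positivity
        have mem : ∀ x : ℝ, x ≤ 1 → √x ∈ Icc (0:ℝ) 1 := fun x hx =>
          ⟨Real.sqrt_nonneg _, Real.sqrt_le_one.2 hx⟩
        have hsq : (√(N:ℝ))⁻¹ ^ 2 = 1 / N := by rw [inv_pow, Real.sq_sqrt hN0.le, one_div]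
        have := hK (√(1 - (k + 1) / N)) (mem _ (by linarith)) (√(k / N)) (mem _ (by linarith))
          (√N)⁻¹ ⟨by positivity, inv_le_one_of_one_le₀ (Real.one_le_sqrt.2 hN1)⟩
          (√(1 - k / N)) (mem _ (by linarith)) (√((k + 1) / N)) (mem _ hk')
          (by rw [Real.sq_sqrt (by linarith), Real.sq_sqrt (by linarith), hsq]; ring)
          (by rw [Real.sq_sqrt (by linarith), Real.sq_sqrt (by linarith), hsq]; ring)
        push_cast
        have ih' := ih (by omega)
        change G _ _ ≤ G _ _ + _ at this
        linarith
    have := hstep N le_rfl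
    rw [div_self hN0.ne', sub_self, Real.sqrt_zero, Real.sqrt_one] at this
    refine this.trans_eq ?_
    have h2 : (N:ℝ) = √N ^ 2 := (Real.sq_sqrt hN0.le).symm
    have h3 : (√(N:ℝ)) ≠ 0 := by positivity
    have : (N:ℝ) * (K * (√N)⁻¹ ^ 3) = K * (√N)⁻¹ := by
      generalize √(N:ℝ) = a at *
      rw [h2]; field_simp
    rw [this]
  have hlim : Tendsto (fun N : ℕ => G 0 1 + K * (√(N:ℝ))⁻¹) atTop (nhds (G 0 1 + K * 0)) :=
    ((tendsto_inv_atTop_zero.comp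
      (Real.tendsto_sqrt_atTop.comp tendsto_natCast_atTop_atTop)).const_mul K).const_add _
  have hfin : G 1 0 ≤ G 0 1 + K * 0 :=
    ge_of_tendsto hlim (eventually_atTop.2 ⟨1, fun N hN => hbound N hN⟩)
  have g1 : G 1 0 = ∫ x, expNorm p (fun i => x i - c i / 2) ∂γ := by
    have := integral_fun_fst (μ := γ) (ν := ν) (fun x : ι → ℝ => expNorm p (fun i => x i - c i / 2))
    simp only [probReal_univ, one_smul] at this
    rw [← this]
    simp only [G]
    congr 1; ext z; congr 1; ext i; simp [interpField]
  have g2 : G 0 1 = ∫ x, expNorm p (fun i => x i - d i / 2) ∂ν := by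
    have := integral_fun_snd (μ := γ) (ν := ν) (fun x : ι → ℝ => expNorm p (fun i => x i - d i / 2))
    simp only [probReal_univ, one_smul] at this
    rw [← this]
    simp only [G]
    congr 1; ext z; congr 1; ext i; simp [interpField]
  rw [g1, g2] at hfin
  linarith

end Interpolation

section MaxComparison
variable {ι : Type*} [Fintype ι] [Nonempty ι]

omit [Fintype ι] [Nonempty ι] in
lemma le_iSup_exp [Finite ι] (w : ι → ℝ) (i : ι) : exp (w i) ≤ ⨆ i, exp (w i) :=
  le_ciSup (f := fun i => exp (w i)) (Finite.bddAbove_range _) i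

omit [Fintype ι] in
lemma iSup_exp_nonneg [Finite ι] (w : ι → ℝ) : 0 ≤ ⨆ i, exp (w i) :=
  (exp_pos _).le.trans (le_iSup_exp w (Classical.arbitrary ι))

lemma integrable_iSup_exp (γ : Measure (ι → ℝ)) [IsGaussian γ] {c : ι → ℝ} (hc : ∀ i, 0 ≤ c i) :
    Integrable (fun x : ι → ℝ => ⨆ i, exp (x i - c i / 2)) γ := by
  have h1 := integrable_exp_mul_norm (γ := γ) 1
  refine h1.mono' (Measurable.iSup fun i => by fun_prop).aestronglyMeasurable
    (ae_of_all _ fun x => ?_)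
  rw [Real.norm_eq_abs, abs_of_nonneg (iSup_exp_nonneg _), one_mul]
  refine ciSup_le fun i => Real.exp_le_exp.2 ?_
  have h2 := norm_le_pi_norm x i
  have h3 := le_abs_self (x i)
  rw [Real.norm_eq_abs] at h2
  linarith [hc i]

/-- Larger variograms give larger mean exponential maxima, for variance-corrected centered
Gaussian vectors. -/
theorem integral_iSup_exp_mono (γ ν : Measure (ι → ℝ)) [IsGaussian γ] [IsGaussian ν]
    (h0 : γ[id] = 0) (h0' : ν[id] = 0)
    (hΓ : ∀ i j, ∫ x, (x i - x j) ^ 2 ∂γ ≤ ∫ x, (x i - x j) ^ 2 ∂ν) :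
    ∫ x, ⨆ i, exp (x i - (∫ y, y i ^ 2 ∂γ) / 2) ∂γ ≤
      ∫ x, ⨆ i, exp (x i - (∫ y, y i ^ 2 ∂ν) / 2) ∂ν := by
  have hc : ∀ i, 0 ≤ ∫ x : ι → ℝ, x i ^ 2 ∂γ := fun i => integral_nonneg fun y => sq_nonneg _
  have hd : ∀ i, 0 ≤ ∫ x : ι → ℝ, x i ^ 2 ∂ν := fun i => integral_nonneg fun y => sq_nonneg _
  have hI : ∀ (μ : Measure (ι → ℝ)) [IsGaussian μ] (c : ι → ℝ), (∀ i, 0 ≤ c i) → ∀ p : ℝ, 1 ≤ p →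
      Integrable (fun x => expNorm p (fun i => x i - c i / 2)) μ := by
    intro μ _ c hc p hp
    have := integrable_expNorm_add μ hp 0 c hc (s := 1) (by simp)
    simpa using this
  have hbound : ∀ p : ℝ, 1 ≤ p → ∫ x, ⨆ i, exp (x i - (∫ y, y i ^ 2 ∂γ) / 2) ∂γ ≤
      (Fintype.card ι : ℝ) ^ (1 / p) * ∫ x, ⨆ i, exp (x i - (∫ y, y i ^ 2 ∂ν) / 2) ∂ν := by
    intro p hp
    calc _ ≤ ∫ x, expNorm p (fun i => x i - (∫ y, y i ^ 2 ∂γ) / 2) ∂γ :=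
          integral_mono (integrable_iSup_exp γ hc) (hI γ _ hc p hp) fun x =>
            ciSup_le fun i => exp_le_expNorm hp (fun i => x i - (∫ y, y i ^ 2 ∂γ) / 2) i
      _ ≤ ∫ x, expNorm p (fun i => x i - (∫ y, y i ^ 2 ∂ν) / 2) ∂ν :=
          integral_expNorm_mono γ ν h0 h0' hp hΓ
      _ ≤ ∫ x, (Fintype.card ι : ℝ) ^ (1 / p) * ⨆ i, exp (x i - (∫ y, y i ^ 2 ∂ν) / 2) ∂ν :=
          integral_mono (hI ν _ hd p hp) ((integrable_iSup_exp ν hd).const_mul _) fun x =>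
            expNorm_le_of_forall_exp_le hp _ (fun i => le_iSup_exp
              (fun i => x i - (∫ y, y i ^ 2 ∂ν) / 2) i) (iSup_exp_nonneg _)
      _ = _ := integral_const_mul _ _
  have hcard : (0:ℝ) < Fintype.card ι := by exact_mod_cast Fintype.card_pos
  have hlim : Tendsto (fun p : ℝ => (Fintype.card ι : ℝ) ^ (1 / p) *
      ∫ x, ⨆ i, exp (x i - (∫ y, y i ^ 2 ∂ν) / 2) ∂ν) atTop
      (nhds ((Fintype.card ι : ℝ) ^ (0:ℝ) * ∫ x, ⨆ i, exp (x i - (∫ y, y i ^ 2 ∂ν) / 2) ∂ν)) := by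
    refine Tendsto.mul_const _ (Tendsto.rpow tendsto_const_nhds ?_ (Or.inl hcard.ne'))
    exact tendsto_inv_atTop_zero.congr fun x => (one_div x).symm
  rw [Real.rpow_zero, one_mul] at hlim
  exact ge_of_tendsto hlim (eventually_atTop.2 ⟨1, hbound⟩)

end MaxComparison

section NormalTail

lemma gaussianPDFReal_std (x : ℝ) :
    gaussianPDFReal 0 1 x = (√(2 * π))⁻¹ * exp (-(x ^ 2 / 2)) := by
  simp [gaussianPDFReal_def, neg_div]

lemma gaussianPDFReal_std_add (x y : ℝ) :
    gaussianPDFReal 0 1 (x + y) = gaussianPDFReal 0 1 x * exp (-(x * y + y ^ 2 / 2)) := by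
  rw [gaussianPDFReal_std, gaussianPDFReal_std, mul_assoc, ← Real.exp_add]
  congr 2; ring

lemma stdNormalTail_eq_integral (x : ℝ) :
    stdNormalTail x = ∫ z in Ioi x, gaussianPDFReal 0 1 z := by
  rw [stdNormalTail, gaussianReal_apply_eq_integral _ one_ne_zero, ENNReal.toReal_ofReal]
  exact integral_nonneg fun z => gaussianPDFReal_nonneg _ _ _

lemma stdNormalTail_le {v : ℝ} (hv : 0 < v) (x : ℝ) :
    stdNormalTail x ≤ gaussianPDFReal 0 1 v / v * exp (v * (v - x)) := by
  rw [stdNormalTail_eq_integral]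
  have hi : IntegrableOn (fun z => gaussianPDFReal 0 1 v * exp (v ^ 2) * exp (-v * z)) (Ioi x) :=
    (integrableOn_exp_mul_Ioi (by linarith) x).const_mul _
  calc ∫ z in Ioi x, gaussianPDFReal 0 1 z
      ≤ ∫ z in Ioi x, gaussianPDFReal 0 1 v * exp (v ^ 2) * exp (-v * z) := by
        refine integral_mono (integrable_gaussianPDFReal 0 1).integrableOn hi fun z => ?_
        have := gaussianPDFReal_std_add v (z - v)
        rw [add_sub_cancel] at this
        simp only [this, mul_assoc, ← Real.exp_add]
        refine mul_le_mul_of_nonneg_left (Real.exp_le_exp.2 ?_) (gaussianPDFReal_nonneg _ _ _)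
        nlinarith [sq_nonneg (z - v)]
    _ = gaussianPDFReal 0 1 v / v * exp (v * (v - x)) := by
        rw [integral_const_mul, integral_exp_mul_Ioi (by linarith)]
        rw [show v * (v - x) = v ^ 2 + -v * x by ring, Real.exp_add]
        field_simp

lemma le_stdNormalTail (u : ℝ) :
    gaussianPDFReal 0 1 u * (u / (1 + u ^ 2)) ≤ stdNormalTail u := by
  have hd : ∀ z : ℝ, HasDerivAt (fun z => -(gaussianPDFReal 0 1 z * (z / (1 + z ^ 2))))
      (gaussianPDFReal 0 1 z * (1 - 2 / (1 + z ^ 2) ^ 2)) z := by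
    intro z
    have h1 : HasDerivAt (fun z : ℝ => (√(2 * π))⁻¹ * exp (-(z ^ 2 / 2)))
        ((√(2 * π))⁻¹ * (exp (-(z ^ 2 / 2)) * (-z))) z := by
      refine (HasDerivAt.exp ?_).const_mul _
      have := ((hasDerivAt_pow 2 z).div_const 2).fun_neg
      refine this.congr_deriv ?_
      norm_num
    have hz : (1 + z ^ 2) ≠ 0 := by positivity
    have h2 : HasDerivAt (fun z : ℝ => z / (1 + z ^ 2))
        ((1 * (1 + z ^ 2) - z * (2 * z)) / (1 + z ^ 2) ^ 2) z := by
      refine (hasDerivAt_id z).fun_div ?_ hz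
      refine ((hasDerivAt_pow 2 z).const_add 1).congr_deriv ?_
      norm_num
    have := (h1.fun_mul h2).fun_neg
    simp only [gaussianPDFReal_std]
    refine this.congr_deriv ?_
    field_simp
    ring
  have hle : ∀ z : ℝ, |1 - 2 / (1 + z ^ 2) ^ 2| ≤ 1 := by
    intro z
    have h1 : 1 ≤ (1 + z ^ 2) ^ 2 := by nlinarith [sq_nonneg z, sq_nonneg (z ^ 2)]
    have h2 : 2 / (1 + z ^ 2) ^ 2 ≤ 2 := div_le_self (by norm_num) h1
    have h3 : 0 ≤ 2 / (1 + z ^ 2) ^ 2 := by positivity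
    rw [abs_le]; constructor <;> linarith
  have hI := integrable_gaussianPDFReal 0 1
  have hI' : Integrable (fun z => gaussianPDFReal 0 1 z * (1 - 2 / (1 + z ^ 2) ^ 2)) := by
    refine hI.mono' (by fun_prop) (ae_of_all _ fun z => ?_)
    rw [Real.norm_eq_abs, abs_mul, abs_of_nonneg (gaussianPDFReal_nonneg _ _ _)]
    exact mul_le_of_le_one_right (gaussianPDFReal_nonneg _ _ _) (hle z)
  have hlim : Tendsto (fun z => -(gaussianPDFReal 0 1 z * (z / (1 + z ^ 2)))) atTop (nhds 0) := by
    have h0 : Tendsto (fun z : ℝ => z⁻¹) atTop (nhds 0) := tendsto_inv_atTop_zero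
    rw [tendsto_zero_iff_abs_tendsto_zero]
    refine tendsto_of_tendsto_of_tendsto_of_le_of_le' tendsto_const_nhds h0
      (Eventually.of_forall fun z => abs_nonneg _) ?_
    filter_upwards [eventually_gt_atTop 0] with z hz
    have h1 : gaussianPDFReal 0 1 z ≤ 1 := by
      rw [gaussianPDFReal_std]
      refine mul_le_one₀ (inv_le_one_of_one_le₀ (Real.one_le_sqrt.2 ?_)) (exp_pos _).le
        (Real.exp_le_one_iff.2 (by nlinarith))
      nlinarith [Real.pi_gt_three]
    have h2 : z / (1 + z ^ 2) ≤ z⁻¹ := by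
      rw [inv_eq_one_div, div_le_div_iff₀ (by positivity) hz]; nlinarith
    simp only [Function.comp, abs_neg]
    rw [abs_of_nonneg (mul_nonneg (gaussianPDFReal_nonneg _ _ _) (by positivity))]
    calc _ ≤ 1 * (z / (1 + z ^ 2)) := mul_le_mul_of_nonneg_right h1 (by positivity)
      _ ≤ _ := by rw [one_mul]; exact h2
  have key := integral_Ioi_of_hasDerivAt_of_tendsto' (a := u) (fun z _ => hd z) hI'.integrableOn hlim
  rw [stdNormalTail_eq_integral]
  rw [sub_neg_eq_add, zero_add] at key
  rw [← key]
  refine integral_mono hI'.integrableOn hI.integrableOn fun z => ?_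
  exact mul_le_of_le_one_right (gaussianPDFReal_nonneg _ _ _) ((le_abs_self _).trans (hle z))

end NormalTail

section Conditioning
variable {ι : Type*} [Fintype ι] {γ : Measure (ι → ℝ)} [IsGaussian γ]

lemma integrable_eval_mul (i j : ι) : Integrable (fun x : ι → ℝ => x i * x j) γ :=
  (memLp_eval i).integrable_mul (memLp_eval j)

lemma integral_combination_sq (a b c : ℝ) (i j k : ι) :
    ∫ x : ι → ℝ, (a * x i + b * x j + c * x k) ^ 2 ∂γ =
      a ^ 2 * ∫ x, x i ^ 2 ∂γ + b ^ 2 * ∫ x, x j ^ 2 ∂γ + c ^ 2 * ∫ x, x k ^ 2 ∂γ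
      + 2 * a * b * ∫ x, x i * x j ∂γ + 2 * a * c * ∫ x, x i * x k ∂γ
      + 2 * b * c * ∫ x, x j * x k ∂γ := by
  have hs : ∀ i, Integrable (fun x : ι → ℝ => x i ^ 2) γ := fun i => (memLp_eval i).integrable_sq
  have e : ∀ x : ι → ℝ, (a * x i + b * x j + c * x k) ^ 2 = a ^ 2 * x i ^ 2 + (b ^ 2 * x j ^ 2 +
      (c ^ 2 * x k ^ 2 + (2 * a * b * (x i * x j) + (2 * a * c * (x i * x k) +
        2 * b * c * (x j * x k))))) := fun x => by ring
  have i1 := (hs i).const_mul (a ^ 2)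
  have i2 := (hs j).const_mul (b ^ 2)
  have i3 := (hs k).const_mul (c ^ 2)
  have i4 := (integrable_eval_mul (γ := γ) i j).const_mul (2 * a * b)
  have i5 := (integrable_eval_mul (γ := γ) i k).const_mul (2 * a * c)
  have i6 := (integrable_eval_mul (γ := γ) j k).const_mul (2 * b * c)
  have j5 := integral_add i5 i6
  have j4 := integral_add i4 (i5.add i6)
  have j3 := integral_add i3 (i4.add (i5.add i6))
  have j2 := integral_add i2 (i3.add (i4.add (i5.add i6)))
  have j1 := integral_add i1 (i2.add (i3.add (i4.add (i5.add i6))))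
  simp only [Pi.add_apply] at j1 j2 j3 j4 j5
  simp only [e]
  rw [j1, j2, j3, j4, j5]
  simp only [integral_const_mul]
  ring

lemma integral_sub_sq (i j : ι) : ∫ x : ι → ℝ, (x i - x j) ^ 2 ∂γ =
    ∫ x, x i ^ 2 ∂γ + ∫ x, x j ^ 2 ∂γ - 2 * ∫ x, x i * x j ∂γ := by
  have := integral_combination_sq (γ := γ) 1 (-1) 0 i j j
  simp only [one_mul, neg_one_mul, zero_mul, add_zero, ← sub_eq_add_neg] at this
  rw [this]; ring

lemma integrable_iSup_exp_mul [Nonempty ι] (a b c : ι → ℝ) (i₀ : ι) :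
    Integrable (fun x : ι → ℝ => ⨆ i, exp (a i * x i + b i * x i₀ + c i)) γ := by
  have h1 := (integrable_exp_mul_norm (γ := γ) (∑ i, (|a i| + |b i|))).mul_const
    (exp (∑ i, |c i|))
  refine h1.mono' (Measurable.iSup fun i => by fun_prop).aestronglyMeasurable
    (ae_of_all _ fun x => ?_)
  rw [Real.norm_eq_abs, abs_of_nonneg (iSup_exp_nonneg _), ← Real.exp_add]
  refine ciSup_le fun i => Real.exp_le_exp.2 ?_
  have h2 := norm_le_pi_norm x i
  have h3 := norm_le_pi_norm x i₀
  have e1 : a i * x i ≤ |a i| * ‖x‖ := (le_abs_self _).trans (by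
    rw [abs_mul]; exact mul_le_mul_of_nonneg_left h2 (abs_nonneg _))
  have e2 : b i * x i₀ ≤ |b i| * ‖x‖ := (le_abs_self _).trans (by
    rw [abs_mul]; exact mul_le_mul_of_nonneg_left h3 (abs_nonneg _))
  have e3 : |c i| ≤ ∑ i, |c i| :=
    Finset.single_le_sum (f := fun i => |c i|) (fun j _ => abs_nonneg _) (Finset.mem_univ i)
  have e4 : |a i| + |b i| ≤ ∑ i, (|a i| + |b i|) :=
    Finset.single_le_sum (f := fun i => |a i| + |b i|) (fun j _ => by positivity)
      (Finset.mem_univ i)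
  have e5 := mul_le_mul_of_nonneg_right e4 (norm_nonneg x)
  have := le_abs_self (c i)
  linarith

lemma indepFun_residual (h0 : γ[id] = 0) (i₀ : ι) (hv : ∫ x, x i₀ ^ 2 ∂γ = 1) :
    IndepFun (fun x : ι → ℝ => x i₀)
      (fun x i => x i - (∫ x, x i * x i₀ ∂γ) * x i₀) γ := by
  have hG : HasGaussianLaw (fun x : ι → ℝ => ((fun _ : Unit => x i₀),
      (fun i => x i - (∫ x, x i * x i₀ ∂γ) * x i₀))) γ := by
    let pr (i : ι) : (ι → ℝ) →L[ℝ] ℝ := ContinuousLinearMap.proj i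
    exact (IsGaussian.hasGaussianLaw_id (μ := γ)).map
      ((ContinuousLinearMap.pi fun _ : Unit => pr i₀).prod
      (ContinuousLinearMap.pi fun i => pr i - (∫ x, x i * x i₀ ∂γ) • pr i₀))
  have := hG.indepFun_of_covariance_eval fun _ i => by
    have m1 : MemLp (fun x : ι → ℝ => x i₀) 2 γ := memLp_eval i₀
    have m2 : MemLp (fun x : ι → ℝ => x i - (∫ x, x i * x i₀ ∂γ) * x i₀) 2 γ :=
      (memLp_eval i).sub (m1.const_mul _)
    rw [covariance_eq_sub m1 m2]
    have e : ∀ x : ι → ℝ, ((fun x : ι → ℝ => x i₀) *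
        (fun x : ι → ℝ => x i - (∫ x, x i * x i₀ ∂γ) * x i₀)) x =
        x i * x i₀ - (∫ x, x i * x i₀ ∂γ) * x i₀ ^ 2 := fun x => by
      simp only [Pi.mul_apply]; ring
    simp only [e]
    rw [integral_eval_eq_zero h0, zero_mul, sub_zero,
      integral_sub (integrable_eval_mul i i₀) ((memLp_eval i₀).integrable_sq.const_mul _),
      integral_const_mul, hv, mul_one, sub_self]
  exact this.comp (φ := fun f : Unit → ℝ => f ()) (ψ := id) (by fun_prop) measurable_id

lemma map_eval_eq_gaussianReal (h0 : γ[id] = 0) (i₀ : ι) (hv : ∫ x, x i₀ ^ 2 ∂γ = 1) :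
    γ.map (fun x => x i₀) = gaussianReal 0 1 := by
  have h := (IsGaussian.hasGaussianLaw_id (μ := γ)).map (ContinuousLinearMap.proj (R := ℝ) i₀)
  have := h.map_eq_gaussianReal
  have e : (⇑(ContinuousLinearMap.proj (R := ℝ) (φ := fun _ : ι => ℝ) i₀) ∘ id) =
    fun x : ι → ℝ => x i₀ := rfl
  rw [e, variance_eq_sub (memLp_eval i₀), integral_eval_eq_zero h0] at this
  simpa [hv] using this

/-- Exceedance probability of a Gaussian vector, by conditioning on one coordinate. -/
lemma measureReal_exists_lt_le_integral [Nonempty ι] (h0 : γ[id] = 0) (i₀ : ι)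
    (hv : ∫ x, x i₀ ^ 2 ∂γ = 1) (hr : ∀ i, 0 < ∫ x, x i * x i₀ ∂γ) {v : ℝ} (hv0 : 0 < v) :
    γ.real {x | ∃ i, v < x i} ≤ gaussianPDFReal 0 1 v / v *
      ∫ x, ⨆ i, exp (v / (∫ x, x i * x i₀ ∂γ) * x i + -v * x i₀ +
        -(v ^ 2 * (1 - ∫ x, x i * x i₀ ∂γ) / (∫ x, x i * x i₀ ∂γ))) ∂γ := by
  have hind := indepFun_residual h0 i₀ hv
  have hmap := map_eval_eq_gaussianReal h0 i₀ hv
  have hint := integrable_iSup_exp_mul (γ := γ) (fun i => v / (∫ x, x i * x i₀ ∂γ)) (fun _ => -v)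
    (fun i => -(v ^ 2 * (1 - ∫ x, x i * x i₀ ∂γ) / (∫ x, x i * x i₀ ∂γ))) i₀
  obtain ⟨r, hrdef⟩ : ∃ r : ι → ℝ, r = fun i => ∫ x, x i * x i₀ ∂γ := ⟨_, rfl⟩
  have hr' : ∀ i, ∫ x, x i * x i₀ ∂γ = r i := fun i => by rw [hrdef]
  simp only [hr'] at hind hr hint ⊢
  have hYm : Measurable fun (x : ι → ℝ) i => x i - r i * x i₀ := by fun_prop
  rw [indepFun_iff_map_prod_eq_prod_map_map (measurable_pi_apply i₀).aemeasurable
    hYm.aemeasurable, hmap] at hind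
  set Y : (ι → ℝ) → ι → ℝ := fun x i => x i - r i * x i₀ with hY
  set S : Set (ℝ × (ι → ℝ)) := {z | ∃ i, v < r i * z.1 + z.2 i} with hS
  have hSm : MeasurableSet S := by
    rw [hS, ofPred_exists]
    exact MeasurableSet.iUnion fun i => measurableSet_lt measurable_const (by fun_prop)
  have e1 : {x : ι → ℝ | ∃ i, v < x i} = (fun x => (x i₀, Y x)) ⁻¹' S := by
    ext x; simp [hS, hY]
  have hφ : 0 ≤ gaussianPDFReal 0 1 v / v := div_nonneg (gaussianPDFReal_nonneg _ _ _) hv0.le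
  set g : (ι → ℝ) → ℝ := fun x => ⨆ i, exp (v / r i * x i + -v * x i₀ +
    -(v ^ 2 * (1 - r i) / r i)) with hg
  have hg0 : ∀ x, 0 ≤ g x := fun x => iSup_exp_nonneg _
  rw [Measure.real, ← integral_const_mul]
  refine ENNReal.toReal_le_of_le_ofReal (integral_nonneg fun x => mul_nonneg hφ (hg0 x)) ?_
  rw [e1, ← Measure.map_apply (by fun_prop) hSm, hind, Measure.prod_apply_symm hSm,
    lintegral_map (measurable_measure_prodMk_right hSm) hYm,
    ofReal_integral_eq_lintegral_ofReal (hint.const_mul _)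
      (ae_of_all _ fun x => mul_nonneg hφ (hg0 x))]
  refine lintegral_mono fun x => ?_
  obtain ⟨i, hi⟩ := Finite.exists_min fun i => (v - Y x i) / r i
  have hsub : (fun a => (a, Y x)) ⁻¹' S ⊆ Ioi ((v - Y x i) / r i) := by
    rintro a ⟨j, hj⟩
    refine mem_Ioi.2 ((hi j).trans_lt ?_)
    rw [div_lt_iff₀ (hr j)]
    simp only at hj
    linarith
  refine (measure_mono hsub).trans ?_
  have hΨ : gaussianReal 0 1 (Ioi ((v - Y x i) / r i)) =
      ENNReal.ofReal (stdNormalTail ((v - Y x i) / r i)) := by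
    rw [stdNormalTail, ENNReal.ofReal_toReal (measure_ne_top _ _)]
  rw [hΨ]
  refine ENNReal.ofReal_le_ofReal ((stdNormalTail_le hv0 _).trans
    (mul_le_mul_of_nonneg_left ?_ hφ))
  refine le_trans (Real.exp_le_exp.2 (le_of_eq ?_)) (le_iSup_exp (fun i => v / r i * x i +
    -v * x i₀ + -(v ^ 2 * (1 - r i) / r i)) i)
  have := (hr i).ne'
  simp only [hY]
  field_simp
  ring

end Conditioning

section Conditioning
variable {ι : Type*} [Fintype ι] {γ : Measure (ι → ℝ)} [IsGaussian γ]

lemma variogram_normalized_le (hv : ∀ i, ∫ x, x i ^ 2 ∂γ = 1) (i₀ i j : ι) {η : ℝ}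
    (hη0 : 0 ≤ η) (hη : η < 1) (hr : ∀ i, 1 - η ≤ ∫ x, x i * x i₀ ∂γ) :
    ∫ x, (1 / (∫ x, x i * x i₀ ∂γ) * x i + -(1 / (∫ x, x j * x i₀ ∂γ)) * x j + 0 * x i₀) ^ 2 ∂γ ≤
      (1 + 2 * η) / (1 - η) ^ 4 * ∫ x, (x i - x j) ^ 2 ∂γ := by
  have hCS : ∀ t : ℝ, 0 ≤ (∫ x : ι → ℝ, (x i - x j) ^ 2 ∂γ) * (t * t) +
      (2 * (∫ x, x i * x i₀ ∂γ - ∫ x, x j * x i₀ ∂γ)) * t +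
      (3 / 2 - ∫ x, x i * x i₀ ∂γ - ∫ x, x j * x i₀ ∂γ + (∫ x, x i * x j ∂γ) / 2) := by
    intro t
    have h : 0 ≤ ∫ x : ι → ℝ, ((t - 1 / 2) * x i + (-t - 1 / 2) * x j + 1 * x i₀) ^ 2 ∂γ :=
      integral_nonneg fun x => sq_nonneg _
    rw [integral_combination_sq, hv, hv, hv] at h
    rw [integral_sub_sq, hv, hv]
    linarith
  have hD := discrim_le_zero hCS
  have hD0 : 0 ≤ ∫ x : ι → ℝ, (x i - x j) ^ 2 ∂γ := integral_nonneg fun x => sq_nonneg _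
  have hi := hr i
  have hj := hr j
  have hle : ∫ x, x i * x j ∂γ ≤ 1 := by
    rw [integral_sub_sq, hv, hv] at hD0; linarith
  rw [integral_combination_sq, hv, hv, hv]
  have hDe := integral_sub_sq (γ := γ) i j
  rw [hv, hv] at hDe
  generalize ∫ x, x i * x i₀ ∂γ = a at *
  generalize ∫ x, x j * x i₀ ∂γ = b at *
  generalize ∫ x, x i * x j ∂γ = c at *
  generalize ∫ x : ι → ℝ, (x i - x j) ^ 2 ∂γ = D at *
  rw [discrim] at hD
  have ha : 0 < a := by linarith
  have hb : 0 < b := by linarith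
  have h1 : (a - b) ^ 2 ≤ 2 * η * D := by
    have : D * (3 / 2 - a - b + c / 2) ≤ D * (2 * η) :=
      mul_le_mul_of_nonneg_left (by linarith) hD0
    nlinarith
  have hη' : 0 < 1 - η := by linarith
  have hab : (1 - η) ^ 2 ≤ a * b := by
    rw [sq]; exact mul_le_mul hi hj hη'.le ha.le
  have e : (1 / a) ^ 2 * 1 + (-(1 / b)) ^ 2 * 1 + 0 ^ 2 * 1 + 2 * (1 / a) * (-(1 / b)) * c +
      2 * (1 / a) * 0 * a + 2 * -(1 / b) * 0 * b = (a - b) ^ 2 / (a * b) ^ 2 + D / (a * b) := by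
    rw [hDe]; field_simp; ring
  rw [e]
  have s1 : (a - b) ^ 2 / (a * b) ^ 2 ≤ 2 * η * D / (1 - η) ^ 4 := by
    refine div_le_div₀ (by positivity) h1 (by positivity) ?_
    calc (1 - η) ^ 4 = ((1 - η) ^ 2) ^ 2 := by ring
      _ ≤ _ := by gcongr
  have s2 : D / (a * b) ≤ D / (1 - η) ^ 4 := by
    refine div_le_div_of_nonneg_left hD0 (by positivity) (le_trans ?_ hab)
    exact pow_le_pow_of_le_one hη'.le (by linarith) (by norm_num)
  calc _ ≤ 2 * η * D / (1 - η) ^ 4 + D / (1 - η) ^ 4 := add_le_add s1 s2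
    _ = _ := by ring

/-- Tail bound for the maximum of a standardized Gaussian vector in terms of the mean exponential
maximum of a comparison vector with a larger variogram. -/
theorem measureReal_exists_lt_le [Nonempty ι] (h0 : γ[id] = 0) (hv : ∀ i, ∫ x, x i ^ 2 ∂γ = 1)
    (i₀ : ι) {η : ℝ} (hη0 : 0 ≤ η) (hη : η < 1) (hr : ∀ i, 1 - η ≤ ∫ x, x i * x i₀ ∂γ)
    {v : ℝ} (hv0 : 0 < v) (ν : Measure (ι → ℝ)) [IsGaussian ν] (h0' : ν[id] = 0)
    (hΓ : ∀ i j, v ^ 2 * ((1 + 2 * η) / (1 - η) ^ 4 * ∫ x, (x i - x j) ^ 2 ∂γ) ≤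
      ∫ x, (x i - x j) ^ 2 ∂ν) :
    γ.real {x | ∃ i, v < x i} ≤ gaussianPDFReal 0 1 v / v * (exp (v ^ 2 * η ^ 2 / (2 * (1 - η) ^ 2))
      * ∫ x, ⨆ i, exp (x i - (∫ y, y i ^ 2 ∂ν) / 2) ∂ν) := by
  have hη' : 0 < 1 - η := by linarith
  refine (measureReal_exists_lt_le_integral h0 i₀ (hv i₀) (fun i => hη'.trans_le (hr i)) hv0).trans
    (mul_le_mul_of_nonneg_left ?_ (div_nonneg (gaussianPDFReal_nonneg _ _ _) hv0.le))
  have hvg := fun i j => variogram_normalized_le hv i₀ i j hη0 hη hr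
  have hcs := fun i (a b : ℝ) => integral_combination_sq (γ := γ) a b 0 i i₀ i₀
  have hint := integrable_iSup_exp_mul (γ := γ) (fun i => v / (∫ x, x i * x i₀ ∂γ)) (fun _ => -v)
    (fun i => -(v ^ 2 * (1 - ∫ x, x i * x i₀ ∂γ) / (∫ x, x i * x i₀ ∂γ))) i₀
  have hr1 : ∀ i, ∫ x, x i * x i₀ ∂γ ≤ 1 := fun i => by
    have h1 := integral_sub_sq (γ := γ) i i₀
    have h2 : 0 ≤ ∫ x : ι → ℝ, (x i - x i₀) ^ 2 ∂γ := integral_nonneg fun x => sq_nonneg _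
    rw [h1, hv, hv] at h2; linarith
  obtain ⟨r, hrdef⟩ : ∃ r : ι → ℝ, r = fun i => ∫ x, x i * x i₀ ∂γ := ⟨_, rfl⟩
  have hr' : ∀ i, ∫ x, x i * x i₀ ∂γ = r i := fun i => by rw [hrdef]
  simp only [hr', hv] at hr hvg hcs hint hr1 ⊢
  have hrp : ∀ i, 0 < r i := fun i => hη'.trans_le (hr i)
  let pr (i : ι) : (ι → ℝ) →L[ℝ] ℝ := ContinuousLinearMap.proj i
  let G : (ι → ℝ) →L[ℝ] (ι → ℝ) :=
    ContinuousLinearMap.pi fun i => (v / r i) • pr i + (-v) • pr i₀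
  have hGi : ∀ x i, G x i = v / r i * x i + -v * x i₀ := fun x i => rfl
  have hGm : Measurable G := G.continuous.measurable
  have hG0 : (γ.map G)[id] = 0 := by
    rw [integral_map hGm.aemeasurable (by fun_prop)]
    simp only [id]
    have e := G.integral_comp_comm (IsGaussian.integrable_id (μ := γ))
    simp only [id] at e h0
    rw [e, h0, map_zero]
  have hvar : ∀ i, ∫ y, y i ^ 2 ∂(γ.map G) = v ^ 2 * (1 - r i ^ 2) / r i ^ 2 := fun i => by
    rw [integral_map hGm.aemeasurable (Continuous.aestronglyMeasurable (by fun_prop))]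
    have := hcs i (v / r i) (-v)
    simp only [zero_mul, add_zero] at this
    simp only [hGi]
    rw [this]
    have := (hrp i).ne'
    field_simp
    ring
  have hmono := integral_iSup_exp_mono (γ.map G) ν hG0 h0' fun i j => by
    refine le_trans (le_of_eq_of_le ?_ (mul_le_mul_of_nonneg_left (hvg i j) (sq_nonneg v))) (hΓ i j)
    rw [integral_map hGm.aemeasurable (Continuous.aestronglyMeasurable (by fun_prop)),
      ← integral_const_mul]
    refine integral_congr_ae (ae_of_all _ fun x => ?_)
    simp only [hGi]
    ring
  simp only [hvar] at hmono
  refine le_trans ?_ (mul_le_mul_of_nonneg_left hmono (exp_pos _).le)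
  have hint2 := integrable_iSup_exp (γ.map G) (c := fun i => v ^ 2 * (1 - r i ^ 2) / r i ^ 2)
    fun i => by
      have : 0 ≤ 1 - r i ^ 2 := by nlinarith [hrp i, hr1 i]
      positivity
  rw [integrable_map_measure (Measurable.iSup fun i => by fun_prop).aestronglyMeasurable
    hGm.aemeasurable] at hint2
  rw [integral_map hGm.aemeasurable (Measurable.iSup fun i => by fun_prop).aestronglyMeasurable,
    ← integral_const_mul]
  refine integral_mono hint (hint2.const_mul _) fun x => ciSup_le fun i => ?_
  refine le_trans ?_ (mul_le_mul_of_nonneg_left (le_iSup_exp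
    (fun i => G x i - v ^ 2 * (1 - r i ^ 2) / r i ^ 2 / 2) i) (exp_pos _).le)
  rw [← Real.exp_add, Real.exp_le_exp, hGi]
  have h1 : -(v ^ 2 * (1 - r i) / r i) + v ^ 2 * (1 - r i ^ 2) / r i ^ 2 / 2 =
      v ^ 2 * (1 - r i) ^ 2 / (2 * r i ^ 2) := by
    have := (hrp i).ne'
    field_simp
    ring
  have h2 : v ^ 2 * (1 - r i) ^ 2 / (2 * r i ^ 2) ≤ v ^ 2 * η ^ 2 / (2 * (1 - η) ^ 2) := by
    have a1 := hr i
    have a2 : 0 ≤ 1 - r i := by linarith [hr1 i]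
    have a3 : 1 - r i ≤ η := by linarith
    gcongr
  linarith

end Conditioning

section Chernoff
variable {ι : Type*} [Fintype ι] {γ : Measure (ι → ℝ)} [IsGaussian γ]

/-- Chernoff-type bound for the maximum of a Gaussian vector in terms of the mean exponential
maximum of a comparison vector with a larger variogram. -/
theorem measureReal_exists_lt_le_exp [Nonempty ι] (h0 : γ[id] = 0) {S : ℝ}
    (hS : ∀ i, ∫ x, x i ^ 2 ∂γ ≤ S) {θ : ℝ} (hθ : 0 ≤ θ) (u : ℝ)
    (ν : Measure (ι → ℝ)) [IsGaussian ν] (h0' : ν[id] = 0)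
    (hΓ : ∀ i j, θ ^ 2 * ∫ x, (x i - x j) ^ 2 ∂γ ≤ ∫ x, (x i - x j) ^ 2 ∂ν) :
    γ.real {x | ∃ i, u < x i} ≤ exp (-(θ * u) + θ ^ 2 * S / 2) *
      ∫ x, ⨆ i, exp (x i - (∫ y, y i ^ 2 ∂ν) / 2) ∂ν := by
  let G : (ι → ℝ) →L[ℝ] (ι → ℝ) := θ • ContinuousLinearMap.id ℝ _
  have hGi : ∀ x i, G x i = θ * x i := fun x i => rfl
  have hGm : Measurable G := G.continuous.measurable
  have hG0 : (γ.map G)[id] = 0 := by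
    rw [integral_map hGm.aemeasurable (by fun_prop)]
    have e := G.integral_comp_comm (IsGaussian.integrable_id (μ := γ))
    simp only [id] at e h0
    simp only [id]
    rw [e, h0, map_zero]
  have hvar : ∀ i, ∫ y, y i ^ 2 ∂(γ.map G) = θ ^ 2 * ∫ y, y i ^ 2 ∂γ := fun i => by
    rw [integral_map hGm.aemeasurable (Continuous.aestronglyMeasurable (by fun_prop))]
    simp only [hGi, mul_pow, integral_const_mul]
  have hmono := integral_iSup_exp_mono (γ.map G) ν hG0 h0' fun i j => by
    refine le_of_eq_of_le ?_ (hΓ i j)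
    rw [integral_map hGm.aemeasurable (Continuous.aestronglyMeasurable (by fun_prop)),
      ← integral_const_mul]
    refine integral_congr_ae (ae_of_all _ fun x => ?_)
    simp only [hGi]
    ring
  refine le_trans ?_ (mul_le_mul_of_nonneg_left hmono (exp_pos _).le)
  simp only [hvar]
  have hint2 := integrable_iSup_exp (γ.map G) (c := fun i => θ ^ 2 * ∫ y, y i ^ 2 ∂γ)
    fun i => mul_nonneg (sq_nonneg _) (integral_nonneg fun x => sq_nonneg _)
  rw [integrable_map_measure (Measurable.iSup fun i => by fun_prop).aestronglyMeasurable
    hGm.aemeasurable] at hint2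
  rw [integral_map hGm.aemeasurable (Measurable.iSup fun i => by fun_prop).aestronglyMeasurable]
  have hmarkov := mul_meas_ge_le_integral_of_nonneg
    (ae_of_all _ fun x => iSup_exp_nonneg (fun i => G x i - θ ^ 2 * (∫ y, y i ^ 2 ∂γ) / 2))
    hint2 (exp (θ * u - θ ^ 2 * S / 2))
  rw [show -(θ * u) + θ ^ 2 * S / 2 = -(θ * u - θ ^ 2 * S / 2) by ring, Real.exp_neg,
    ← div_eq_inv_mul, le_div_iff₀ (exp_pos _), mul_comm]
  refine le_trans (mul_le_mul_of_nonneg_left (measureReal_mono ?_) (exp_pos _).le) hmarkov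
  rintro x ⟨i, hi⟩
  refine le_trans (Real.exp_le_exp.2 ?_) (le_iSup_exp
    (fun i => G x i - θ ^ 2 * (∫ y, y i ^ 2 ∂γ) / 2) i)
  have h1 := mul_le_mul_of_nonneg_left hi.le hθ
  have h2 := mul_le_mul_of_nonneg_left (hS i) (sq_nonneg θ)
  rw [hGi]
  linarith

end Chernoff

section FBM
variable {Ω : Type*} [MeasurableSpace Ω]

/-- Fractional Brownian motion with Hurst index `H`: finite-dimensional laws are centered Gaussian
with the fBm covariance on `[0, ∞)`, and paths are almost surely continuous. -/
structure IsFBM (B : ℝ → Ω → ℝ) (H : ℝ) (μ : Measure Ω) : Prop where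
  measurable : ∀ t, Measurable (B t)
  continuous : ∀ᵐ ω ∂μ, Continuous fun t => B t ω
  gauss : ∀ (n : ℕ) (c : Fin n → ℝ) (t : Fin n → ℝ),
      ∃ v : NNReal, μ.map (fun ω => ∑ i, c i * B (t i) ω) = gaussianReal 0 v
  cov : ∀ t s : ℝ, 0 ≤ t → 0 ≤ s →
      ∫ ω, B t ω * B s ω ∂μ = (t ^ (2*H) + s ^ (2*H) - |t - s| ^ (2*H)) / 2

variable {μ : Measure Ω} {B : ℝ → Ω → ℝ} {H : ℝ}

namespace IsFBM

lemma hasGaussianLaw (hB : IsFBM B H μ) {ι : Type*} [Fintype ι] (t : ι → ℝ) :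
    HasGaussianLaw (fun ω i => B (t i) ω) μ := by
  classical
  refine ⟨isGaussian_of_map_eq_gaussianReal fun L => ?_⟩
  have hm : Measurable fun ω i => B (t i) ω := measurable_pi_lambda _ fun i => hB.measurable _
  let e := Fintype.equivFin ι
  obtain ⟨v, hv⟩ := hB.gauss (Fintype.card ι) (fun j => L (Pi.single (e.symm j) 1))
    fun j => t (e.symm j)
  refine ⟨0, v, ?_⟩
  rw [Measure.map_map L.continuous.measurable hm, ← hv]
  congr 1
  ext ω
  simp only [Function.comp]
  conv_lhs => rw [← Finset.univ_sum_single fun i => B (t i) ω]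
  rw [map_sum, ← e.symm.sum_comp]
  refine Finset.sum_congr rfl fun j _ => ?_
  have : (Pi.single (e.symm j) (B (t (e.symm j)) ω) : ι → ℝ) =
      B (t (e.symm j)) ω • Pi.single (e.symm j) (1:ℝ) := by
    rw [← Pi.single_smul, smul_eq_mul, mul_one]
  rw [this, map_smul, smul_eq_mul, mul_comm]

lemma memLp (hB : IsFBM B H μ) (t : ℝ) : MemLp (B t) 2 μ :=
  ((hB.hasGaussianLaw fun _ : Unit => t).eval ()).memLp_two

lemma integral_eq_zero (hB : IsFBM B H μ) (t : ℝ) : ∫ ω, B t ω ∂μ = 0 := by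
  obtain ⟨v, hv⟩ := hB.gauss 1 (fun _ => 1) fun _ => t
  simp only [Finset.univ_unique, Finset.sum_const, Finset.card_singleton, one_smul, one_mul] at hv
  have h := integral_map (μ := μ) (f := fun x : ℝ => x) (hB.measurable t).aemeasurable (by fun_prop)
  rw [← h]
  change ∫ x, x ∂(μ.map fun ω => B t ω) = 0
  rw [hv, integral_id_gaussianReal]

lemma integrable_mul (hB : IsFBM B H μ) (s t : ℝ) : Integrable (fun ω => B s ω * B t ω) μ :=
  (hB.memLp s).integrable_mul (hB.memLp t)

/-- Covariance of two increments. -/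
lemma integral_increment_mul (hB : IsFBM B H μ) {a b a' b' : ℝ} (ha : 0 ≤ a) (hb : 0 ≤ b)
    (ha' : 0 ≤ a') (hb' : 0 ≤ b') :
    ∫ ω, (B b ω - B a ω) * (B b' ω - B a' ω) ∂μ =
      (|b - a'| ^ (2 * H) + |b' - a| ^ (2 * H) - |b - b'| ^ (2 * H) - |a - a'| ^ (2 * H)) / 2 := by
  have e : ∀ ω, (B b ω - B a ω) * (B b' ω - B a' ω) =
      (B b ω * B b' ω - B b ω * B a' ω) - (B a ω * B b' ω - B a ω * B a' ω) := fun ω => by ring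
  have i1 := hB.integrable_mul b b'
  have i2 := hB.integrable_mul b a'
  have i3 := hB.integrable_mul a b'
  have i4 := hB.integrable_mul a a'
  have j1 := integral_sub (i1.sub i2) (i3.sub i4)
  simp only [Pi.sub_apply] at j1
  simp only [e]
  rw [j1, integral_sub i1 i2, integral_sub i3 i4, hB.cov _ _ hb hb', hB.cov _ _ hb ha',
    hB.cov _ _ ha hb', hB.cov _ _ ha ha', abs_sub_comm a b']
  ring

lemma integral_increment_sq (hB : IsFBM B H μ) (hH : 0 < H) {a b : ℝ} (ha : 0 ≤ a) (hb : 0 ≤ b) :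
    ∫ ω, (B b ω - B a ω) ^ 2 ∂μ = |b - a| ^ (2 * H) := by
  simp only [sq]
  rw [hB.integral_increment_mul ha hb ha hb]
  simp [Real.zero_rpow (by positivity : 2 * H ≠ 0)]

lemma integral_sq (hB : IsFBM B H μ) (hH : 0 < H) {t : ℝ} (ht : 0 ≤ t) :
    ∫ ω, B t ω ^ 2 ∂μ = t ^ (2 * H) := by
  simp only [sq]
  rw [hB.cov _ _ ht ht]
  simp [Real.zero_rpow (by positivity : 2 * H ≠ 0)]

/-- The mean of the exponential supremum entering Pickands' constant. -/
noncomputable def pickandsMean (B : ℝ → Ω → ℝ) (H : ℝ) (μ : Measure Ω) (l : ℝ) : ℝ :=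
  ∫ ω, exp (⨆ t : Icc (0:ℝ) l, (√2 * B (t:ℝ) ω - (t:ℝ) ^ (2 * H))) ∂μ

lemma ae_le_iSup (hB : IsFBM B H μ) (hH : 0 < H) (l : ℝ) : ∀ᵐ ω ∂μ, ∀ t ∈ Icc (0:ℝ) l,
    √2 * B t ω - t ^ (2 * H) ≤ ⨆ t : Icc (0:ℝ) l, (√2 * B (t:ℝ) ω - (t:ℝ) ^ (2 * H)) := by
  filter_upwards [hB.continuous] with ω hω t ht
  have hc : Continuous fun t : Icc (0:ℝ) l => √2 * B (t:ℝ) ω - (t:ℝ) ^ (2 * H) :=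
    (continuous_const.mul (hω.comp continuous_subtype_val)).sub
      (continuous_subtype_val.rpow_const fun _ => Or.inr (by positivity))
  exact le_ciSup (f := fun t : Icc (0:ℝ) l => √2 * B (t:ℝ) ω - (t:ℝ) ^ (2 * H))
    (isCompact_range hc).bddAbove ⟨t, ht⟩

/-- An additive two-parameter comparison vector, whose mean exponential maximum is controlled by
the square of `pickandsMean`. -/
lemma exists_additive_gaussian [IsProbabilityMeasure μ] (hB : IsFBM B H μ) (hH : 0 < H) {l : ℝ}
    (hl : Integrable (fun ω => exp (⨆ t : Icc (0:ℝ) l, (√2 * B (t:ℝ) ω - (t:ℝ) ^ (2 * H)))) μ)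
    {ι : Type*} [Fintype ι] [Nonempty ι] {α β : ι → ℝ} (hα : ∀ i, α i ∈ Icc 0 l)
    (hβ : ∀ i, β i ∈ Icc 0 l) :
    ∃ ν : Measure (ι → ℝ), IsGaussian ν ∧ ν[id] = 0 ∧
      (∀ i j, ∫ x, (x i - x j) ^ 2 ∂ν =
        2 * (|α i - α j| ^ (2 * H) + |β i - β j| ^ (2 * H))) ∧
      ∫ x, ⨆ i, exp (x i - (∫ y, y i ^ 2 ∂ν) / 2) ∂ν ≤ pickandsMean B H μ l ^ 2 := by
  set γα := μ.map fun ω i => B (α i) ω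
  set γβ := μ.map fun ω i => B (β i) ω
  have mα : Measurable fun ω i => B (α i) ω := measurable_pi_lambda _ fun i => hB.measurable _
  have mβ : Measurable fun ω i => B (β i) ω := measurable_pi_lambda _ fun i => hB.measurable _
  have gα : IsGaussian γα := (hB.hasGaussianLaw α).isGaussian_map
  have gβ : IsGaussian γβ := (hB.hasGaussianLaw β).isGaussian_map
  let L : ((ι → ℝ) × (ι → ℝ)) →L[ℝ] (ι → ℝ) :=
    √2 • (ContinuousLinearMap.fst ℝ _ _ + ContinuousLinearMap.snd ℝ _ _)
  have hprod : γα.prod γβ = (μ.prod μ).map fun z => ((fun i => B (α i) z.1), fun i => B (β i) z.2) :=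
    Measure.map_prod_map _ _ mα mβ
  obtain ⟨Y, hY⟩ : ∃ Y : Ω × Ω → ι → ℝ, Y = fun z i => √2 * (B (α i) z.1 + B (β i) z.2) := ⟨_, rfl⟩
  have mB1 : ∀ t, Measurable fun z : Ω × Ω => B t z.1 := fun t => (hB.measurable t).comp measurable_fst
  have mB2 : ∀ t, Measurable fun z : Ω × Ω => B t z.2 := fun t => (hB.measurable t).comp measurable_snd
  have mY : Measurable Y := by
    rw [hY]
    exact measurable_pi_lambda _ fun i => ((mB1 _).add (mB2 _)).const_mul _
  have hmap : (γα.prod γβ).map L = (μ.prod μ).map Y := by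
    rw [hprod, Measure.map_map L.continuous.measurable
      ((measurable_pi_lambda _ fun i => mB1 _).prodMk (measurable_pi_lambda _ fun i => mB2 _)), hY]
    rfl
  have l1 : ∀ t, MemLp (fun z : Ω × Ω => B t z.1) 2 (μ.prod μ) := fun t => (hB.memLp t).comp_fst μ
  have l2 : ∀ t, MemLp (fun z : Ω × Ω => B t z.2) 2 (μ.prod μ) := fun t => (hB.memLp t).comp_snd μ
  have z1 : ∀ f : Ω → ℝ, ∫ z : Ω × Ω, f z.1 ∂(μ.prod μ) = ∫ ω, f ω ∂μ := fun f => by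
    rw [integral_fun_fst, probReal_univ, one_smul]
  have z2 : ∀ f : Ω → ℝ, ∫ z : Ω × Ω, f z.2 ∂(μ.prod μ) = ∫ ω, f ω ∂μ := fun f => by
    rw [integral_fun_snd, probReal_univ, one_smul]
  have hsq : ∀ U V : Ω → ℝ, MemLp U 2 μ → MemLp V 2 μ → ∫ ω, U ω ∂μ = 0 →
      ∫ z : Ω × Ω, (√2 * (U z.1 + V z.2)) ^ 2 ∂(μ.prod μ) =
        2 * (∫ ω, U ω ^ 2 ∂μ + ∫ ω, V ω ^ 2 ∂μ) := by
    intro U V hU hV hU0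
    have e : ∀ z : Ω × Ω, (√2 * (U z.1 + V z.2)) ^ 2 =
        2 * (U z.1 ^ 2 + (V z.2 ^ 2 + 2 * (U z.1 * V z.2))) := fun z => by
      rw [mul_pow, Real.sq_sqrt (by norm_num)]; ring
    have k1 : Integrable (fun z : Ω × Ω => U z.1 ^ 2) (μ.prod μ) := (hU.comp_fst μ).integrable_sq
    have k2 : Integrable (fun z : Ω × Ω => V z.2 ^ 2) (μ.prod μ) := (hV.comp_snd μ).integrable_sq
    have k3 : Integrable (fun z : Ω × Ω => 2 * (U z.1 * V z.2)) (μ.prod μ) :=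
      ((hU.comp_fst μ).integrable_mul (hV.comp_snd μ)).const_mul 2
    have k4 := integral_add k1 (k2.add k3)
    simp only [Pi.add_apply] at k4
    simp only [e]
    rw [integral_const_mul, k4, integral_add k2 k3, integral_const_mul, integral_prod_mul, hU0,
      z1 fun ω => U ω ^ 2, z2 fun ω => V ω ^ 2]
    ring
  have hvar : ∀ i, ∫ y, y i ^ 2 ∂((γα.prod γβ).map L) =
      2 * (α i ^ (2 * H) + β i ^ (2 * H)) := fun i => by
    rw [hmap, integral_map mY.aemeasurable (Continuous.aestronglyMeasurable (by fun_prop)), hY]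
    rw [hsq _ _ (hB.memLp _) (hB.memLp _) (hB.integral_eq_zero _), hB.integral_sq hH (hα i).1,
      hB.integral_sq hH (hβ i).1]
  refine ⟨(γα.prod γβ).map L, inferInstance, ?_, fun i j => ?_, ?_⟩
  · rw [hmap, integral_map mY.aemeasurable (by fun_prop)]
    ext i
    have hint : Integrable Y (μ.prod μ) := by
      refine Integrable.of_eval fun i => ?_
      rw [hY]
      exact (((l1 _).add (l2 _)).const_mul _).integrable (by norm_num)
    simp only [id]
    rw [eval_integral fun i => hint.eval i, hY]
    have := integral_add ((l1 (α i)).integrable (by norm_num)) ((l2 (β i)).integrable (by norm_num))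
    rw [integral_const_mul, this, z1, z2, hB.integral_eq_zero, hB.integral_eq_zero]
    simp
  · rw [hmap, integral_map mY.aemeasurable (Continuous.aestronglyMeasurable (by fun_prop)), hY]
    have hm1 : MemLp (fun ω => B (α i) ω - B (α j) ω) 2 μ := (hB.memLp _).sub (hB.memLp _)
    have hm2 : MemLp (fun ω => B (β i) ω - B (β j) ω) 2 μ := (hB.memLp _).sub (hB.memLp _)
    have h0 : ∫ ω, (B (α i) ω - B (α j) ω) ∂μ = 0 := by
      rw [integral_sub ((hB.memLp _).integrable (by norm_num))
        ((hB.memLp _).integrable (by norm_num)), hB.integral_eq_zero, hB.integral_eq_zero, sub_zero]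
    rw [← hB.integral_increment_sq hH (hα j).1 (hα i).1,
      ← hB.integral_increment_sq hH (hβ j).1 (hβ i).1, ← hsq _ _ hm1 hm2 h0]
    congr 1
    ext z
    ring
  · have hI := integrable_iSup_exp ((γα.prod γβ).map L)
      (c := fun i => 2 * (α i ^ (2 * H) + β i ^ (2 * H))) fun i => by
        have := Real.rpow_nonneg (hα i).1 (2 * H)
        have := Real.rpow_nonneg (hβ i).1 (2 * H)
        positivity
    simp only [hvar]
    rw [hmap] at hI ⊢
    rw [integrable_map_measure (Measurable.iSup fun i => by fun_prop).aestronglyMeasurable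
      mY.aemeasurable] at hI
    rw [integral_map mY.aemeasurable (Measurable.iSup fun i => by fun_prop).aestronglyMeasurable,
      pickandsMean, sq, ← integral_prod_mul]
    have ha := hB.ae_le_iSup hH l
    have ha1 := Measure.quasiMeasurePreserving_fst (μ := μ) (ν := μ) |>.ae ha
    have ha2 := Measure.quasiMeasurePreserving_snd (μ := μ) (ν := μ) |>.ae ha
    refine integral_mono_ae hI (hl.mul_prod hl) ?_
    filter_upwards [ha1, ha2] with z hz1 hz2
    refine ciSup_le fun i => ?_
    rw [← Real.exp_add, Real.exp_le_exp, hY]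
    have h1 := hz1 _ (hα i)
    have h2 := hz2 _ (hβ i)
    linarith

end IsFBM
end FBM

section BoxEstimate

lemma rpow_sub_rpow_le_four_mul {x y p : ℝ} (hx : 1 / 4 ≤ x) (hy : 1 / 4 ≤ y) (hp : 0 ≤ p)
    (hp1 : p ≤ 1) : y ^ p - x ^ p ≤ 4 * |y - x| := by
  rcases le_total y x with hxy | hxy
  · have := Real.rpow_le_rpow (by linarith) hxy hp
    have := abs_nonneg (y - x)
    linarith
  have hx0 : 0 < x := by linarith
  have h1 : (y / x) ^ p ≤ y / x := by
    conv_rhs => rw [← Real.rpow_one (y / x)]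
    exact Real.rpow_le_rpow_of_exponent_le ((one_le_div hx0).2 hxy) hp1
  have h2 : y ^ p = x ^ p * (y / x) ^ p := by
    rw [← Real.mul_rpow hx0.le (by positivity), mul_div_cancel₀ _ hx0.ne']
  have h3 : x ^ p ≤ 4 * x := by
    have : x ^ p = x ^ (p - 1) * x := by
      rw [Real.rpow_sub_one hx0.ne']; field_simp
    rw [this]
    refine mul_le_mul_of_nonneg_right ?_ hx0.le
    calc x ^ (p - 1) ≤ (1 / 4) ^ (p - 1) :=
          Real.rpow_le_rpow_of_nonpos (by norm_num) hx (by linarith)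
      _ = 4 ^ (1 - p) := by
          rw [one_div, Real.inv_rpow (by norm_num), ← Real.rpow_neg (by norm_num), neg_sub]
      _ ≤ 4 ^ (1:ℝ) := Real.rpow_le_rpow_of_exponent_le (by norm_num) (by linarith)
      _ = 4 := Real.rpow_one _
  rw [abs_of_nonneg (by linarith)]
  have h4 : y ^ p - x ^ p ≤ x ^ p * (y / x - 1) := by
    rw [h2, mul_sub, mul_one]
    have := mul_le_mul_of_nonneg_left h1 (Real.rpow_nonneg hx0.le p)
    linarith
  have h5 : 0 ≤ y / x - 1 := by
    rw [sub_nonneg]; exact (one_le_div hx0).2 hxy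
  calc y ^ p - x ^ p ≤ x ^ p * (y / x - 1) := h4
    _ ≤ 4 * x * (y / x - 1) := mul_le_mul_of_nonneg_right h3 h5
    _ = 4 * (y - x) := by field_simp

/-- The variance of a difference of two increments is, up to the factor `1 + 8 h ^ (1 - p)`,
at most the additive one, for increments over nearby intervals of length at least `1 / 2`. -/
lemma increment_variance_le {a b a' b' h p : ℝ} (hp : 0 < p) (hp1 : p ≤ 1) (h4 : h ≤ 1 / 4)
    (ha : |a - a'| ≤ h) (hτ : 1 / 2 ≤ b - a) (hτ' : 1 / 2 ≤ b' - a') :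
    (b - a) ^ p + (b' - a') ^ p -
        (|b - a'| ^ p + |b' - a| ^ p - |b - b'| ^ p - |a - a'| ^ p) ≤
      (1 + 8 * h ^ (1 - p)) * (|a - a'| ^ p + |b - b'| ^ p) := by
  obtain ⟨g1, g2⟩ := abs_le.1 ha
  have k1 := rpow_sub_rpow_le_four_mul (x := b - a') (y := b - a) (by linarith) (by linarith)
    hp.le hp1
  have k2 := rpow_sub_rpow_le_four_mul (x := b' - a) (y := b' - a') (by linarith) (by linarith)
    hp.le hp1
  rw [abs_of_nonneg (show 0 ≤ b - a' by linarith), abs_of_nonneg (show 0 ≤ b' - a by linarith)]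
  rw [show b - a - (b - a') = -(a - a') by ring, abs_neg] at k1
  rw [show b' - a' - (b' - a) = a - a' by ring] at k2
  have k3 : |a - a'| ≤ h ^ (1 - p) * |a - a'| ^ p := by
    rcases (abs_nonneg (a - a')).eq_or_lt with h0 | h0
    · rw [← h0, Real.zero_rpow hp.ne', mul_zero]
    · calc |a - a'| = |a - a'| ^ (1 - p) * |a - a'| ^ p := by
            rw [← Real.rpow_add h0, sub_add_cancel, Real.rpow_one]
        _ ≤ h ^ (1 - p) * |a - a'| ^ p := by
            gcongr
  have k4 : 0 ≤ h ^ (1 - p) * |b - b'| ^ p :=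
    mul_nonneg (Real.rpow_nonneg ((abs_nonneg _).trans ha) _) (Real.rpow_nonneg (abs_nonneg _) _)
  nlinarith

end BoxEstimate

namespace IsFBM
variable {Ω : Type*} [MeasurableSpace Ω]
variable {μ : Measure Ω} {B : ℝ → Ω → ℝ} {H : ℝ}

/-- Weighted increments form a centered Gaussian vector. -/
lemma exists_increment_gaussian [IsProbabilityMeasure μ] (hB : IsFBM B H μ) {ι : Type*} [Fintype ι] (w : ι → ℝ)
    {a b : ι → ℝ} (ha : ∀ i, 0 ≤ a i) (hb : ∀ i, 0 ≤ b i) :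
    ∃ γ : Measure (ι → ℝ), IsGaussian γ ∧ γ[id] = 0 ∧
      (∀ i j, ∫ x, x i * x j ∂γ = w i * w j *
        ((|b i - a j| ^ (2 * H) + |b j - a i| ^ (2 * H) - |b i - b j| ^ (2 * H)
          - |a i - a j| ^ (2 * H)) / 2)) ∧
      ∀ u, μ.real {ω | ∃ i, u < w i * (B (b i) ω - B (a i) ω)} = γ.real {x | ∃ i, u < x i} := by
  obtain ⟨X, hX⟩ : ∃ X : Ω → ι → ℝ, X = fun ω i => w i * (B (b i) ω - B (a i) ω) := ⟨_, rfl⟩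
  have mX : Measurable X := by
    rw [hX]
    exact measurable_pi_lambda _ fun i => ((hB.measurable _).sub (hB.measurable _)).const_mul _
  let L : ((ι ⊕ ι) → ℝ) →L[ℝ] (ι → ℝ) := ContinuousLinearMap.pi fun i =>
    w i • (ContinuousLinearMap.proj (R := ℝ) (φ := fun _ : ι ⊕ ι => ℝ) (Sum.inr i) -
      ContinuousLinearMap.proj (R := ℝ) (φ := fun _ : ι ⊕ ι => ℝ) (Sum.inl i))
  have hg : HasGaussianLaw X μ := by
    have := (hB.hasGaussianLaw (Sum.elim a b)).map L
    rw [hX]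
    exact this
  have hI : ∀ i, Integrable (fun ω => X ω i) μ := fun i => by
    rw [hX]
    exact (((hB.memLp _).sub (hB.memLp _)).const_mul _).integrable (by norm_num)
  refine ⟨μ.map X, hg.isGaussian_map, ?_, fun i j => ?_, fun u => ?_⟩
  · rw [integral_map mX.aemeasurable (by fun_prop)]
    ext i
    simp only [id]
    rw [eval_integral hI, hX]
    simp only
    rw [integral_const_mul, integral_sub ((hB.memLp _).integrable (by norm_num))
      ((hB.memLp _).integrable (by norm_num)), hB.integral_eq_zero, hB.integral_eq_zero]
    simp
  · rw [integral_map mX.aemeasurable (Continuous.aestronglyMeasurable (by fun_prop)), hX,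
      ← hB.integral_increment_mul (ha i) (hb i) (ha j) (hb j), ← integral_const_mul]
    congr 1
    ext ω
    ring
  · have : MeasurableSet {x : ι → ℝ | ∃ i, u < x i} := by
      rw [ofPred_exists]
      exact MeasurableSet.iUnion fun i => measurableSet_lt measurable_const (measurable_pi_apply i)
    rw [map_measureReal_apply mX this, hX]
    rfl

lemma increment_variance_le_two_mul (hB : IsFBM B H μ) (hH : 0 < H) {a b a' b' : ℝ} (ha : 0 ≤ a)
    (hb : 0 ≤ b) (ha' : 0 ≤ a') (hb' : 0 ≤ b') :
    |b - a| ^ (2 * H) + |b' - a'| ^ (2 * H) -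
        (|b - a'| ^ (2 * H) + |b' - a| ^ (2 * H) - |b - b'| ^ (2 * H) - |a - a'| ^ (2 * H)) ≤
      2 * (|a - a'| ^ (2 * H) + |b - b'| ^ (2 * H)) := by
  have i1 := ((hB.memLp b).sub (hB.memLp a)).integrable_sq
  have i2 := ((hB.memLp b').sub (hB.memLp a')).integrable_sq
  have i3 := (((hB.memLp b).sub (hB.memLp a)).integrable_mul
    ((hB.memLp b').sub (hB.memLp a'))).const_mul 2
  have i4 := ((hB.memLp b).sub (hB.memLp b')).integrable_sq
  have i5 := ((hB.memLp a).sub (hB.memLp a')).integrable_sq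
  have h := integral_mono ((i1.add i2).sub i3) ((i4.add i5).const_mul 2) fun ω => by
    simp only [Pi.add_apply, Pi.sub_apply, Pi.mul_apply]
    nlinarith [sq_nonneg (B b ω - B b' ω + (B a ω - B a' ω))]
  have e1 := integral_sub (i1.add i2) i3
  have e2 := integral_add i4 i5
  have e3 := integral_add i1 i2
  simp only [Pi.add_apply, Pi.sub_apply, Pi.mul_apply] at h e1 e2 e3
  rw [e1, e3, integral_const_mul, integral_const_mul, e2, hB.integral_increment_sq hH ha hb,
    hB.integral_increment_sq hH ha' hb', hB.integral_increment_sq hH hb' hb,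
    hB.integral_increment_sq hH ha' ha, hB.integral_increment_mul ha hb ha' hb'] at h
  linarith

/-- Tail bound for increments whose end points range over two short intervals. -/
lemma measureReal_box_le [IsProbabilityMeasure μ] (hB : IsFBM B H μ) (hH : 0 < H) (hH2 : H < 1 / 2) {l : ℝ}
    (hl : Integrable (fun ω => exp (⨆ t : Icc (0:ℝ) l, (√2 * B (t:ℝ) ω - (t:ℝ) ^ (2 * H)))) μ)
    {ι : Type*} [Fintype ι] {a b : ι → ℝ} {a0 b0 h : ℝ} (ha0 : 0 ≤ a0)
    (hh : 0 < h) (h4 : h ≤ 1 / 4) (ha : ∀ i, a i ∈ Icc a0 (a0 + h))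
    (hb : ∀ i, b i ∈ Icc b0 (b0 + h)) (hτ : ∀ i, 1 / 2 ≤ b i - a i) {c : ℝ} (hc1 : 1 ≤ c)
    (hc : ∀ i, 1 ≤ c * (b i - a i) ^ (2 * H)) {u v : ℝ} (hv0 : 0 < v)
    (hv : ∀ i, v * (b i - a i) ^ H ≤ u) (hvc : v ^ 2 ≤ u ^ 2 * c) {k : ℝ} (hk : 0 ≤ k)
    (hkl : k * h ≤ l) {η : ℝ} (hη : η = c * (1 + 8 * h ^ (1 - 2 * H)) * h ^ (2 * H)) (hη1 : η < 1)
    (hcond : u ^ 2 * c ^ 2 * (1 + 8 * h ^ (1 - 2 * H)) * ((1 + 2 * η) / (1 - η) ^ 4) ≤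
      2 * k ^ (2 * H)) :
    μ.real {ω | ∃ i, u < B (b i) ω - B (a i) ω} ≤
      gaussianPDFReal 0 1 v / v *
        (exp (v ^ 2 * η ^ 2 / (2 * (1 - η) ^ 2)) * pickandsMean B H μ l ^ 2) := by
  rcases isEmpty_or_nonempty ι with hι | hι
  · simp only [IsEmpty.exists_iff, ofPred_false, measureReal_empty]
    have := gaussianPDFReal_nonneg 0 1 v
    positivity
  have ha' : ∀ i, 0 ≤ a i := fun i => ha0.trans (ha i).1
  have hb' : ∀ i, 0 ≤ b i := fun i => by linarith [ha' i, hτ i]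
  have hτ0 : ∀ i, 0 < b i - a i := fun i => by linarith [hτ i]
  have hσ : ∀ i, 0 < (b i - a i) ^ H := fun i => Real.rpow_pos_of_pos (hτ0 i) _
  have hσ2 : ∀ i, (b i - a i) ^ (2 * H) = ((b i - a i) ^ H) ^ 2 := fun i => by
    rw [← Real.rpow_natCast, ← Real.rpow_mul (hτ0 i).le, mul_comm]; norm_num
  have hε : 0 ≤ h ^ (1 - 2 * H) := by positivity
  have hh2 : 0 ≤ h ^ (2 * H) := by positivity
  have hη0 : 0 ≤ η := by rw [hη]; positivity
  have hda : ∀ i j, |a i - a j| ≤ h := fun i j => by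
    rw [abs_le]; constructor <;> linarith [(ha i).1, (ha i).2, (ha j).1, (ha j).2]
  have hdb : ∀ i j, |b i - b j| ≤ h := fun i j => by
    rw [abs_le]; constructor <;> linarith [(hb i).1, (hb i).2, (hb j).1, (hb j).2]
  obtain ⟨γ, hγ, hγ0, hγc, hγm⟩ := hB.exists_increment_gaussian
    (fun i => ((b i - a i) ^ H)⁻¹) ha' hb'
  have hself : ∀ i, ∫ x, x i ^ 2 ∂γ = 1 := fun i => by
    simp only [sq]
    rw [hγc]
    simp only [sub_self, abs_zero, Real.zero_rpow (by positivity : 2 * H ≠ 0), sub_zero]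
    rw [abs_of_pos (hτ0 i), hσ2]
    field_simp [(hσ i).ne']
    norm_num
  have hcov : ∀ i j, 2 - 2 * ∫ x, x i * x j ∂γ ≤
      c * ((1 + 8 * h ^ (1 - 2 * H)) * (|a i - a j| ^ (2 * H) + |b i - b j| ^ (2 * H))) := by
    intro i j
    have hD := increment_variance_le (p := 2 * H) (by positivity) (by linarith) h4 (hda i j) (hτ i)
      (hτ j)
    rw [hγc]
    set s := (b i - a i) ^ H with hs
    set s' := (b j - a j) ^ H with hs'
    set C := |b i - a j| ^ (2 * H) + |b j - a i| ^ (2 * H) - |b i - b j| ^ (2 * H) -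
      |a i - a j| ^ (2 * H) with hC
    set R := (1 + 8 * h ^ (1 - 2 * H)) * (|a i - a j| ^ (2 * H) + |b i - b j| ^ (2 * H)) with hR
    have hR0 : 0 ≤ R := by positivity
    rw [hσ2, hσ2] at hD
    have p1 : 0 < s := hσ i
    have p2 : 0 < s' := hσ j
    have e : 2 - 2 * (s⁻¹ * s'⁻¹ * (C / 2)) = (2 * (s * s') - C) * (s * s')⁻¹ := by
      field_simp
    have hcs : (s * s')⁻¹ ≤ c := by
      rw [inv_le_comm₀ (by positivity) (by positivity)]
      have q1 := hc i
      have q2 := hc j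
      rw [hσ2] at q1 q2
      refine abs_le_of_sq_le_sq' ?_ (by positivity) |>.2
      calc c⁻¹ ^ 2 = c⁻¹ * c⁻¹ := sq _
        _ ≤ s ^ 2 * s' ^ 2 := by
          gcongr
          · rw [inv_le_iff_one_le_mul₀ (by positivity), mul_comm]; exact q1
          · rw [inv_le_iff_one_le_mul₀ (by positivity), mul_comm]; exact q2
        _ = (s * s') ^ 2 := by ring
    rw [e]
    calc (2 * (s * s') - C) * (s * s')⁻¹ ≤ R * (s * s')⁻¹ := by
          gcongr
          nlinarith [sq_nonneg (s - s')]
      _ ≤ R * c := by gcongr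
      _ = c * R := mul_comm _ _
  have hrp : ∀ x, 0 ≤ x → x ≤ h → x ^ (2 * H) ≤ h ^ (2 * H) := fun x h0 h1 =>
    Real.rpow_le_rpow h0 h1 (by positivity)
  have hr : ∀ i j, 1 - η ≤ ∫ x, x i * x j ∂γ := fun i j => by
    have q1 := hcov i j
    have q2 := hrp _ (abs_nonneg _) (hda i j)
    have q3 := hrp _ (abs_nonneg _) (hdb i j)
    have : c * ((1 + 8 * h ^ (1 - 2 * H)) * (|a i - a j| ^ (2 * H) + |b i - b j| ^ (2 * H))) ≤
        c * ((1 + 8 * h ^ (1 - 2 * H)) * (h ^ (2 * H) + h ^ (2 * H))) := by gcongr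
    rw [hη]
    linarith
  obtain ⟨ν, hν, hν0, hνd, hνm⟩ := hB.exists_additive_gaussian hH hl
    (α := fun i => k * (a i - a0)) (β := fun i => k * (b i - b0))
    (fun i => ⟨mul_nonneg hk (by linarith [(ha i).1]),
      (mul_le_mul_of_nonneg_left (by linarith [(ha i).2]) hk).trans hkl⟩)
    (fun i => ⟨mul_nonneg hk (by linarith [(hb i).1]),
      (mul_le_mul_of_nonneg_left (by linarith [(hb i).2]) hk).trans hkl⟩)
  obtain ⟨i₀⟩ := hι
  have : Nonempty ι := ⟨i₀⟩
  have main := measureReal_exists_lt_le hγ0 hself i₀ hη0 hη1 (fun i => hr i i₀) hv0 ν hν0 ?_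
  · refine le_trans ?_ (main.trans ?_)
    · rw [← hγm]
      refine measureReal_mono ?_
      rintro ω ⟨i, hi⟩
      refine ⟨i, ?_⟩
      rw [lt_inv_mul_iff₀ (hσ i), mul_comm]
      exact (hv i).trans_lt hi
    · have := gaussianPDFReal_nonneg 0 1 v
      gcongr
  · intro i j
    have hsc : ∀ x y z : ℝ, |k * (x - z) - k * (y - z)| ^ (2 * H) =
        k ^ (2 * H) * |x - y| ^ (2 * H) := fun x y z => by
      rw [← mul_sub, sub_sub_sub_cancel_right, abs_mul, abs_of_nonneg hk,
        Real.mul_rpow hk (abs_nonneg _)]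
    have hX : 0 ≤ ∫ x, (x i - x j) ^ 2 ∂γ := integral_nonneg fun _ => sq_nonneg _
    rw [integral_sub_sq, hself, hself] at hX
    rw [hνd, hsc, hsc, ← mul_add, integral_sub_sq, hself, hself]
    set W := |a i - a j| ^ (2 * H) + |b i - b j| ^ (2 * H) with hW
    have hW0 : 0 ≤ W := by positivity
    have q := hcov i j
    have hη' : 0 < 1 - η := by linarith
    calc v ^ 2 * ((1 + 2 * η) / (1 - η) ^ 4 * (1 + 1 - 2 * ∫ x, x i * x j ∂γ))
        ≤ u ^ 2 * c * ((1 + 2 * η) / (1 - η) ^ 4 * (c * ((1 + 8 * h ^ (1 - 2 * H)) * W))) := by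
          have hK : 0 ≤ (1 + 2 * η) / (1 - η) ^ 4 := by positivity
          refine mul_le_mul hvc (mul_le_mul_of_nonneg_left (by linarith) hK) (mul_nonneg hK hX) ?_
          positivity
      _ = (u ^ 2 * c ^ 2 * (1 + 8 * h ^ (1 - 2 * H)) * ((1 + 2 * η) / (1 - η) ^ 4)) * W := by ring
      _ ≤ 2 * k ^ (2 * H) * W := by gcongr
      _ = 2 * (k ^ (2 * H) * W) := by ring

/-- Crude bound for increments over intervals of length at most `τ₀`. -/
lemma measureReal_exists_increment_le [IsProbabilityMeasure μ] (hB : IsFBM B H μ) (hH : 0 < H) {l : ℝ}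
    (hl : Integrable (fun ω => exp (⨆ t : Icc (0:ℝ) l, (√2 * B (t:ℝ) ω - (t:ℝ) ^ (2 * H)))) μ)
    {ι : Type*} [Fintype ι] {a b : ι → ℝ} {τ₀ A θ : ℝ} (u : ℝ)
    (ha : ∀ i, a i ∈ Icc 0 A) (hb : ∀ i, b i ∈ Icc 0 A) (hτ : ∀ i, |b i - a i| ≤ τ₀)
    (hθ : 0 ≤ θ) (hl' : θ ^ (1 / H) * A ≤ l) :
    μ.real {ω | ∃ i, u < B (b i) ω - B (a i) ω} ≤
      exp (-(θ * u) + θ ^ 2 * τ₀ ^ (2 * H) / 2) * pickandsMean B H μ l ^ 2 := by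
  rcases isEmpty_or_nonempty ι with hι | hι
  · simp only [IsEmpty.exists_iff, ofPred_false, measureReal_empty]
    positivity
  obtain ⟨γ, hγ, hγ0, hγc, hγm⟩ := hB.exists_increment_gaussian (fun _ => 1)
    (fun i => (ha i).1) (fun i => (hb i).1)
  set k := θ ^ (1 / H) with hk
  have hk0 : 0 ≤ k := Real.rpow_nonneg hθ _
  have hkH : k ^ (2 * H) = θ ^ 2 := by
    rw [hk, ← Real.rpow_mul hθ, ← Real.rpow_natCast]
    congr 1
    field_simp
    norm_num
  obtain ⟨ν, hν, hν0, hνd, hνm⟩ := hB.exists_additive_gaussian hH hl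
    (α := fun i => k * a i) (β := fun i => k * b i)
    (fun i => ⟨mul_nonneg hk0 (ha i).1, (mul_le_mul_of_nonneg_left (ha i).2 hk0).trans hl'⟩)
    (fun i => ⟨mul_nonneg hk0 (hb i).1, (mul_le_mul_of_nonneg_left (hb i).2 hk0).trans hl'⟩)
  have hself : ∀ i, ∫ x, x i ^ 2 ∂γ = |b i - a i| ^ (2 * H) := fun i => by
    simp only [sq]
    rw [hγc]
    simp [Real.zero_rpow (by positivity : 2 * H ≠ 0)]
  have main := measureReal_exists_lt_le_exp hγ0 (S := τ₀ ^ (2 * H)) (fun i => ?_) hθ u ν hν0 ?_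
  · refine le_trans ?_ (main.trans ?_)
    · rw [← hγm]
      simp only [one_mul, le_refl]
    · gcongr
  · rw [hself]
    exact Real.rpow_le_rpow (abs_nonneg _) (hτ i) (by positivity)
  · intro i j
    have hsc : ∀ x y : ℝ, |k * x - k * y| ^ (2 * H) = θ ^ 2 * |x - y| ^ (2 * H) := fun x y => by
      rw [← mul_sub, abs_mul, abs_of_nonneg hk0, Real.mul_rpow hk0 (abs_nonneg _), hkH]
    have hd := hB.increment_variance_le_two_mul hH (ha i).1 (hb i).1 (ha j).1 (hb j).1
    rw [hνd, hsc, hsc, integral_sub_sq, hself, hself, hγc]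
    nlinarith [sq_nonneg θ]

end IsFBM

section Sums

lemma sum_exp_neg_mul_pred_le {y : ℝ} (hy : 0 < y) (N : ℕ) :
    ∑ j ∈ Finset.range N, exp (-(y * ((j - 1 : ℕ) : ℝ))) ≤ (1 + 2 * y) / y := by
  have hr0 : 0 ≤ exp (-y) := (exp_pos _).le
  have hr1 : exp (-y) < 1 := by rw [Real.exp_lt_one_iff]; linarith
  have hgeom : ∀ n : ℕ, ∑ j ∈ Finset.range n, exp (-(y * (j : ℝ))) ≤ (1 + y) / y := fun n => by
    have e : ∀ j : ℕ, exp (-(y * (j : ℝ))) = exp (-y) ^ j := fun j => by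
      rw [← Real.exp_nat_mul]; ring_nf
    simp only [e]
    refine ((summable_geometric_of_lt_one hr0 hr1).sum_le_tsum _ fun _ _ => by positivity).trans ?_
    rw [tsum_geometric_of_lt_one hr0 hr1, inv_le_iff_one_le_mul₀ (by linarith)]
    have h1 : exp (-y) ≤ (1 + y)⁻¹ := by
      rw [Real.exp_neg]
      gcongr
      linarith [Real.add_one_le_exp y]
    calc (1:ℝ) = (1 + y) / y * (1 - (1 + y)⁻¹) := by field_simp; ring
      _ ≤ (1 + y) / y * (1 - exp (-y)) := by gcongr
  cases N with
  | zero => simp; positivity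
  | succ N =>
    rw [Finset.sum_range_succ']
    simp only [Nat.add_sub_cancel, zero_tsub, Nat.cast_zero, mul_zero, neg_zero, Real.exp_zero]
    have := hgeom N
    calc _ ≤ (1 + y) / y + 1 := by linarith
      _ = (1 + 2 * y) / y := by field_simp; ring

lemma gaussianPDFReal_std_div_le {u z : ℝ} (hu : 0 < u) (hz : 0 ≤ z) :
    gaussianPDFReal 0 1 (u + u * z) / (u + u * z) ≤
      gaussianPDFReal 0 1 u / u * exp (-(u ^ 2 * z)) := by
  rw [gaussianPDFReal_std_add, div_mul_eq_mul_div]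
  have := gaussianPDFReal_nonneg 0 1 u
  gcongr
  · nlinarith [sq_nonneg (u * z)]
  · nlinarith [mul_nonneg hu.le hz]

lemma one_add_mul_mul_rpow_le_one {x t H : ℝ} (hH : 0 ≤ H) (hH1 : H ≤ 1) (hx0 : 0 ≤ x)
    (ht : 0 ≤ t) (htx : t ≤ 1 - x) : (1 + H * x) * t ^ H ≤ 1 := by
  have h1 : t ^ H ≤ 1 - H * x := by
    calc t ^ H ≤ (1 + -x) ^ H := Real.rpow_le_rpow ht (by linarith) hH
      _ ≤ 1 + H * -x := rpow_one_add_le_one_add_mul_self (by linarith) hH hH1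
      _ = 1 - H * x := by ring
  calc (1 + H * x) * t ^ H ≤ (1 + H * x) * (1 - H * x) := by gcongr
    _ ≤ 1 := by nlinarith [sq_nonneg (H * x)]

lemma sq_le_of_mul_rpow_le_one {y t H c : ℝ} (hy : 0 ≤ y) (ht : 0 ≤ t) (h : y * t ^ H ≤ 1)
    (hc : 1 ≤ c * t ^ (2 * H)) : y ^ 2 ≤ c := by
  have h1 : t ^ (2 * H) = (t ^ H) ^ 2 := by
    rw [← Real.rpow_natCast, ← Real.rpow_mul ht, mul_comm]; norm_num
  rw [h1] at hc
  have h3 : 0 ≤ y * t ^ H := by positivity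
  have hc0 : 0 ≤ c := by
    by_contra! hneg
    nlinarith [sq_nonneg (t ^ H)]
  calc y ^ 2 = y ^ 2 * 1 := (mul_one _).symm
    _ ≤ y ^ 2 * (c * (t ^ H) ^ 2) := by gcongr
    _ = c * (y * t ^ H) ^ 2 := by ring
    _ ≤ c * 1 ^ 2 := by gcongr
    _ = c := by ring

end Sums

namespace IsFBM
variable {Ω : Type*} [MeasurableSpace Ω] {μ : Measure Ω} {B : ℝ → Ω → ℝ} {H : ℝ}

/-- Tail bound for increments over intervals whose length is close to `1`. -/
lemma measureReal_exists_near_le [IsProbabilityMeasure μ] (hB : IsFBM B H μ) (hH : 0 < H)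
    (hH2 : H < 1 / 2) {l : ℝ}
    (hl : Integrable (fun ω => exp (⨆ t : Icc (0:ℝ) l, (√2 * B (t:ℝ) ω - (t:ℝ) ^ (2 * H)))) μ)
    {ι : Type*} [Fintype ι] {s τ : ι → ℝ} {T h : ℝ} (hT : 0 < T)
    (hs : ∀ i, s i ∈ Icc 0 T) (hτ : ∀ i, τ i ∈ Icc (1 / 2) 1)
    (hh : 0 < h) (h4 : h ≤ 1 / 4) {c : ℝ} (hc1 : 1 ≤ c)
    (hc : ∀ i, 1 ≤ c * τ i ^ (2 * H)) {u : ℝ} (hu : 0 < u) {k : ℝ} (hk : 0 ≤ k)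
    (hkl : k * h ≤ l) {η : ℝ} (hη : η = c * (1 + 8 * h ^ (1 - 2 * H)) * h ^ (2 * H)) (hη1 : η < 1)
    (hcond : u ^ 2 * c ^ 2 * (1 + 8 * h ^ (1 - 2 * H)) * ((1 + 2 * η) / (1 - η) ^ 4) ≤
      2 * k ^ (2 * H)) :
    μ.real {ω | ∃ i, u < B (s i + τ i) ω - B (s i) ω} ≤
      (T / h + 1) * ((1 + 2 * (u ^ 2 * H * h)) / (u ^ 2 * H * h)) *
        (gaussianPDFReal 0 1 u / u *
        (exp (u ^ 2 * c * η ^ 2 / (2 * (1 - η) ^ 2)) * pickandsMean B H μ l ^ 2)) := by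
  set G := gaussianPDFReal 0 1 u / u *
        (exp (u ^ 2 * c * η ^ 2 / (2 * (1 - η) ^ 2)) * pickandsMean B H μ l ^ 2) with hG
  have hφ : ∀ x, 0 ≤ gaussianPDFReal 0 1 x := gaussianPDFReal_nonneg 0 1
  have hG0 : 0 ≤ G := by
    have := hφ u
    positivity
  let J (m j : ℕ) : Type _ := {i : ι // s i ∈ Icc (m * h) (m * h + h) ∧
    s i + τ i ∈ Icc (m * h + 1 - j * h) (m * h + 1 - j * h + h)}
  have hbox : ∀ m j : ℕ, μ.real {ω | ∃ i : J m j, u < B (s i.1 + τ i.1) ω - B (s i.1) ω} ≤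
      exp (-(u ^ 2 * H * h * ((j - 1 : ℕ) : ℝ))) * G := by
    classical
    intro m j
    rcases isEmpty_or_nonempty (J m j) with hJ | ⟨⟨i₀⟩⟩
    · simp only [IsEmpty.exists_iff, ofPred_false, measureReal_empty]
      positivity
    set x : ℝ := ((j - 1 : ℕ) : ℝ) * h with hx
    have hx0 : 0 ≤ x := by positivity
    have hτx : ∀ i : J m j, τ i.1 ≤ 1 - x := fun i => by
      rcases Nat.eq_zero_or_pos j with h0 | h0
      · have : x = 0 := by rw [hx, h0]; simp
        rw [this, sub_zero]
        exact (hτ i.1).2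
      · rw [hx, Nat.cast_sub h0]
        have := i.2.1.1
        have := i.2.2.2
        push_cast
        linarith
    have hone : ∀ i : J m j, (1 + H * x) * τ i.1 ^ H ≤ 1 := fun i =>
      one_add_mul_mul_rpow_le_one hH.le (by linarith) hx0 (by linarith [(hτ i.1).1]) (hτx i)
    have hvc : (u + u * (H * x)) ^ 2 ≤ u ^ 2 * c := by
      have e : (u + u * (H * x)) ^ 2 = u ^ 2 * (1 + H * x) ^ 2 := by ring
      rw [e]
      gcongr
      exact sq_le_of_mul_rpow_le_one (by positivity) (by linarith [(hτ i₀.1).1]) (hone i₀)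
        (hc i₀.1)
    have key := hB.measureReal_box_le hH hH2 hl (ι := J m j) (a := fun i => s i.1)
      (b := fun i => s i.1 + τ i.1) (a0 := m * h) (b0 := m * h + 1 - j * h) (by positivity) hh h4
      (fun i => i.2.1) (fun i => i.2.2) (fun i => by simpa using (hτ i.1).1) hc1
      (fun i => by simpa using hc i.1) (u := u) (v := u + u * (H * x)) (by positivity)
      (fun i => by
        have := mul_le_mul_of_nonneg_left (hone i) hu.le
        simp only [add_sub_cancel_left]
        linarith) hvc hk hkl hη hη1 hcond
    have hη' : 0 < 1 - η := by linarith
    refine key.trans ?_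
    calc _ ≤ gaussianPDFReal 0 1 u / u * exp (-(u ^ 2 * (H * x))) *
        (exp (u ^ 2 * c * η ^ 2 / (2 * (1 - η) ^ 2)) * pickandsMean B H μ l ^ 2) := by
          refine mul_le_mul (gaussianPDFReal_std_div_le hu (by positivity)) ?_ (by positivity) ?_
          · gcongr
          · have := hφ u
            positivity
      _ = exp (-(u ^ 2 * H * h * ((j - 1 : ℕ) : ℝ))) * G := by
        rw [hG, hx]
        ring_nf
  have hcover : {ω | ∃ i, u < B (s i + τ i) ω - B (s i) ω} ⊆
      ⋃ m ∈ Finset.range (⌊T / h⌋₊ + 1), ⋃ j ∈ Finset.range (⌊(h + 1) / h⌋₊ + 1),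
        {ω | ∃ i : J m j, u < B (s i.1 + τ i.1) ω - B (s i.1) ω} := by
    rintro ω ⟨i, hi⟩
    simp only [mem_iUnion]
    set m := ⌊s i / h⌋₊ with hm
    have hsh : 0 ≤ s i / h := div_nonneg (hs i).1 hh.le
    have m1 : m * h ≤ s i := by
      rw [← le_div_iff₀ hh]; exact Nat.floor_le hsh
    have m2 : s i ≤ m * h + h := by
      have := (Nat.lt_floor_add_one (s i / h)).le
      rw [div_le_iff₀ hh] at this
      linarith
    set w := m * h + h + 1 - (s i + τ i) with hw
    have hw0 : 0 ≤ w := by linarith [(hτ i).2]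
    set j := ⌊w / h⌋₊ with hj
    have j1 : j * h ≤ w := by
      rw [← le_div_iff₀ hh]; exact Nat.floor_le (by positivity)
    have j2 : w ≤ j * h + h := by
      have := (Nat.lt_floor_add_one (w / h)).le
      rw [div_le_iff₀ hh] at this
      linarith
    refine ⟨m, ?_, j, ?_, ⟨i, ⟨m1, m2⟩, ?_, ?_⟩, hi⟩
    · rw [Finset.mem_range, Nat.lt_add_one_iff]
      exact Nat.floor_le_floor (by have := (hs i).2; gcongr)
    · rw [Finset.mem_range, Nat.lt_add_one_iff]
      refine Nat.floor_le_floor ?_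
      have : w ≤ h + 1 := by linarith [(hτ i).1]
      gcongr
    · linarith
    · linarith
  have hy : 0 < u ^ 2 * H * h := by positivity
  calc μ.real {ω | ∃ i, u < B (s i + τ i) ω - B (s i) ω}
      ≤ ∑ m ∈ Finset.range (⌊T / h⌋₊ + 1), ∑ j ∈ Finset.range (⌊(h + 1) / h⌋₊ + 1),
          exp (-(u ^ 2 * H * h * ((j - 1 : ℕ) : ℝ))) * G := by
        refine (measureReal_mono hcover (measure_ne_top _ _)).trans ?_
        refine (measureReal_biUnion_finset_le _ _).trans (Finset.sum_le_sum fun m _ => ?_)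
        exact (measureReal_biUnion_finset_le _ _).trans (Finset.sum_le_sum fun j _ => hbox m j)
    _ ≤ ∑ m ∈ Finset.range (⌊T / h⌋₊ + 1), (1 + 2 * (u ^ 2 * H * h)) / (u ^ 2 * H * h) * G := by
        refine Finset.sum_le_sum fun m _ => ?_
        rw [← Finset.sum_mul]
        exact mul_le_mul_of_nonneg_right (sum_exp_neg_mul_pred_le hy _) hG0
    _ ≤ (T / h + 1) * ((1 + 2 * (u ^ 2 * H * h)) / (u ^ 2 * H * h)) * G := by
        rw [Finset.sum_const, Finset.card_range, nsmul_eq_mul, mul_assoc (T / h + 1)]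
        have : ((⌊T / h⌋₊ + 1 : ℕ) : ℝ) ≤ T / h + 1 := by
          push_cast
          linarith [Nat.floor_le (show 0 ≤ T / h by positivity)]
        exact mul_le_mul_of_nonneg_right this (by positivity)

/-- Tail bounds for the supremum follow from tail bounds over finite sets. -/
lemma measure_lt_iSup_le [IsProbabilityMeasure μ] (hB : IsFBM B H μ) {T u C : ℝ} (hT : 0 ≤ T)
    (h : ∀ (n : ℕ) (s τ : Fin n → ℝ), (∀ i, s i ∈ Icc 0 T) → (∀ i, τ i ∈ Icc 0 1) →
      μ.real {ω | ∃ i, u < B (s i + τ i) ω - B (s i) ω} ≤ C) :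
    (μ {ω | u < ⨆ (τ : Icc (0:ℝ) 1) (s : Icc (0:ℝ) T),
      (B ((s:ℝ) + (τ:ℝ)) ω - B (s:ℝ) ω)}).toReal ≤ C := by
  have hC : 0 ≤ C := measureReal_nonneg.trans (h 0 Fin.elim0 Fin.elim0 (fun i => i.elim0)
    fun i => i.elim0)
  have : Nonempty (Icc (0:ℝ) T) := ⟨⟨0, le_rfl, hT⟩⟩
  obtain ⟨p, hp⟩ := TopologicalSpace.exists_dense_seq (Icc (0:ℝ) 1 × Icc (0:ℝ) T)
  let E (n : ℕ) : Set Ω := {ω | ∃ i : Fin n, u < B ((p i).2 + (p i).1) ω - B (p i).2 ω}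
  have hmono : Monotone E := by
    rintro n m hnm ω ⟨i, hi⟩
    exact ⟨Fin.castLE hnm i, hi⟩
  refine ENNReal.toReal_le_of_le_ofReal hC ?_
  calc _ ≤ μ (⋃ n, E n) := by
        refine measure_mono_ae ?_
        filter_upwards [hB.continuous] with ω hω hu
        obtain ⟨τ, s, hτs⟩ : ∃ (τ : Icc (0:ℝ) 1) (s : Icc (0:ℝ) T),
            u < B ((s:ℝ) + (τ:ℝ)) ω - B (s:ℝ) ω := by
          by_contra! hcon
          exact (not_le.2 hu) (ciSup_le fun τ => ciSup_le fun s => hcon τ s)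
        have ho : IsOpen {q : Icc (0:ℝ) 1 × Icc (0:ℝ) T |
            u < B ((q.2:ℝ) + (q.1:ℝ)) ω - B (q.2:ℝ) ω} := by
          refine isOpen_lt continuous_const ?_
          exact (hω.comp (by fun_prop : Continuous fun q : Icc (0:ℝ) 1 × Icc (0:ℝ) T =>
            (q.2:ℝ) + (q.1:ℝ))).sub (hω.comp (by fun_prop))
        obtain ⟨n, hq⟩ := hp.exists_mem_open ho ⟨(τ, s), hτs⟩
        exact mem_iUnion.2 ⟨n + 1, Fin.last n, hq⟩
    _ = ⨆ n, μ (E n) := hmono.measure_iUnion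
    _ ≤ ENNReal.ofReal C := iSup_le fun n => by
        rw [← ofReal_measureReal]
        exact ENNReal.ofReal_le_ofReal (h n (fun i => (p i).2) (fun i => (p i).1)
          (fun i => (p i).2.2) fun i => (p i).1.2)

end IsFBM

section Asymptotics

lemma div_rpow_mul_stdNormalTail_le {u X s : ℝ} (hu : 0 < u) (hX : 0 ≤ X) :
    X / (u ^ s * stdNormalTail u) ≤ X * (1 + u ^ 2) / (u ^ s * (u * gaussianPDFReal 0 1 u)) := by
  have hφ : 0 < gaussianPDFReal 0 1 u := gaussianPDFReal_pos 0 1 u (by norm_num)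
  have hs : 0 < u ^ s := Real.rpow_pos_of_pos hu s
  have e : X * (1 + u ^ 2) / (u ^ s * (u * gaussianPDFReal 0 1 u)) =
      X / (u ^ s * (gaussianPDFReal 0 1 u * (u / (1 + u ^ 2)))) := by
    field_simp
  rw [e]
  gcongr
  exact le_stdNormalTail u

lemma tendsto_const_mul_rpow_neg {C a : ℝ} (ha : 0 < a) :
    Tendsto (fun u : ℝ => C * u ^ (-a)) atTop (nhds 0) := by
  simpa using (tendsto_rpow_neg_atTop ha).const_mul C

lemma tendsto_rpow_zero {ι : Type*} {f : Filter ι} {g : ι → ℝ} (hg : Tendsto g f (nhds 0)) {a : ℝ}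
    (ha : 0 < a) : Tendsto (fun u => g u ^ a) f (nhds 0) := by
  simpa [Real.zero_rpow ha.ne'] using hg.rpow_const (p := a) (Or.inr ha.le)

variable {H C : ℝ} {h η : ℝ → ℝ}

/-- With mesh `h` of order `u ^ (-1 / H)`, the correlation defect `η` vanishes faster than `1 / u`. -/
lemma tendsto_mul_defect (hH : 0 < H) (hH2 : H < 1 / 2) (hC : 0 < C)
    (hh : h = fun u => C * u ^ (-(1 / H))) {c : ℝ}
    (hη : η = fun u => c * (1 + 8 * h u ^ (1 - 2 * H)) * h u ^ (2 * H)) :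
    Tendsto (fun u => u * η u) atTop (nhds 0) := by
  have h0 : Tendsto h atTop (nhds 0) := by
    rw [hh]; exact tendsto_const_mul_rpow_neg (by positivity)
  have h1 := tendsto_rpow_zero h0 (show 0 < 1 - 2 * H by linarith)
  have h2 : Tendsto (fun u : ℝ => C ^ (2 * H) * u ^ (-(1:ℝ))) atTop (nhds 0) :=
    tendsto_const_mul_rpow_neg one_pos
  have h3 := (((h1.const_mul 8).const_add 1).const_mul c).mul h2
  rw [mul_zero] at h3
  refine h3.congr' ?_
  filter_upwards [eventually_gt_atTop 0] with u hu
  have e : h u ^ (2 * H) = C ^ (2 * H) * u ^ (-(2:ℝ)) := by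
    rw [hh, Real.mul_rpow hC.le (by positivity), ← Real.rpow_mul hu.le]
    congr 2
    field_simp
  have e2 : u ^ (-(1:ℝ)) = u * u ^ (-(2:ℝ)) := by
    rw [show (-(1:ℝ)) = 1 + -(2:ℝ) by norm_num, Real.rpow_add hu, Real.rpow_one]
  rw [hη, e2]
  simp only [e]
  ring

lemma tendsto_sq_mul_mesh (hH : 0 < H) (hH2 : H < 1 / 2)
    (hh : h = fun u => C * u ^ (-(1 / H))) :
    Tendsto (fun u => u ^ 2 * H * h u) atTop (nhds 0) := by
  have ha : 0 < 1 / H - 2 := by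
    rw [sub_pos, lt_div_iff₀ hH]; linarith
  refine (tendsto_const_mul_rpow_neg (C := H * C) ha).congr' ?_
  filter_upwards [eventually_gt_atTop 0] with u hu
  rw [show -(1 / H - 2) = (2:ℝ) + -(1 / H) by ring, Real.rpow_add hu, hh, Real.rpow_two]
  ring

/-- The conditions of the box estimate hold for large levels. -/
lemma eventually_box_conditions (hH : 0 < H) (hH2 : H < 1 / 2)
    (hh : h = fun u => C * u ^ (-(1 / H))) {c q : ℝ} (hcq : c ^ 2 < q)
    (hη : η = fun u => c * (1 + 8 * h u ^ (1 - 2 * H)) * h u ^ (2 * H)) :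
    ∀ᶠ u in atTop, h u ≤ 1 / 4 ∧ η u < 1 ∧
      u ^ 2 * c ^ 2 * (1 + 8 * h u ^ (1 - 2 * H)) * ((1 + 2 * η u) / (1 - η u) ^ 4) ≤
        q * u ^ 2 := by
  have h0 : Tendsto h atTop (nhds 0) := by
    rw [hh]; exact tendsto_const_mul_rpow_neg (by positivity)
  have h1 := tendsto_rpow_zero h0 (show 0 < 1 - 2 * H by linarith)
  have h2 := tendsto_rpow_zero h0 (show 0 < 2 * H by positivity)
  have hη0 : Tendsto η atTop (nhds 0) := by
    have := (((h1.const_mul 8).const_add 1).const_mul c).mul h2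
    rw [mul_zero] at this
    rw [hη]; exact this
  have h3 : Tendsto (fun u => c ^ 2 * (1 + 8 * h u ^ (1 - 2 * H)) *
      ((1 + 2 * η u) / (1 - η u) ^ 4)) atTop (nhds (c ^ 2)) := by
    have := ((((h1.const_mul 8).const_add 1).const_mul (c ^ 2)).mul
      (((hη0.const_mul 2).const_add 1).div ((hη0.const_sub 1).pow 4) (by norm_num)))
    norm_num at this
    exact this
  filter_upwards [h0.eventually_lt_const (show (0:ℝ) < 1 / 4 by norm_num),
    hη0.eventually_lt_const one_pos, h3.eventually_lt_const hcq] with u k1 k2 k3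
  refine ⟨k1.le, k2, ?_⟩
  calc _ = u ^ 2 * (c ^ 2 * (1 + 8 * h u ^ (1 - 2 * H)) * ((1 + 2 * η u) / (1 - η u) ^ 4)) := by
        ring
    _ ≤ u ^ 2 * q := by gcongr
    _ = q * u ^ 2 := mul_comm _ _

lemma tendsto_main_term (hH : 0 < H) (hH2 : H < 1 / 2) (hC : 0 < C) {c : ℝ}
    (hh : h = fun u => C * u ^ (-(1 / H)))
    (hη : η = fun u => c * (1 + 8 * h u ^ (1 - 2 * H)) * h u ^ (2 * H)) (T Q : ℝ) :
    Tendsto (fun u => (T / h u + 1) * ((1 + 2 * (u ^ 2 * H * h u)) / (u ^ 2 * H * h u)) *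
        (gaussianPDFReal 0 1 u / u * (exp (u ^ 2 * c * η u ^ 2 / (2 * (1 - η u) ^ 2)) * Q)) *
        (1 + u ^ 2) / (u ^ (2 / H - 2) * (u * gaussianPDFReal 0 1 u)))
      atTop (nhds (T / (C ^ 2 * H) * Q)) := by
  have h0 : Tendsto h atTop (nhds 0) := by
    rw [hh]; exact tendsto_const_mul_rpow_neg (by positivity)
  have huη := tendsto_mul_defect hH hH2 hC hh hη
  have hη0 : Tendsto η atTop (nhds 0) := by
    have := huη.mul tendsto_inv_atTop_zero
    rw [mul_zero] at this
    refine this.congr' ?_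
    filter_upwards [eventually_gt_atTop 0] with u hu
    field_simp
  have hκ : Tendsto (fun u => exp (u ^ 2 * c * η u ^ 2 / (2 * (1 - η u) ^ 2))) atTop (nhds 1) := by
    have := (((huη.pow 2).const_mul c).div (((hη0.const_sub 1).pow 2).const_mul 2) (by norm_num))
    norm_num at this
    have h1 := (Real.continuous_exp.tendsto 0).comp this
    rw [Real.exp_zero] at h1
    refine h1.congr fun u => ?_
    simp only [Function.comp, Pi.div_apply]
    congr 1
    ring
  have hu2 : Tendsto (fun u : ℝ => (u ^ 2)⁻¹ + 1) atTop (nhds 1) := by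
    simpa using ((tendsto_pow_atTop (α := ℝ) two_ne_zero).inv_tendsto_atTop).add_const 1
  have hy := tendsto_sq_mul_mesh hH hH2 hh
  have main := ((((h0.const_add T).div_const (C ^ 2 * H)).mul ((hy.const_mul 2).const_add 1)).mul
    (hκ.mul_const Q)).mul hu2
  norm_num at main
  refine main.congr' ?_
  filter_upwards [eventually_gt_atTop 0] with u hu
  have hφ : 0 < gaussianPDFReal 0 1 u := gaussianPDFReal_pos 0 1 u (by norm_num)
  have e1 : u ^ (2 / H - 2) = C ^ 2 / (h u ^ 2 * u ^ 2) := by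
    rw [hh, Real.rpow_sub hu, Real.rpow_two, mul_pow, ← Real.rpow_natCast (u ^ (-(1 / H))),
      ← Real.rpow_mul hu.le, show -(1 / H) * ((2 : ℕ) : ℝ) = -(2 / H) by push_cast; ring,
      Real.rpow_neg hu.le]
    have : 0 < u ^ (2 / H) := Real.rpow_pos_of_pos hu _
    field_simp
  have hhu : 0 < h u := by rw [hh]; positivity
  rw [e1]
  field_simp

lemma tendsto_far_term {S A D : ℝ} (hS : 0 < S) (hS1 : S < 1) :
    Tendsto (fun u => exp (-(u / S * u) + (u / S) ^ 2 * S / 2) *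
        (D * ((u / S) ^ (1 / H) * A)) ^ 2 * (1 + u ^ 2) /
          (u ^ (2 / H - 2) * (u * gaussianPDFReal 0 1 u))) atTop (nhds 0) := by
  have hd : -((S⁻¹ - 1) / 2) < 0 := by
    have := (one_lt_inv₀ hS).2 hS1
    linarith
  have g := fun s : ℝ => (rexp_neg_quadratic_isLittleO_rpow_atTop hd 0 s).tendsto_div_nhds_zero
  have main := (((g (-1)).add (g (-3))).const_mul (√(2 * π) * (D * S⁻¹ ^ (1 / H) * A) ^ 2))
  norm_num only [add_zero, mul_zero] at main
  refine main.congr' ?_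
  filter_upwards [eventually_gt_atTop 0] with u hu
  rw [gaussianPDFReal_std]
  have e1 : -(u / S * u) + (u / S) ^ 2 * S / 2 = -((S⁻¹ - 1) / 2) * u ^ 2 + 0 * u + -(u ^ 2 / 2) := by
    field_simp
    ring
  have e2 : u ^ (2 / H - 2) = (u ^ (1 / H)) ^ 2 / u ^ 2 := by
    rw [Real.rpow_sub hu, Real.rpow_two, ← Real.rpow_natCast (u ^ (1 / H)), ← Real.rpow_mul hu.le]
    congr 2
    push_cast
    ring
  have e3 : (u / S) ^ (1 / H) = S⁻¹ ^ (1 / H) * u ^ (1 / H) := by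
    rw [div_eq_inv_mul, Real.mul_rpow (by positivity) hu.le]
  have e4 : u ^ (-1 : ℝ) = u⁻¹ := Real.rpow_neg_one u
  have e5 : u ^ (-3 : ℝ) = (u ^ 3)⁻¹ := by
    rw [Real.rpow_neg hu.le]; norm_num
  rw [e1, Real.exp_add (-((S⁻¹ - 1) / 2) * u ^ 2 + 0 * u), e2, e3, e4, e5]
  have : 0 < u ^ (1 / H) := by positivity
  have : 0 < √(2 * π) := by positivity
  have hY := Real.exp_pos (-(u ^ 2 / 2))
  generalize exp (-(u ^ 2 / 2)) = Y at hY ⊢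
  generalize exp (-((S⁻¹ - 1) / 2) * u ^ 2 + 0 * u) = X
  field_simp

end Asymptotics

namespace IsFBM
variable {Ω : Type*} [MeasurableSpace Ω] {μ : Measure Ω} [IsProbabilityMeasure μ]
  {B : ℝ → Ω → ℝ} {H : ℝ}

/-- Non-asymptotic tail bound: a main term from interval lengths in `[τ₀, 1]` and a remainder from
shorter intervals. -/
lemma measure_lt_iSup_le_add (hB : IsFBM B H μ) (hH : 0 < H) (hH2 : H < 1 / 2) {l L : ℝ}
    (hl : Integrable (fun ω => exp (⨆ t : Icc (0:ℝ) l, (√2 * B (t:ℝ) ω - (t:ℝ) ^ (2 * H)))) μ)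
    (hL : Integrable (fun ω => exp (⨆ t : Icc (0:ℝ) L, (√2 * B (t:ℝ) ω - (t:ℝ) ^ (2 * H)))) μ)
    {T h : ℝ} (hT : 0 < T) (hh : 0 < h) (h4 : h ≤ 1 / 4) {τ₀ : ℝ} (hτ₀ : 1 / 2 ≤ τ₀) {c : ℝ}
    (hc1 : 1 ≤ c) (hc : 1 ≤ c * τ₀ ^ (2 * H)) {u : ℝ} (hu : 0 < u) {k : ℝ}
    (hk : 0 ≤ k) (hkl : k * h ≤ l) {η : ℝ}
    (hη : η = c * (1 + 8 * h ^ (1 - 2 * H)) * h ^ (2 * H)) (hη1 : η < 1)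
    (hcond : u ^ 2 * c ^ 2 * (1 + 8 * h ^ (1 - 2 * H)) * ((1 + 2 * η) / (1 - η) ^ 4) ≤
      2 * k ^ (2 * H)) {θ : ℝ} (hθ : 0 ≤ θ) (hL' : θ ^ (1 / H) * (T + 1) ≤ L) :
    (μ {ω | u < ⨆ (τ : Icc (0:ℝ) 1) (s : Icc (0:ℝ) T),
      (B ((s:ℝ) + (τ:ℝ)) ω - B (s:ℝ) ω)}).toReal ≤
      (T / h + 1) * ((1 + 2 * (u ^ 2 * H * h)) / (u ^ 2 * H * h)) *
        (gaussianPDFReal 0 1 u / u *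
        (exp (u ^ 2 * c * η ^ 2 / (2 * (1 - η) ^ 2)) * pickandsMean B H μ l ^ 2)) +
      exp (-(θ * u) + θ ^ 2 * τ₀ ^ (2 * H) / 2) * pickandsMean B H μ L ^ 2 := by
  classical
  refine hB.measure_lt_iSup_le hT.le fun n s τ hs hτ => ?_
  have hnear := hB.measureReal_exists_near_le hH hH2 hl (ι := {i // τ₀ ≤ τ i})
    (s := fun i => s i) (τ := fun i => τ i) hT (fun i => hs i) (fun i => ⟨hτ₀.trans i.2, (hτ i).2⟩)
    hh h4 hc1 (fun i => hc.trans (mul_le_mul_of_nonneg_left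
      (Real.rpow_le_rpow (by linarith) i.2 (by positivity)) (by linarith))) hu hk hkl hη hη1 hcond
  have hfar := hB.measureReal_exists_increment_le hH hL (ι := {i // ¬ τ₀ ≤ τ i})
    (a := fun i => s i) (b := fun i => s i + τ i) (τ₀ := τ₀) (A := T + 1) u
    (fun i => ⟨(hs i).1, by linarith [(hs i).2]⟩)
    (fun i => ⟨add_nonneg (hs i).1 (hτ i).1, add_le_add (hs i).2 (hτ i).2⟩)
    (fun i => by
      rw [add_sub_cancel_left, abs_of_nonneg (hτ i).1]
      exact (not_le.1 i.2).le) hθ hL'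
  refine le_trans ?_ (add_le_add hnear hfar)
  refine (measureReal_mono ?_ (measure_ne_top _ _)).trans (measureReal_union_le _ _)
  rintro ω ⟨i, hi⟩
  by_cases h0 : τ₀ ≤ τ i
  · exact Or.inl ⟨⟨i, h0⟩, hi⟩
  · exact Or.inr ⟨⟨i, h0⟩, hi⟩

omit [IsProbabilityMeasure μ] in
lemma integrable_of_pickandsMean_pos {l : ℝ} (h : 0 < l⁻¹ * pickandsMean B H μ l) :
    Integrable (fun ω => exp (⨆ t : Icc (0:ℝ) l, (√2 * B (t:ℝ) ω - (t:ℝ) ^ (2 * H)))) μ := by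
  by_contra hcon
  rw [pickandsMean, integral_undef hcon, mul_zero] at h
  exact h.false

/-- Eventual bound for the normalized tail of the Shepp statistic. -/
lemma eventually_ratio_le (hB : IsFBM B H μ) (hH : 0 < H) (hH2 : H < 1 / 2) {HH : ℝ} (hHH : 0 < HH)
    (hP : Tendsto (fun l => l⁻¹ * pickandsMean B H μ l) atTop (nhds HH)) {T : ℝ} (hT : 0 < T)
    {R : ℝ} (hR : T / H * (1 / 2 : ℝ) ^ (1 / H) * HH ^ 2 < R) :
    ∀ᶠ u in atTop, (μ {ω | u < ⨆ (τ : Icc (0:ℝ) 1) (s : Icc (0:ℝ) T),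
      (B ((s:ℝ) + (τ:ℝ)) ω - B (s:ℝ) ω)}).toReal / (u ^ (2 / H - 2) * stdNormalTail u) ≤ R := by
  obtain ⟨q, hq, hq1⟩ : ∃ q : ℝ, T / H * (q / 2) ^ (1 / H) * HH ^ 2 < R ∧ 1 < q := by
    have hc : ContinuousAt (fun q : ℝ => T / H * (q / 2) ^ (1 / H) * HH ^ 2) 1 := by
      refine (continuousAt_const.mul ?_).mul continuousAt_const
      exact (continuousAt_id.div_const 2).rpow_const (Or.inl (by norm_num))
    exact (((hc.tendsto.mono_left nhdsWithin_le_nhds).eventually_lt_const hR).and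
      (self_mem_nhdsWithin (s := Ioi 1))).exists
  obtain ⟨τ₀, hτq, hτ1, hτ2⟩ : ∃ x : ℝ, ((x ^ (2 * H))⁻¹) ^ 2 < q ∧ 1 / 2 < x ∧ x < 1 := by
    have hc : ContinuousAt (fun x : ℝ => ((x ^ (2 * H))⁻¹) ^ 2) 1 :=
      ((continuousAt_id.rpow_const (Or.inl (by norm_num))).inv₀ (by norm_num)).pow 2
    have h1 : ((fun x : ℝ => ((x ^ (2 * H))⁻¹) ^ 2) 1) < q := by simpa using hq1
    exact (((hc.tendsto.eventually_lt_const h1).and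
      (lt_mem_nhds (by norm_num : (1 / 2 : ℝ) < 1))).filter_mono nhdsWithin_le_nhds |>.and
      (self_mem_nhdsWithin (s := Iio (1:ℝ)))).exists.imp fun x hx => ⟨hx.1.1, hx.1.2, hx.2⟩
  set S := τ₀ ^ (2 * H) with hS
  have hS0 : 0 < S := Real.rpow_pos_of_pos (by linarith) _
  have hS1 : S < 1 := Real.rpow_lt_one (by linarith) hτ2 (by positivity)
  set K := (q / 2) ^ (1 / (2 * H)) with hK
  have hq0 : 0 < q / 2 := by linarith
  have hK0 : 0 < K := Real.rpow_pos_of_pos hq0 _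
  have hK2 : K ^ 2 = (q / 2) ^ (1 / H) := by
    rw [hK, ← Real.rpow_natCast, ← Real.rpow_mul hq0.le]
    congr 1
    field_simp
    norm_num
  have hKH : K ^ (2 * H) = q / 2 := by
    rw [hK, ← Real.rpow_mul hq0.le, one_div_mul_cancel (by positivity), Real.rpow_one]
  obtain ⟨l, ⟨hlR, hl0⟩, hlP⟩ : ∃ l, (T / ((l / K) ^ 2 * H) * pickandsMean B H μ l ^ 2 < R ∧ 0 < l) ∧
      0 < l⁻¹ * pickandsMean B H μ l := by
    have h1 := ((hP.pow 2).const_mul (T / H * (q / 2) ^ (1 / H))).eventually_lt_const hq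
    refine (((h1.and (eventually_gt_atTop 0)).mono fun l hl => ⟨?_, hl.2⟩).and
      (hP.eventually_const_lt hHH)).exists
    have hl0 := hl.2
    refine lt_of_eq_of_lt ?_ hl.1
    rw [← hK2]
    field_simp
  have hl := integrable_of_pickandsMean_pos hlP
  set C := l / K with hC
  have hC0 : 0 < C := div_pos hl0 hK0
  obtain ⟨h, hh⟩ : ∃ h : ℝ → ℝ, h = fun u => C * u ^ (-(1 / H)) := ⟨_, rfl⟩
  obtain ⟨η, hη⟩ : ∃ η : ℝ → ℝ,
      η = fun u => S⁻¹ * (1 + 8 * h u ^ (1 - 2 * H)) * h u ^ (2 * H) := ⟨_, rfl⟩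
  have hcond := eventually_box_conditions hH hH2 hh hτq hη
  have hmain := tendsto_main_term hH hH2 hC0 hh hη T (pickandsMean B H μ l ^ 2)
  have hfar := tendsto_far_term (H := H) (A := T + 1) (D := HH + 1) hS0 hS1
  have hsum := hmain.add hfar
  rw [add_zero] at hsum
  have hLtop : Tendsto (fun u : ℝ => (u / S) ^ (1 / H) * (T + 1)) atTop atTop :=
    ((tendsto_rpow_atTop (by positivity)).comp (tendsto_id.atTop_div_const hS0)).atTop_mul_const
      (by linarith)
  have hLlow := (hP.comp hLtop).eventually_const_lt hHH
  have hLup := (hP.comp hLtop).eventually_lt_const (lt_add_one HH)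
  filter_upwards [hcond, hsum.eventually_lt_const hlR, hLlow, hLup, eventually_gt_atTop 0]
    with u ⟨c1, c2, c3⟩ hsu hlow hup hu
  have hhu : 0 < h u := by rw [hh]; positivity
  set L := (u / S) ^ (1 / H) * (T + 1) with hL
  have hL0 : 0 < L := by positivity
  have hk : K * u ^ (1 / H) * h u = l := by
    rw [hh, hC]
    simp only
    rw [Real.rpow_neg hu.le]
    field_simp
  have hk2 : 2 * (K * u ^ (1 / H)) ^ (2 * H) = q * u ^ 2 := by
    rw [Real.mul_rpow hK0.le (by positivity), hKH, ← Real.rpow_mul hu.le,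
      show 1 / H * (2 * H) = 2 by field_simp, Real.rpow_two]
    ring
  have key := hB.measure_lt_iSup_le_add hH hH2 hl (integrable_of_pickandsMean_pos hlow) hT hhu c1
    hτ1.le ((one_le_inv₀ hS0).2 hS1.le) (by rw [inv_mul_cancel₀ hS0.ne']) hu
    (k := K * u ^ (1 / H)) (by positivity) hk.le (congrFun hη u) c2 (c3.trans_eq hk2.symm)
    (θ := u / S) (by positivity) (le_refl L)
  have hPL : pickandsMean B H μ L ≤ (HH + 1) * L := by
    have : L⁻¹ * pickandsMean B H μ L ≤ HH + 1 := hup.le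
    rwa [inv_mul_le_iff₀ hL0, mul_comm L] at this
  have hPL0 : 0 ≤ pickandsMean B H μ L := integral_nonneg fun _ => (Real.exp_pos _).le
  refine (div_rpow_mul_stdNormalTail_le hu ENNReal.toReal_nonneg).trans (le_trans ?_ hsu.le)
  have hφ : 0 < gaussianPDFReal 0 1 u := gaussianPDFReal_pos 0 1 u (by norm_num)
  rw [← add_div, ← add_mul]
  have := key.trans (add_le_add_right (mul_le_mul_of_nonneg_left
    (pow_le_pow_left₀ hPL0 hPL 2) (Real.exp_pos _).le) _)
  gcongr

end IsFBM

/-- Upper asymptotic bound for the Shepp statistics of fBm, `H ∈ (0,1/2)`: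
`limsup_{u→∞} P(M_H(T) > u)/(u^{2/H-2} Ψ(u)) ≤ (T/H) (1/2)^{1/H} 𝓗_{2H}²`. -/
theorem shepp_fbm_tail_limsup
    {Ω : Type*} [MeasurableSpace Ω] (μ : Measure Ω) [IsProbabilityMeasure μ]
    (H : ℝ) (hH : H ∈ Set.Ioo (0:ℝ) (1/2))
    (B : ℝ → Ω → ℝ)
    (hmeas : ∀ t : ℝ, Measurable (B t))
    (hzero : ∀ ω, B 0 ω = 0)
    (hcont : ∀ᵐ ω ∂μ, Continuous fun t => B t ω)
    (hgauss : ∀ (n : ℕ) (c : Fin n → ℝ) (t : Fin n → ℝ),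
      ∃ v : NNReal, μ.map (fun ω => ∑ i, c i * B (t i) ω) =
        ProbabilityTheory.gaussianReal 0 v)
    (hcov : ∀ t s : ℝ, 0 ≤ t → 0 ≤ s →
      ∫ ω, B t ω * B s ω ∂μ = (t ^ (2*H) + s ^ (2*H) - |t - s| ^ (2*H)) / 2)
    (HH : ℝ) (hHH : 0 < HH)
    (hPick : Tendsto (fun lam : ℝ => lam⁻¹ *
        ∫ ω, Real.exp (⨆ t : Set.Icc (0:ℝ) lam,
          (Real.sqrt 2 * B (t:ℝ) ω - (t:ℝ) ^ (2*H))) ∂μ) atTop (nhds HH))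
    (T : ℝ) (hT : 0 < T) :
    Filter.limsup (fun u : ℝ =>
        (μ {ω | u < ⨆ (τ : Set.Icc (0:ℝ) (1)) (s : Set.Icc (0:ℝ) (T)),
            (B ((s:ℝ) + (τ:ℝ)) ω - B (s:ℝ) ω)}).toReal /
          (u ^ (2/H - 2) * stdNormalTail u)) atTop ≤
      (T / H) * ((1/2 : ℝ) ^ (1/H)) * HH ^ 2 := by
  have hB : IsFBM B H μ := ⟨hmeas, hcont, hgauss, hcov⟩
  refine le_of_forall_pos_le_add fun ρ hρ => Filter.limsup_le_of_le ?_
    (hB.eventually_ratio_le hH.1 hH.2 hHH hPick hT (lt_add_of_pos_right _ hρ))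
  refine Filter.IsBoundedUnder.isCoboundedUnder_le ⟨0, ?_⟩
  rw [eventually_map]
  filter_upwards [eventually_gt_atTop 0] with u hu
  have : 0 ≤ stdNormalTail u := ENNReal.toReal_nonneg
  positivity
end

section
/- Let H ∈ (0,1) and ε ∈ (0, H), and set δ_u = (ln u)² / u². There exists a constant C > 0 such that for every T > 0 and all sufficiently large u, P( max_{τ ∈ [0, 1 − δ_u], s ∈ [0, T]} Z_H(τ, s) > u ) ≤ C · T · u^{2/H − 1} · exp( −u²/2 − (H − ε)(ln u)² ), where C does not depend on T or u. -/
open MeasureTheory ProbabilityTheory Real Filter Set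

theorem measure_ge_le_of_map_eq_gaussianReal {Ω : Type*} [MeasurableSpace Ω] {μ : Measure Ω}
    [IsProbabilityMeasure μ] {X : Ω → ℝ} (hX : AEMeasurable X μ) {v : NNReal}
    (hlaw : μ.map X = gaussianReal 0 v) {w x : ℝ} (hvw : v ≤ w) (hx : 0 ≤ x) :
    μ {ω | x ≤ X ω} ≤ ENNReal.ofReal (exp (-x ^ 2 / (2 * w))) := by
  have hw : 0 ≤ w := v.coe_nonneg.trans hvw
  have hsub : HasSubgaussianMGF X ⟨w, hw⟩ μ := by
    refine ⟨fun t => ?_, fun t => ?_⟩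
    · have h := integrable_exp_mul_gaussianReal (μ := 0) (v := v) t
      rw [← hlaw] at h
      exact h.comp_aemeasurable hX
    · rw [mgf_gaussianReal hlaw, zero_mul, zero_add]
      change exp (v * t ^ 2 / 2) ≤ exp (w * t ^ 2 / 2)
      gcongr
  have h := hsub.measure_ge_le hx
  rw [← ofReal_measureReal]
  exact ENNReal.ofReal_le_ofReal h

theorem map_sub_eq_gaussianReal_of_fbm {Ω : Type*} [MeasurableSpace Ω] {μ : Measure Ω}
    [IsProbabilityMeasure μ] {H : ℝ} (hH : 0 < H) {B : ℝ → Ω → ℝ}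
    (hmeas : ∀ t : ℝ, Measurable (B t))
    (hgauss : ∀ (n : ℕ) (c : Fin n → ℝ) (t : Fin n → ℝ),
      ∃ v : NNReal, μ.map (fun ω => ∑ i, c i * B (t i) ω) = gaussianReal 0 v)
    (hcov : ∀ t s : ℝ, 0 ≤ t → 0 ≤ s →
      ∫ ω, B t ω * B s ω ∂μ = (t ^ (2 * H) + s ^ (2 * H) - |t - s| ^ (2 * H)) / 2)
    {t s : ℝ} (ht : 0 ≤ t) (hs : 0 ≤ s) :
    μ.map (fun ω => B t ω - B s ω) = gaussianReal 0 (|t - s| ^ (2 * H)).toNNReal := by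
  have hL2 : ∀ r, MemLp (B r) 2 μ := by
    intro r
    obtain ⟨v, hv⟩ := hgauss 1 (fun _ => 1) (fun _ => r)
    simp only [Finset.univ_unique, one_mul, Finset.sum_const, Finset.card_singleton,
      one_smul] at hv
    have h := memLp_id_gaussianReal' (μ := 0) (v := v) 2 (by simp)
    rw [← hv] at h
    exact h.comp_of_map (hmeas r).aemeasurable
  obtain ⟨v, hv⟩ := hgauss 2 ![1, -1] ![t, s]
  simp only [Fin.sum_univ_two, Matrix.cons_val_zero, Matrix.cons_val_one, one_mul, neg_one_mul,
    ← sub_eq_add_neg] at hv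
  rw [hv]
  congr 1
  have hm : AEMeasurable (fun ω => B t ω - B s ω) μ := ((hmeas t).sub (hmeas s)).aemeasurable
  have hvar : (v : ℝ) = ∫ ω, (B t ω - B s ω) ^ 2 ∂μ := by
    have h1 : Var[id; gaussianReal 0 v] = v := variance_id_gaussianReal
    rw [variance_eq_integral aemeasurable_id] at h1
    simp only [id, integral_id_gaussianReal, sub_zero] at h1
    rw [← h1, ← hv, integral_map hm (by fun_prop)]
  have hmul : ∀ a b, Integrable (fun ω => B a ω * B b ω) μ := fun a b =>
    (hL2 a).integrable_mul (hL2 b)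
  have hexp : ∫ ω, (B t ω - B s ω) ^ 2 ∂μ = |t - s| ^ (2 * H) := by
    have : (fun ω => (B t ω - B s ω) ^ 2) =
        fun ω => B t ω * B t ω - 2 * (B t ω * B s ω) + B s ω * B s ω := by
      ext ω; ring
    rw [this, integral_add (f := fun ω => B t ω * B t ω - 2 * (B t ω * B s ω))
        ((hmul t t).sub ((hmul t s).const_mul 2)) (hmul s s),
      integral_sub (hmul t t) ((hmul t s).const_mul 2), integral_const_mul,
      hcov t t ht ht, hcov t s ht hs, hcov s s hs hs]
    simp only [sub_self, abs_zero, Real.zero_rpow (by positivity : 2 * H ≠ 0)]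
    ring
  rw [← hexp, ← hvar, Real.toNNReal_coe]

theorem abs_sub_apply_floor_le {f : ℝ → ℝ} (hf : Continuous f) {h S A : ℝ} (hh : 0 < h)
    {x : ℕ → ℝ} (hx0 : ∀ n, 0 ≤ x n) (hx : ∀ n, ∑ i ∈ Finset.range n, x i ≤ A)
    (hinc : ∀ n k : ℕ, k * (h / 2 ^ (n + 1)) ≤ S →
      |f ((k + 1 : ℕ) * (h / 2 ^ (n + 1))) - f (k * (h / 2 ^ (n + 1)))| ≤ x n)
    {t : ℝ} (ht : 0 ≤ t) (htS : t ≤ S) :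
    |f t - f (⌊t / h⌋₊ * h)| ≤ A := by
  set p : ℕ → ℝ := fun n => ⌊t / (h / 2 ^ n)⌋₊ * (h / 2 ^ n) with hp
  have hstep : ∀ n, |f (p (n + 1)) - f (p n)| ≤ x n := by
    intro n
    set d := h / 2 ^ (n + 1) with hd
    have hd0 : 0 < d := by positivity
    have hdn : h / 2 ^ n = 2 * d := by rw [hd, pow_succ]; field_simp
    set m := ⌊t / (h / 2 ^ n)⌋₊ with hm
    have h1 : (m : ℝ) ≤ t / (2 * d) := by rw [← hdn]; exact Nat.floor_le (by positivity)
    have h2 : t / (2 * d) < m + 1 := by rw [← hdn]; exact Nat.lt_floor_add_one _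
    rw [le_div_iff₀ (by positivity)] at h1
    rw [div_lt_iff₀ (by positivity)] at h2
    have hpn : p n = (2 * m : ℕ) * d := by
      change (m : ℝ) * (h / 2 ^ n) = _
      rw [hdn]; push_cast; ring
    have hcase : ⌊t / d⌋₊ = 2 * m ∨ ⌊t / d⌋₊ = 2 * m + 1 := by
      have h3 : 2 * m ≤ ⌊t / d⌋₊ := by
        apply Nat.le_floor
        rw [le_div_iff₀ hd0]; push_cast; linarith
      have h4 : ⌊t / d⌋₊ < 2 * m + 2 := by
        rw [Nat.floor_lt (by positivity), div_lt_iff₀ hd0]; push_cast; linarith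
      omega
    have hpn1 : p (n + 1) = ⌊t / d⌋₊ * d := rfl
    rcases hcase with hc | hc
    · rw [hpn1, hpn, hc, sub_self, abs_zero]; exact hx0 n
    · rw [hpn1, hpn, hc]
      apply hinc n (2 * m)
      push_cast; linarith
  have hsum : ∀ n, |f (p n) - f (p 0)| ≤ A := by
    intro n
    refine le_trans ?_ (hx n)
    rw [← Finset.sum_range_sub (fun i => f (p i))]
    exact (Finset.abs_sum_le_sum_abs _ _).trans (Finset.sum_le_sum fun i _ => hstep i)
  have hlim : Tendsto p atTop (nhds t) := by
    have hz : Tendsto (fun n : ℕ => h / 2 ^ n) atTop (nhds 0) := by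
      simpa [div_eq_mul_inv, inv_pow] using
        (tendsto_pow_atTop_nhds_zero_of_lt_one (r := (2 : ℝ)⁻¹) (by norm_num)
          (by norm_num)).const_mul h
    refine tendsto_of_tendsto_of_tendsto_of_le_of_le (g := fun n : ℕ => t - h / 2 ^ n)
      (by simpa using hz.const_sub t) tendsto_const_nhds (fun n => ?_) (fun n => ?_)
    · have hd : 0 < h / 2 ^ n := by positivity
      have := (Nat.lt_floor_add_one (t / (h / 2 ^ n))).le
      rw [div_le_iff₀ hd] at this
      simp only [hp]; linarith
    · have hd : 0 < h / 2 ^ n := by positivity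
      have := Nat.floor_le (show 0 ≤ t / (h / 2 ^ n) by positivity)
      rwa [le_div_iff₀ hd] at this
  have hp0 : p 0 = ⌊t / h⌋₊ * h := by simp [hp]
  rw [← hp0]
  exact le_of_tendsto ((((hf.tendsto t).comp hlim).sub_const _).abs)
    (Eventually.of_forall hsum)

theorem measure_iUnion_dyadic_le {Ω : Type*} [MeasurableSpace Ω] {μ : Measure Ω}
    {E : ℕ → ℕ → Set Ω} {h S p : ℝ} (hh : 0 < h) (hS : 0 ≤ S) (hp : 0 ≤ p)
    (hE : ∀ n k, μ (E n k) ≤ ENNReal.ofReal (p * (1 / 4) ^ (n + 1))) :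
    μ (⋃ n, ⋃ k ∈ Finset.range (⌊S / (h / 2 ^ (n + 1))⌋₊ + 1), E n k) ≤
      ENNReal.ofReal ((S / h + 1) * p) := by
  rw [← tsum_geometric_two' ((S / h + 1) * p),
    ENNReal.ofReal_tsum_of_nonneg (fun n => by positivity) (summable_geometric_two' _)]
  refine (measure_iUnion_le _).trans (ENNReal.tsum_le_tsum fun n => ?_)
  refine (measure_biUnion_finset_le _ _).trans ?_
  refine (Finset.sum_le_sum fun k _ => hE n k).trans ?_
  rw [Finset.sum_const, Finset.card_range, ← ENNReal.ofReal_nsmul]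
  apply ENNReal.ofReal_le_ofReal
  rw [nsmul_eq_mul]
  have hcard : ((⌊S / (h / 2 ^ (n + 1))⌋₊ + 1 : ℕ) : ℝ) ≤ (S / h + 1) * 2 ^ (n + 1) := by
    have h1 := Nat.floor_le (show 0 ≤ S / (h / 2 ^ (n + 1)) by positivity)
    have h2 : S / (h / 2 ^ (n + 1)) = S / h * 2 ^ (n + 1) := by field_simp
    have h3 : (1 : ℝ) ≤ 2 ^ (n + 1) := one_le_pow₀ (by norm_num)
    push_cast
    linarith
  calc _ ≤ (S / h + 1) * 2 ^ (n + 1) * (p * (1 / 4) ^ (n + 1)) := by gcongr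
    _ = _ := by
      rw [show (1 / 4 : ℝ) = (1 / 2) * (1 / 2) by norm_num, mul_pow]
      simp only [pow_succ, one_div, inv_pow]
      field_simp

theorem exp_neg_level_le {H L : ℝ} (hu : 4 ≤ exp (4 * L) * H) (m : ℕ) :
    exp (-(exp (-2 * L - H / 2 * (m * log 2))) ^ 2 /
      (2 * (exp (-4 * L / H) / 2 ^ m) ^ (2 * H))) ≤ exp (-exp (4 * L) / 2) * (1 / 4) ^ m := by
  have hH : H ≠ 0 := by rintro rfl; norm_num at hu
  have h2 : ∀ a : ℝ, exp a / 2 ^ m = exp (a - m * log 2) := by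
    intro a
    rw [exp_sub, mul_comm, ← rpow_def_of_pos two_pos, rpow_natCast]
  have h4 : (1 / 4 : ℝ) ^ m = exp (-2 * (m * log 2)) := by
    rw [show -2 * (m * log 2) = m * (-2 * log 2) by ring, exp_nat_mul,
      show -2 * log 2 = -(log (2 ^ 2)) by rw [log_pow]; push_cast; ring, exp_neg,
      exp_log (by norm_num)]
    norm_num
  have hw : (exp (-4 * L / H) / 2 ^ m) ^ (2 * H) = exp (-8 * L - 2 * H * (m * log 2)) := by
    rw [h2, ← exp_mul]
    congr 1
    field_simp
    ring
  have hq : -(exp (-2 * L - H / 2 * (m * log 2))) ^ 2 /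
      (2 * exp (-8 * L - 2 * H * (m * log 2))) = -(exp (4 * L) * exp (H * (m * log 2))) / 2 := by
    rw [← exp_add, ← exp_nat_mul, neg_div, neg_div, div_mul_eq_div_div_swap, ← exp_sub]
    congr 3
    push_cast
    ring
  rw [hw, hq, h4, ← exp_add (-exp (4 * L) / 2), exp_le_exp]
  have hb := add_one_le_exp (H * (m * log 2))
  have hlog : 0 ≤ m * log 2 := by positivity
  have hc : exp (4 * L) * (H * (m * log 2) + 1) ≤ exp (4 * L) * exp (H * (m * log 2)) := by
    gcongr
  nlinarith

theorem sum_exp_geometric_le {H : ℝ} (hH : 0 < H) (L : ℝ) (n : ℕ) :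
    ∑ i ∈ Finset.range n, exp (-2 * L - H / 2 * ((i + 1 : ℕ) * log 2)) ≤
      exp (-2 * L) * (1 - exp (-(H / 2 * log 2)))⁻¹ := by
  have hq : exp (-(H / 2 * log 2)) < 1 := by
    rw [exp_lt_one_iff, neg_lt_zero]
    have := log_pos (by norm_num : (1 : ℝ) < 2)
    positivity
  calc _ ≤ ∑ i ∈ Finset.range n, exp (-2 * L) * exp (-(H / 2 * log 2)) ^ i := by
        refine Finset.sum_le_sum fun i _ => ?_
        rw [← exp_nat_mul, ← exp_add, exp_le_exp]
        push_cast
        have : 0 < H / 2 * log 2 := by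
          have := log_pos (by norm_num : (1 : ℝ) < 2)
          positivity
        nlinarith
    _ = exp (-2 * L) * ∑ i ∈ Finset.range n, exp (-(H / 2 * log 2)) ^ i := by
        rw [Finset.mul_sum]
    _ ≤ _ := by
        gcongr
        rw [← tsum_geometric_of_lt_one (exp_nonneg _) hq]
        exact (summable_geometric_of_lt_one (exp_nonneg _) hq).sum_le_tsum _
          (fun _ _ => by positivity)

theorem exp_neg_main_le {H u h δ : ℝ} (hu : 1 ≤ u) (hH0 : 0 < H) (hH1 : H < 1)
    (hδ : δ ≤ 1) (hδ0 : 0 ≤ δ) (hh0 : 0 ≤ h) (hh : h * u ^ 2 ≤ 1) :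
    exp (-(u - 1 / u) ^ 2 / (2 * exp (-(δ - h)) ^ (2 * H))) ≤
      exp 4 * exp (-u ^ 2 / 2 - H * (u ^ 2 * δ)) := by
  have hu0 : 0 < u := by linarith
  rw [← exp_mul, ← exp_add, exp_le_exp, neg_div, div_mul_eq_div_div, div_eq_mul_inv _ (exp _),
    ← exp_neg]
  have hsq : u ^ 2 - 2 ≤ (u - 1 / u) ^ 2 := by
    have : (u - 1 / u) ^ 2 = u ^ 2 - 2 + (1 / u) ^ 2 := by field_simp; ring
    nlinarith [sq_nonneg (1 / u)]
  have he := add_one_le_exp (-(-(δ - h) * (2 * H)))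
  have hexp0 := exp_pos (-(-(δ - h) * (2 * H)))
  set e := exp (-(-(δ - h) * (2 * H)))
  set y := (u - 1 / u) ^ 2
  have hy0 : 0 ≤ y := sq_nonneg _
  have hyu : y ≤ u ^ 2 := by
    have h1 : 1 / u ≤ 1 := by rw [div_le_one hu0]; exact hu
    have h2 : 0 < 1 / u := by positivity
    exact pow_le_pow_left₀ (by linarith) (by linarith) 2
  have h1 : y * (1 + 2 * H * δ - 2 * H * h) ≤ y * e := by
    gcongr
    linarith
  have h2 : (u ^ 2 - 2) * (1 + 2 * H * δ) ≤ y * (1 + 2 * H * δ) := by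
    gcongr
  have h3 : y * (2 * H * h) ≤ 2 * H := by
    calc y * (2 * H * h) ≤ u ^ 2 * (2 * H * h) := by gcongr
      _ = 2 * H * (h * u ^ 2) := by ring
      _ ≤ 2 * H * 1 := by gcongr
      _ = _ := by ring
  have h4 : H * δ ≤ 1 := by nlinarith
  nlinarith

theorem eventually_polynomial_le_exp_sq_log {H ε K : ℝ} (hε : 0 < ε) :
    ∀ᶠ u : ℝ in atTop, K * exp (4 * log u / H) ^ 2 ≤ exp (ε * log u ^ 2) := by
  have h1 : Tendsto (fun L : ℝ => exp (L * (ε * L - 8 / H))) atTop atTop := by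
    refine tendsto_exp_atTop.comp (tendsto_id.atTop_mul_atTop₀ ?_)
    exact tendsto_atTop_add_const_right _ _ (tendsto_id.const_mul_atTop hε)
  filter_upwards [(h1.comp tendsto_log_atTop).eventually_ge_atTop K] with u hu
  simp only [Function.comp] at hu
  calc _ ≤ exp (log u * (ε * log u - 8 / H)) * exp (4 * log u / H) ^ 2 := by gcongr
    _ = _ := by
      rw [← exp_nat_mul, ← exp_add]
      congr 1
      push_cast
      ring

theorem union_bound_le_of_polynomial_le {H ε T u N : ℝ} (hT : 0 < T) (hH0 : 0 < H) (hH1 : H < 1)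
    (hu : 2 ≤ u) (hN1 : 1 ≤ N) (hN : N ≤ (T + 2) * exp (4 * log u / H))
    (hpoly : (T + 2) ^ 2 * (exp 4 + 2) / T * exp (4 * log u / H) ^ 2 ≤ exp (ε * log u ^ 2)) :
    N * (2 * exp (-u ^ 4 / 2)) + N ^ 2 * (exp 4 * exp (-u ^ 2 / 2 - H * log u ^ 2)) ≤
      T * u ^ (2 / H - 1) * exp (-(u ^ 2) / 2 - (H - ε) * log u ^ 2) := by
  have hL0 : 0 ≤ log u := log_nonneg (by linarith)
  have hLu : log u ≤ u := (log_le_sub_one_of_pos (by linarith)).trans (by linarith)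
  set L := log u
  have hexp : exp (-u ^ 4 / 2) ≤ exp (-u ^ 2 / 2 - H * L ^ 2) := by
    rw [exp_le_exp]
    have h1 : L ^ 2 ≤ u ^ 2 := pow_le_pow_left₀ hL0 hLu 2
    have h2 : H * L ^ 2 ≤ u ^ 2 := by nlinarith [sq_nonneg L]
    have h3 : 4 ≤ u ^ 2 := by nlinarith
    have h4 : u ^ 4 = u ^ 2 * u ^ 2 := by ring
    nlinarith
  have hN2 : N ≤ N ^ 2 := by nlinarith
  have hrpow : 1 ≤ u ^ (2 / H - 1) := by
    apply one_le_rpow (by linarith)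
    have : 2 ≤ 2 / H := le_div_self (by norm_num) hH0 hH1.le
    linarith
  have hNT : (exp 4 + 2) * N ^ 2 ≤ T * exp (ε * L ^ 2) := by
    calc (exp 4 + 2) * N ^ 2 ≤ (exp 4 + 2) * ((T + 2) * exp (4 * L / H)) ^ 2 := by gcongr
      _ = T * ((T + 2) ^ 2 * (exp 4 + 2) / T * exp (4 * L / H) ^ 2) := by field_simp
      _ ≤ _ := by gcongr
  calc _ ≤ N ^ 2 * (2 * exp (-u ^ 2 / 2 - H * L ^ 2)) +
          N ^ 2 * (exp 4 * exp (-u ^ 2 / 2 - H * L ^ 2)) := by gcongr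
    _ = (exp 4 + 2) * N ^ 2 * exp (-u ^ 2 / 2 - H * L ^ 2) := by ring
    _ ≤ T * exp (ε * L ^ 2) * exp (-u ^ 2 / 2 - H * L ^ 2) := by gcongr
    _ = T * 1 * exp (-(u ^ 2) / 2 - (H - ε) * L ^ 2) := by
      rw [mul_assoc, ← exp_add, mul_one]
      congr 2
      ring
    _ ≤ _ := by gcongr

/-- Lemma 3.1: with `δ_u = (ln u)²/u²`, there is `C > 0` (independent of `T` and `u`)
such that for every `T > 0` and all large `u`,
`P(max_{τ∈[0,1-δ_u], s∈[0,T]} Z_H(τ,s) > u) ≤ C T u^{2/H-1} exp(-u²/2 - (H-ε)(ln u)²)`. -/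
theorem shepp_fbm_away_from_max_variance
    {Ω : Type*} [MeasurableSpace Ω] (μ : Measure Ω) [IsProbabilityMeasure μ]
    (H : ℝ) (hH : H ∈ Set.Ioo (0:ℝ) (1))
    (B : ℝ → Ω → ℝ)
    (hmeas : ∀ t : ℝ, Measurable (B t))
    (hzero : ∀ ω, B 0 ω = 0)
    (hcont : ∀ᵐ ω ∂μ, Continuous fun t => B t ω)
    (hgauss : ∀ (n : ℕ) (c : Fin n → ℝ) (t : Fin n → ℝ),
      ∃ v : NNReal, μ.map (fun ω => ∑ i, c i * B (t i) ω) =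
        ProbabilityTheory.gaussianReal 0 v)
    (hcov : ∀ t s : ℝ, 0 ≤ t → 0 ≤ s →
      ∫ ω, B t ω * B s ω ∂μ = (t ^ (2*H) + s ^ (2*H) - |t - s| ^ (2*H)) / 2)
    (ε : ℝ) (hε : ε ∈ Set.Ioo (0:ℝ) H) :
    ∃ C : ℝ, 0 < C ∧ ∀ T : ℝ, 0 < T → ∀ᶠ u : ℝ in atTop,
      (μ {ω | u < ⨆ (τ : Set.Icc (0:ℝ) (1 - (Real.log u)^2 / u^2)) (s : Set.Icc (0:ℝ) (T)),
            (B ((s:ℝ) + (τ:ℝ)) ω - B (s:ℝ) ω)}).toReal ≤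
        C * T * u ^ (2/H - 1) * Real.exp (-(u^2)/2 - (H - ε) * (Real.log u)^2) := by
  obtain ⟨hH0, hH1⟩ := hH
  obtain ⟨hε0, -⟩ := hε
  refine ⟨1, one_pos, fun T hT => ?_⟩
  have htail : ∀ {t s w x : ℝ}, 0 ≤ t → 0 ≤ s → |t - s| ^ (2 * H) ≤ w → 0 ≤ x →
      μ {ω | x ≤ B t ω - B s ω} ≤ ENNReal.ofReal (exp (-x ^ 2 / (2 * w))) := by
    intro t s w x ht hs hw hx
    refine measure_ge_le_of_map_eq_gaussianReal ((hmeas t).sub (hmeas s)).aemeasurable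
      (map_sub_eq_gaussianReal_of_fbm hH0 hmeas hgauss hcov ht hs) ?_ hx
    rwa [Real.coe_toNNReal _ (by positivity)]
  set A₀ := (1 - exp (-(H / 2 * log 2)))⁻¹
  have hu4 : Tendsto (fun u : ℝ => u ^ 4 * H) atTop atTop :=
    (tendsto_pow_atTop (by norm_num)).atTop_mul_const hH0
  filter_upwards [eventually_ge_atTop 2, eventually_ge_atTop (2 * A₀),
    hu4.eventually_ge_atTop 4, eventually_polynomial_le_exp_sq_log (H := H)
      (K := (T + 2) ^ 2 * (exp 4 + 2) / T) hε0] with u hu2 huA hu4 hpoly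
  have hu0 : 0 < u := by linarith
  set L := log u with hL
  have hexpL : exp L = u := exp_log hu0
  have hL0 : 0 ≤ L := log_nonneg (by linarith)
  have hLu : L ≤ u := (log_le_sub_one_of_pos hu0).trans (by linarith)
  have hexp4 : exp (4 * L) = u ^ 4 := by rw [← hexpL, ← exp_nat_mul]; norm_num
  set h := exp (-4 * L / H) with hh
  have hh0 : 0 < h := exp_pos _
  have hinv : h⁻¹ = exp (4 * L / H) := by rw [hh, ← exp_neg]; congr 1; ring
  have hhu : h * u ^ 2 ≤ 1 := by
    rw [← hexpL, ← exp_nat_mul, hh, ← exp_add, exp_le_one_iff]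
    have : 4 * L ≤ 4 * L / H := le_div_self (by positivity) hH0 hH1.le
    push_cast
    rw [neg_mul, neg_div]
    linarith
  set δ := L ^ 2 / u ^ 2 with hδ
  have hδ0 : 0 ≤ δ := by positivity
  have hδ1 : δ ≤ 1 := by
    rw [hδ, div_le_one (by positivity)]
    exact pow_le_pow_left₀ hL0 hLu 2
  have hδu : u ^ 2 * δ = L ^ 2 := by rw [hδ]; field_simp
  set N := (T + 1) / h + 1 with hN
  have hN1 : 1 ≤ N := by rw [hN]; linarith [show 0 ≤ (T + 1) / h by positivity]
  have hNle : N ≤ (T + 2) * exp (4 * L / H) := by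
    rw [hN, div_eq_mul_inv, hinv]
    have : 1 ≤ exp (4 * L / H) := one_le_exp (by positivity)
    linarith
  set K := ⌊(T + 1) / h⌋₊ + 1 with hK
  have hKN : (K : ℝ) ≤ N := by
    rw [hK, hN]
    push_cast
    linarith [Nat.floor_le (show 0 ≤ (T + 1) / h by positivity)]
  set x : ℕ → ℝ := fun n => exp (-2 * L - H / 2 * ((n + 1 : ℕ) * log 2))
  have hxsum : ∀ n, ∑ i ∈ Finset.range n, x i ≤ exp (-2 * L) * A₀ := sum_exp_geometric_le hH0 L
  have hosc : 2 * (exp (-2 * L) * A₀) ≤ 1 / u := by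
    have : exp (-2 * L) = 1 / u ^ 2 := by
      rw [← hexpL, ← exp_nat_mul, neg_mul, exp_neg]; norm_num
    rw [this, le_div_iff₀ hu0]
    have : 2 * (1 / u ^ 2 * A₀) * u = 2 * A₀ / u := by field_simp
    rw [this, div_le_one hu0]
    exact huA
  set p := 2 * exp (-exp (4 * L) / 2) with hp
  set E : ℕ → ℕ → Set Ω := fun n k =>
    {ω | x n ≤ |B ((k + 1 : ℕ) * (h / 2 ^ (n + 1))) ω - B (k * (h / 2 ^ (n + 1))) ω|}
  have hEle : ∀ n k, μ (E n k) ≤ ENNReal.ofReal (p * (1 / 4) ^ (n + 1)) := by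
    intro n k
    set a : ℝ := (k + 1 : ℕ) * (h / 2 ^ (n + 1)) with ha
    set b : ℝ := k * (h / 2 ^ (n + 1)) with hb
    have hd0 : 0 < h / 2 ^ (n + 1) := by positivity
    have hab : a - b = h / 2 ^ (n + 1) := by rw [ha, hb]; push_cast; ring
    have ha0 : 0 ≤ a := by positivity
    have hb0 : 0 ≤ b := by positivity
    have hlev := exp_neg_level_le (H := H) (L := L) (by rw [hexp4]; exact hu4) (n + 1)
    have hsub : E n k ⊆ {ω | x n ≤ B a ω - B b ω} ∪ {ω | x n ≤ B b ω - B a ω} := by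
      intro ω hω
      have hω' : x n ≤ |B a ω - B b ω| := hω
      rcases le_abs.1 hω' with h1 | h1
      · exact Or.inl h1
      · exact Or.inr (by simpa using h1)
    refine (measure_mono hsub).trans ((measure_union_le _ _).trans ?_)
    have h1 := htail (x := x n) ha0 hb0 (by rw [hab, abs_of_pos hd0]) (exp_nonneg _)
    have h2 := htail (x := x n) hb0 ha0 (by rw [abs_sub_comm, hab, abs_of_pos hd0])
      (exp_nonneg _)
    refine (add_le_add h1 h2).trans ?_
    rw [← ENNReal.ofReal_add (exp_nonneg _) (exp_nonneg _)]
    apply ENNReal.ofReal_le_ofReal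
    rw [hp]
    linarith
  have hchain := measure_iUnion_dyadic_le hh0 (by positivity : 0 ≤ T + 1)
    (by positivity : 0 ≤ p) hEle
  set pairs := (Finset.range K ×ˢ Finset.range K).filter
    fun ij => |(ij.1 : ℝ) * h - ij.2 * h| ≤ exp (-(δ - h)) with hpairs
  set q := exp 4 * exp (-u ^ 2 / 2 - H * L ^ 2) with hq
  set F : ℕ × ℕ → Set Ω := fun ij => {ω | u - 1 / u ≤ B (ij.1 * h) ω - B (ij.2 * h) ω}
  have hinvu : 1 / u ≤ 1 := by rw [div_le_one hu0]; linarith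
  have hFle : μ (⋃ ij ∈ pairs, F ij) ≤ ENNReal.ofReal (N ^ 2 * q) := by
    refine (measure_biUnion_finset_le _ _).trans ?_
    have hone : ∀ ij ∈ pairs, μ (F ij) ≤ ENNReal.ofReal q := by
      intro ij hij
      have hclose := (Finset.mem_filter.1 hij).2
      refine (htail (by positivity) (by positivity)
        (rpow_le_rpow (abs_nonneg _) hclose (by positivity)) (by linarith)).trans ?_
      apply ENNReal.ofReal_le_ofReal
      rw [hq, ← hδu]
      exact exp_neg_main_le (by linarith) hH0 hH1 hδ1 hδ0 hh0.le hhu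
    refine (Finset.sum_le_sum hone).trans ?_
    rw [Finset.sum_const, ← ENNReal.ofReal_nsmul, nsmul_eq_mul]
    apply ENNReal.ofReal_le_ofReal
    have hcard : (pairs.card : ℝ) ≤ N ^ 2 := by
      have h1 : pairs.card ≤ K * K := by
        refine (Finset.card_filter_le _ _).trans ?_
        rw [Finset.card_product, Finset.card_range]
      calc (pairs.card : ℝ) ≤ (K * K : ℕ) := by exact_mod_cast h1
        _ = (K : ℝ) ^ 2 := by push_cast; ring
        _ ≤ N ^ 2 := by gcongr
    gcongr
  have hnull : μ {ω | ¬ Continuous fun t => B t ω} = 0 := hcont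
  set U := ⋃ n, ⋃ k ∈ Finset.range (⌊(T + 1) / (h / 2 ^ (n + 1))⌋₊ + 1), E n k
  set V := ⋃ ij ∈ pairs, F ij
  have hincl : {ω | u < ⨆ (τ : Set.Icc (0:ℝ) (1 - δ)) (s : Set.Icc (0:ℝ) T),
      (B ((s:ℝ) + (τ:ℝ)) ω - B (s:ℝ) ω)} ⊆
      (U ∪ V) ∪ {ω | ¬ Continuous fun t => B t ω} := by
    intro ω hω
    by_contra hnot
    simp only [Set.mem_union, not_or, Set.mem_ofPred_eq, not_not] at hnot
    obtain ⟨⟨hωU, hωV⟩, hωc⟩ := hnot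
    refine not_le.2 hω (Real.iSup_le (fun τ => Real.iSup_le (fun s => ?_) hu0.le) hu0.le)
    obtain ⟨τ, hτ0, hτ1⟩ := τ
    obtain ⟨s, hs0, hs1⟩ := s
    have hnear : ∀ t, 0 ≤ t → t ≤ T + 1 →
        |B t ω - B (⌊t / h⌋₊ * h) ω| ≤ exp (-2 * L) * A₀ := by
      intro t ht0 ht1
      refine abs_sub_apply_floor_le (f := fun t => B t ω) hωc hh0 (fun n => exp_nonneg _) hxsum
        (fun n k hk => ?_) ht0 ht1
      by_contra hlt
      refine hωU (Set.mem_iUnion.2 ⟨n, Set.mem_iUnion₂.2 ⟨k, ?_, (not_le.1 hlt).le⟩⟩)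
      rw [Finset.mem_range, Nat.lt_succ_iff]
      exact Nat.le_floor ((le_div_iff₀ (by positivity)).2 hk)
    have hst0 : 0 ≤ s + τ := by linarith
    have hst1 : s + τ ≤ T + 1 := by linarith
    have ha := abs_le.1 (hnear (s + τ) hst0 hst1)
    have hb := abs_le.1 (hnear s hs0 (by linarith))
    have hmem : ∀ t, t ≤ T + 1 → ⌊t / h⌋₊ ∈ Finset.range K := by
      intro t ht
      rw [Finset.mem_range, hK, Nat.lt_succ_iff]
      exact Nat.floor_le_floor (by gcongr)
    have hpair : (⌊(s + τ) / h⌋₊, ⌊s / h⌋₊) ∈ pairs := by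
      rw [hpairs, Finset.mem_filter, Finset.mem_product]
      refine ⟨⟨hmem _ hst1, hmem _ (by linarith)⟩, ?_⟩
      have h1 : (⌊s / h⌋₊ : ℝ) * h ≤ ⌊(s + τ) / h⌋₊ * h := by
        gcongr
        linarith
      have h2 := Nat.floor_le (show 0 ≤ (s + τ) / h by positivity)
      have h3 := Nat.lt_floor_add_one (s / h)
      rw [le_div_iff₀ hh0] at h2
      rw [div_lt_iff₀ hh0] at h3
      have h4 := add_one_le_exp (-(δ - h))
      change |(⌊(s + τ) / h⌋₊ : ℝ) * h - ⌊s / h⌋₊ * h| ≤ _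
      rw [abs_of_nonneg (by linarith)]
      linarith
    have hgrid : B (⌊(s + τ) / h⌋₊ * h) ω - B (⌊s / h⌋₊ * h) ω < u - 1 / u := by
      by_contra hge
      exact hωV (Set.mem_iUnion₂.2 ⟨_, hpair, not_lt.1 hge⟩)
    change B (s + τ) ω - B s ω ≤ u
    linarith
  have hfinal := union_bound_le_of_polynomial_le hT hH0 hH1 hu2 hN1 hNle hpoly
  refine ENNReal.toReal_le_of_le_ofReal (by positivity) ?_
  calc _ ≤ μ ((U ∪ V) ∪ {ω | ¬ Continuous fun t => B t ω}) := measure_mono hincl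
    _ ≤ μ U + μ V + μ {ω | ¬ Continuous fun t => B t ω} :=
      (measure_union_le _ _).trans (by gcongr; exact measure_union_le _ _)
    _ ≤ ENNReal.ofReal (N * p) + ENNReal.ofReal (N ^ 2 * q) := by
      rw [hnull, add_zero]
      gcongr
    _ = ENNReal.ofReal (N * p + N ^ 2 * q) :=
      (ENNReal.ofReal_add (by positivity) (by positivity)).symm
    _ ≤ _ := ENNReal.ofReal_le_ofReal (by
      rw [one_mul]
      rwa [← hL, ← hexp4] at hfinal)
end
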